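/- Let G be a locally graded insoluble parahamiltonian group. Then G is isomorphic to the alternating group A₅. -/

import Mathlib

/-- A group is *minimal non-nilpotent* if it is not nilpotent but every proper
subgroup of it is nilpotent. -/
def MinimalNonNilpotent (G : Type*) [Group G] : Prop :=
  ¬ Group.IsNilpotent G ∧ ∀ H : Subgroup G, H ≠ ⊤ → Group.IsNilpotent H

/-- A group is *biminimal non-nilpotent* if it is neither nilpotent nor minimal
non-nilpotent, but every proper subgroup of it is nilpotent or minimal non-nilpotent. -/
def BiminimalNonNilpotent (G : Type*) [Group G] : Prop :=
  ¬ Group.IsNilpotent G ∧ ¬ MinimalNonNilpotent G ∧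
    ∀ H : Subgroup G, H ≠ ⊤ → (Group.IsNilpotent H ∨ MinimalNonNilpotent H)

/-- A group is *para-Nil-Hamiltonian* if it is not nilpotent and every non-normal
subgroup of it is either nilpotent or minimal non-nilpotent. -/
def ParaNilHamiltonian (G : Type*) [Group G] : Prop :=
  ¬ Group.IsNilpotent G ∧
    ∀ H : Subgroup G, ¬ H.Normal → (Group.IsNilpotent H ∨ MinimalNonNilpotent H)

/-- A group is *meta-Nil-Hamiltonian* if every non-nilpotent subgroup of it is normal. -/
def MetaNilHamiltonian (G : Type*) [Group G] : Prop :=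
  ∀ H : Subgroup G, ¬ Group.IsNilpotent H → H.Normal

/-- A group is *locally graded* if every non-trivial finitely generated subgroup of it
contains a proper subgroup of finite index. -/
def LocallyGraded (G : Type*) [Group G] : Prop :=
  ∀ H : Subgroup G, H ≠ ⊥ → Group.FG H → ∃ K : Subgroup H, K ≠ ⊤ ∧ K.FiniteIndex

/-- A group is abelian if its multiplication commutes. -/
def Abelian (G : Type*) [Group G] : Prop := ∀ a b : G, a * b = b * a

/-- A group is *minimal non-abelian* if it is not abelian but every proper
subgroup of it is abelian. -/
def MinimalNonAbelian (G : Type*) [Group G] : Prop :=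
  ¬ Abelian G ∧ ∀ H : Subgroup G, H ≠ ⊤ → Abelian H

/-- A group is *biminimal non-abelian* if it is neither abelian nor minimal non-abelian,
but every proper subgroup of it is abelian or minimal non-abelian. -/
def BiminimalNonAbelian (G : Type*) [Group G] : Prop :=
  ¬ Abelian G ∧ ¬ MinimalNonAbelian G ∧
    ∀ H : Subgroup G, H ≠ ⊤ → (Abelian H ∨ MinimalNonAbelian H)

/-- A group is *parahamiltonian* if it is not abelian and every non-normal subgroup
of it is either abelian or minimal non-abelian. -/
def Parahamiltonian (G : Type*) [Group G] : Prop :=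
  ¬ Abelian G ∧ ∀ H : Subgroup G, ¬ H.Normal → (Abelian H ∨ MinimalNonAbelian H)

/-- A group is *locally nilpotent* if every finitely generated subgroup of it is nilpotent. -/
def LocallyNilpotent (G : Type*) [Group G] : Prop :=
  ∀ H : Subgroup G, Group.FG H → Group.IsNilpotent H

set_option linter.unusedSectionVars false

universe u

section

open Subgroup
open scoped commutatorElement Pointwise MonoidAlgebra

/-- The elements of the subgroup `K` commute pairwise. -/
def IsCommSub {G : Type*} [Group G] (K : Subgroup G) : Prop :=
  ∀ a ∈ K, ∀ b ∈ K, a * b = b * a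

lemma IsCommSub.mono {G : Type*} [Group G] {H K : Subgroup G} (hK : IsCommSub K) (h : H ≤ K) :
    IsCommSub H := fun a ha b hb => hK a (h ha) b (h hb)

lemma isCommSub_closure {G : Type*} [Group G] {s : Set G}
    (h : ∀ a ∈ s, ∀ b ∈ s, a * b = b * a) : IsCommSub (closure s) := by
  have h1 : closure s ≤ centralizer s := by
    rw [closure_le]
    intro a ha
    rw [SetLike.mem_coe, mem_centralizer_iff]
    exact fun b hb => h b hb a ha
  have h2 : closure s ≤ centralizer (closure s : Set G) := by
    rw [closure_le]
    intro a ha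
    rw [SetLike.mem_coe, mem_centralizer_iff]
    exact fun b hb => (mem_centralizer_iff.1 (h1 hb) a ha).symm
  exact fun a ha b hb => mem_centralizer_iff.1 (h2 hb) a ha

lemma isCommSub_sup {G : Type*} [Group G] {H K : Subgroup G} (hH : IsCommSub H)
    (hK : IsCommSub K) (h : ∀ a ∈ H, ∀ b ∈ K, a * b = b * a) : IsCommSub (H ⊔ K) := by
  rw [sup_eq_closure]
  apply isCommSub_closure
  rintro a (ha | ha) b (hb | hb)
  · exact hH a ha b hb
  · exact h a ha b hb
  · exact (h b hb a ha).symm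
  · exact hK a ha b hb

lemma exists_normalizer_growth {G : Type*} [Group G] [Finite G] {p : ℕ} [Fact p.Prime]
    {A Q : Subgroup G} (hQ : IsPGroup p Q) (h : A < Q) :
    ∃ g ∈ Q, g ∉ A ∧ g ∈ normalizer (A : Set G) := by
  have : Group.IsNilpotent Q := hQ.isNilpotent
  have hn := Group.normalizerCondition_of_isNilpotent (G := Q) (A.subgroupOf Q) (by
    rw [lt_top_iff_ne_top, Ne, subgroupOf_eq_top]
    exact not_le_of_gt h)
  obtain ⟨g, hg, hgA⟩ := SetLike.exists_of_lt hn
  refine ⟨g, g.2, fun h' => hgA (mem_subgroupOf.2 h'), ?_⟩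
  rw [mem_normalizer_iff] at hg ⊢
  intro a
  constructor
  · intro ha
    exact mem_subgroupOf.1 ((hg ⟨a, h.le ha⟩).1 (mem_subgroupOf.2 ha))
  · intro ha
    have h1 : a ∈ Q := by
      have := Q.mul_mem (Q.mul_mem (Q.inv_mem g.2) (h.le ha)) g.2
      simpa [mul_assoc] using this
    exact mem_subgroupOf.1 ((hg ⟨a, h1⟩).2 (mem_subgroupOf.2 ha))

lemma burnside_complement {G : Type*} [Group G] [Finite G] {p : ℕ} [Fact p.Prime]
    (P : Sylow p G) (hP : normalizer (P : Set G) ≤ centralizer (P : Set G)) :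
    ∃ K : Subgroup G, K.Normal ∧ K ⊓ P = ⊥ ∧ K ⊔ P = ⊤ ∧ _root_.commutator G ≤ K := by
  have hc := MonoidHom.ker_transferSylow_isComplement' P hP
  refine ⟨(MonoidHom.transferSylow P hP).ker, inferInstance, hc.disjoint.eq_bot,
    hc.sup_eq_top, ?_⟩
  rw [commutator_def, commutator_le]
  intro a _ b _
  rw [MonoidHom.mem_ker, map_commutatorElement, commutatorElement_eq_one_iff_mul_comm]
  have hcomm : IsCommSub (P : Subgroup G) := fun a ha b hb =>
    (mem_centralizer_iff.1 (hP (le_normalizer ha)) b hb).symm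
  exact Subtype.ext (hcomm _ (Subtype.mem _) _ (Subtype.mem _))

lemma sylow_not_normalizer_le_centralizer {G : Type*} [Group G] [Finite G] {p : ℕ}
    [Fact p.Prime] (hperf : _root_.commutator G = ⊤) (P : Sylow p G)
    (hP : (P : Subgroup G) ≠ ⊥) :
    ¬ normalizer (P : Set G) ≤ centralizer (P : Set G) := by
  intro h
  obtain ⟨K, _, h1, -, h3⟩ := burnside_complement P h
  rw [hperf, top_le_iff] at h3
  rw [h3, top_inf_eq] at h1
  exact hP h1

/-- In a finite minimal non-abelian group, a non-normal Sylow subgroup is cyclic and its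
maximal subgroup is central. -/
lemma sylow_of_minimal_nonabelian {C : Type*} [Group C] [Finite C] {p : ℕ} [hp : Fact p.Prime]
    (hC : ¬ IsCommSub (⊤ : Subgroup C)) (hmin : ∀ H : Subgroup C, H ≠ ⊤ → IsCommSub H)
    (P : Sylow p C) (hP : (P : Subgroup C) ≠ ⊥) (hN : normalizer (P : Set C) ≠ ⊤) :
    ∃ u ∈ P, (P : Subgroup C) = zpowers u ∧ u ^ p ∈ center C := by
  have hNc := hmin _ hN
  have hNC : normalizer (P : Set C) ≤ centralizer (P : Set C) := fun a ha =>
    mem_centralizer_iff.2 fun b hb => hNc b (le_normalizer hb) a ha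
  obtain ⟨K, hKn, hKP, hKP', -⟩ := burnside_complement P hNC
  have hK : K ≠ ⊤ := by
    rintro rfl
    exact hP (by simpa using hKP)
  have hKc := hmin K hK
  have hPc : IsCommSub (P : Subgroup C) := hNc.mono le_normalizer
  obtain ⟨u, huP, a, haK, hau⟩ : ∃ u ∈ P, ∃ a ∈ K, a * u ≠ u * a := by
    by_contra! hcon
    apply hC
    rw [← hKP']
    exact isCommSub_sup hKc hPc fun a ha b hb => hcon b hb a ha
  have htop : K ⊔ zpowers u = ⊤ := by
    by_contra hne
    exact hau (hmin _ hne a (mem_sup_left haK) u (mem_sup_right (mem_zpowers u)))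
  have hzP : zpowers u ≤ (P : Subgroup C) := by rwa [zpowers_le]
  refine ⟨u, huP, le_antisymm (fun w hw => ?_) hzP, ?_⟩
  · have : w ∈ K ⊔ zpowers u := htop ▸ mem_top w
    rw [mem_sup_of_normal_left] at this
    obtain ⟨k, hk, v, hv, rfl⟩ := this
    have hkP : k ∈ (P : Subgroup C) := by
      have := mul_mem hw (inv_mem (hzP hv))
      simpa using this
    have : k ∈ K ⊓ (P : Subgroup C) := ⟨hk, hkP⟩
    rw [hKP, mem_bot] at this
    simpa [this] using hv
  · have hne : K ⊔ zpowers (u ^ p) ≠ ⊤ := by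
      intro h
      have : u ∈ K ⊔ zpowers (u ^ p) := h ▸ mem_top u
      rw [mem_sup_of_normal_left] at this
      obtain ⟨k, hk, v, ⟨i, rfl⟩, hkv⟩ := this
      have hpi : (u ^ p) ^ i ∈ (P : Subgroup C) := zpow_mem (pow_mem huP p) i
      have hkP : k ∈ (P : Subgroup C) := by
        rw [eq_mul_inv_of_mul_eq hkv]
        exact mul_mem huP (inv_mem hpi)
      have hk1 : k ∈ K ⊓ (P : Subgroup C) := ⟨hk, hkP⟩
      rw [hKP, mem_bot] at hk1
      subst hk1
      have h1 : u ^ ((p : ℤ) * i - 1) = 1 := by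
        rw [zpow_sub, zpow_mul, zpow_natCast, zpow_one]
        simp at hkv
        rw [hkv, mul_inv_cancel]
      have h2 := orderOf_dvd_iff_zpow_eq_one.2 h1
      obtain ⟨n, hn⟩ := (IsPGroup.iff_orderOf.1 P.2) ⟨u, huP⟩
      rw [Subgroup.orderOf_mk] at hn
      rcases n with _ | n
      · have : u = 1 := by simpa using hn
        apply hau
        simp [this]
      · have h3 : (p : ℤ) ∣ orderOf u := by
          rw [hn, pow_succ]; push_cast; exact Dvd.intro_left _ rfl
        have h4 : (p : ℤ) ∣ 1 := by
          have := dvd_sub (dvd_mul_right (p : ℤ) i) (h3.trans h2)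
          simpa using this
        exact hp.out.one_lt.ne' (by exact_mod_cast Int.eq_one_of_dvd_one (by positivity) h4)
    have hcm := hmin _ hne
    rw [mem_center_iff]
    have : (⊤ : Subgroup C) ≤ centralizer {u ^ p} := by
      rw [← htop, sup_le_iff, zpowers_le]
      refine ⟨fun b hb => ?_, ?_⟩
      · rw [mem_centralizer_singleton_iff]
        exact hcm b (mem_sup_left hb) _ (mem_sup_right (mem_zpowers _))
      · rw [mem_centralizer_singleton_iff]
        exact (Commute.self_pow u p).eq
    exact fun g => mem_centralizer_singleton_iff.1 (this (mem_top g))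

/-- Every subgroup strictly contained in a proper subgroup is abelian. -/
def SecondAbelian (G : Type*) [Group G] : Prop :=
  ∀ K H : Subgroup G, K < H → H ≠ ⊤ → IsCommSub K

lemma SecondAbelian.eq_of_le {G : Type*} [Group G] (hG : SecondAbelian G) {H M : Subgroup G}
    (hH : ¬ IsCommSub H) (hM : M ≠ ⊤) (h : H ≤ M) : H = M := by
  by_contra hne
  exact hH (hG H M (lt_of_le_of_ne h hne) hM)

section

variable {S : Type*} [Group S] [Finite S] [IsSimpleGroup S]

lemma centralizer_singleton_ne_top (hnc : ¬ IsCommSub (⊤ : Subgroup S)) {x : S} (hx : x ≠ 1) :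
    centralizer {x} ≠ (⊤ : Subgroup S) := by
  intro h
  have hxc : x ∈ center S := by
    rw [mem_center_iff]
    intro g
    exact mem_centralizer_singleton_iff.1 (h ▸ mem_top g)
  rcases IsSimpleGroup.eq_bot_or_eq_top_of_normal (center S) inferInstance with hz | hz
  · rw [hz, mem_bot] at hxc
    exact hx hxc
  · apply hnc
    intro a _ b _
    have : b ∈ center S := hz ▸ mem_top b
    exact mem_center_iff.1 this a

lemma normalizer_ne_top {H : Subgroup S} (h1 : H ≠ ⊥) (h2 : H ≠ ⊤) :
    normalizer (H : Set S) ≠ ⊤ := by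
  intro h
  have : H.Normal := normalizer_eq_top_iff.1 h
  rcases IsSimpleGroup.eq_bot_or_eq_top_of_normal H this with hz | hz
  · exact h1 hz
  · exact h2 hz

lemma commutator_eq_top_of_simple (hnc : ¬ IsCommSub (⊤ : Subgroup S)) :
    _root_.commutator S = ⊤ := by
  rcases IsSimpleGroup.eq_bot_or_eq_top_of_normal (_root_.commutator S) inferInstance with h | h
  · exfalso
    apply hnc
    intro a ha b hb
    have : ⁅a, b⁆ ∈ _root_.commutator S := commutator_mem_commutator ha hb
    rw [h, mem_bot, commutatorElement_eq_one_iff_mul_comm] at this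
    exact this
  · exact h

lemma sylow_ne_top {p : ℕ} [Fact p.Prime] (hnc : ¬ IsCommSub (⊤ : Subgroup S))
    {Q : Subgroup S} (hQ : IsPGroup p Q) : Q ≠ ⊤ := by
  rintro rfl
  have h0 : IsPGroup p S := hQ.of_equiv topEquiv
  have h1 : Group.IsNilpotent S := h0.isNilpotent
  have h3 : Nontrivial S := IsSimpleGroup.toNontrivial
  exact (Group.IsSolvable.commutator_lt_top_of_nontrivial S).ne (commutator_eq_top_of_simple hnc)

/-- Sylow subgroups of a finite simple group whose second maximal subgroups are abelian are
abelian: centralizers of elements of a nonabelian Sylow subgroup. -/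
lemma centralizer_le_of_nonabelian_sylow (hS : SecondAbelian S)
    (hnc : ¬ IsCommSub (⊤ : Subgroup S)) {p : ℕ} [hp : Fact p.Prime] (P : Sylow p S)
    (hP : ¬ IsCommSub (P : Subgroup S)) {z : S} (hzP : z ∈ P) (hz1 : z ≠ 1)
    (hz : ∀ a ∈ P, a * z = z * a) {x : S} (hxP : x ∈ P) (hx1 : x ≠ 1) :
    centralizer {x} ≤ (P : Subgroup S) := by
  have central : ∀ y ∈ P, y ≠ 1 → (∀ a ∈ P, a * y = y * a) → centralizer {y} ≤ (P : Subgroup S) := by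
    intro y hy hy1 hyc
    refine (hS.eq_of_le hP (centralizer_singleton_ne_top hnc hy1) ?_).ge
    exact fun a ha => mem_centralizer_singleton_iff.2 (hyc a ha)
  by_cases hxc : ∀ a ∈ P, a * x = x * a
  · exact central x hxP hx1 hxc
  set C := centralizer {x} with hC
  have hCz : ∀ c : S, c * z = z * c → c ∈ P := fun c hc =>
    central z hzP hz1 hz (mem_centralizer_singleton_iff.2 hc)
  have hzC : z ∈ C := mem_centralizer_singleton_iff.2 (hz x hxP).symm
  by_cases hCc : IsCommSub C
  · intro c hc
    exact hCz c (hCc c hc z hzC)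
  exfalso
  set A := C ⊓ (P : Subgroup S) with hA
  have hPtop : (P : Subgroup S) ≠ ⊤ := sylow_ne_top hnc P.2
  have hxC : x ∈ C := mem_centralizer_singleton_iff.2 rfl
  have hAP : A < P := by
    refine lt_of_le_of_ne inf_le_right fun h => hxc fun a ha => ?_
    have : a ∈ A := h ▸ ha
    exact mem_centralizer_singleton_iff.1 this.1
  have hAc : IsCommSub A := hS _ _ hAP hPtop
  have hxA : x ∈ A := ⟨hxC, hxP⟩
  have hAmax : ∀ B : Subgroup S, A ≤ B → B < P → B ≤ A := by
    intro B hAB hBP b hb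
    have hBc := hS _ _ hBP hPtop
    exact ⟨mem_centralizer_singleton_iff.2 (hBc b hb x (hAB hxA)), hBP.le hb⟩
  have hPN : (P : Subgroup S) ≤ normalizer (A : Set S) := by
    obtain ⟨g, hgP, hgA, hgN⟩ := exists_normalizer_growth P.2 hAP
    by_contra hle
    have h1 : normalizer (A : Set S) ⊓ P < P := by
      refine lt_of_le_of_ne inf_le_right fun h => hle (h ▸ inf_le_left)
    exact hgA (hAmax _ (le_inf le_normalizer hAP.le) h1 ⟨hgN, hgP⟩)
  have hNA : (P : Subgroup S) = normalizer (A : Set S) := by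
    refine hS.eq_of_le hP (normalizer_ne_top ?_ ?_) hPN
    · intro h
      rw [h, mem_bot] at hxA
      exact hx1 hxA
    · intro h
      exact hnc (h ▸ hAc)
  have hAp : IsPGroup p A := P.2.to_le hAP.le
  have hAC : A ≤ C := inf_le_left
  -- `A` is a Sylow subgroup of `C`
  let A' : Sylow p C :=
    { A.subgroupOf C with
      isPGroup' := hAp.comap_subtype
      is_maximal' := by
        intro Q hQ hAQ
        by_contra hne
        have hlt : A.subgroupOf C < Q := lt_of_le_of_ne hAQ (Ne.symm hne)
        obtain ⟨g, hgQ, hgA, hgN⟩ := exists_normalizer_growth hQ hlt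
        apply hgA
        rw [mem_subgroupOf]
        refine ⟨g.2, ?_⟩
        change (g : S) ∈ (P : Subgroup S)
        rw [hNA, mem_normalizer_iff]
        rw [mem_normalizer_iff] at hgN
        intro a
        constructor
        · intro ha
          exact mem_subgroupOf.1 ((hgN ⟨a, hAC ha⟩).1 (mem_subgroupOf.2 ha))
        · intro ha
          have h1 : a ∈ C := by
            have := C.mul_mem (C.mul_mem (C.inv_mem g.2) (hAC ha)) g.2
            simpa [mul_assoc] using this
          exact mem_subgroupOf.1 ((hgN ⟨a, h1⟩).2 (mem_subgroupOf.2 ha)) }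
  have hA' : (A' : Subgroup C) = A.subgroupOf C := rfl
  have hCtop : C ≠ ⊤ := centralizer_singleton_ne_top hnc hx1
  obtain ⟨u, huA, hAu, hup⟩ := sylow_of_minimal_nonabelian (C := C)
    (by
      intro h
      apply hCc
      intro a ha b hb
      exact congrArg Subtype.val (h ⟨a, ha⟩ (mem_top _) ⟨b, hb⟩ (mem_top _)))
    (by
      intro H hH a ha b hb
      have : H.map C.subtype < C := by
        refine lt_of_le_of_ne (map_subtype_le H) fun h => hH ?_
        rw [eq_top_iff]
        intro c _
        obtain ⟨d, hd, hdc⟩ : (c : S) ∈ H.map C.subtype := by rw [h]; exact c.2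
        exact (Subtype.ext hdc : d = c) ▸ hd
      exact Subtype.ext (hS _ _ this hCtop a (mem_map_of_mem _ ha) b (mem_map_of_mem _ hb)))
    A'
    (by
      intro h
      have : (⟨x, hxC⟩ : C) ∈ (A' : Subgroup C) := mem_subgroupOf.2 hxA
      rw [h, mem_bot] at this
      exact hx1 (congrArg Subtype.val this))
    (by
      intro h
      apply hCc
      refine hAc.mono fun c hc => ⟨hc, ?_⟩
      change c ∈ (P : Subgroup S)
      rw [hNA, mem_normalizer_iff]
      have hcN : (⟨c, hc⟩ : C) ∈ normalizer ((A' : Subgroup C) : Set C) := h ▸ mem_top _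
      rw [mem_normalizer_iff] at hcN
      intro a
      constructor
      · intro ha
        exact mem_subgroupOf.1 ((hcN ⟨a, hAC ha⟩).1 (mem_subgroupOf.2 ha))
      · intro ha
        have h1 : a ∈ C := by
          have := C.mul_mem (C.mul_mem (C.inv_mem hc) (hAC ha)) hc
          simpa [mul_assoc] using this
        exact mem_subgroupOf.1 ((hcN ⟨a, h1⟩).2 (mem_subgroupOf.2 ha)))
  have hzA' : (⟨z, hzC⟩ : C) ∈ (A' : Subgroup C) := mem_subgroupOf.2 ⟨hzC, hzP⟩
  rw [hAu] at hzA'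
  obtain ⟨n, hn⟩ := hzA'
  by_cases hpn : (p : ℤ) ∣ n
  · obtain ⟨m, rfl⟩ := hpn
    have hzc : (⟨z, hzC⟩ : C) ∈ center C := by
      rw [← hn]
      simp only [zpow_mul, zpow_natCast]
      exact zpow_mem hup m
    apply hCc
    refine hAc.mono fun c hc => ⟨hc, hCz c ?_⟩
    exact congrArg Subtype.val (mem_center_iff.1 hzc ⟨c, hc⟩)
  · have huz : u ∈ zpowers (⟨z, hzC⟩ : C) := by
      obtain ⟨k, hk⟩ := (IsPGroup.iff_orderOf.1 A'.2) ⟨u, huA⟩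
      rw [Subgroup.orderOf_mk] at hk
      have hcop : IsCoprime n (orderOf u : ℤ) := by
        rw [hk]; push_cast
        refine IsCoprime.pow_right ?_
        rw [isCoprime_comm]
        exact (Nat.prime_iff_prime_int.1 hp.out).coprime_iff_not_dvd.2 hpn
      obtain ⟨a, b, hab⟩ := hcop
      refine ⟨a, ?_⟩
      have : u = u ^ (a * n + b * orderOf u) := by rw [hab, zpow_one]
      simp only
      conv_rhs => rw [this]
      rw [zpow_add, mul_comm b, zpow_mul u (orderOf u : ℤ), zpow_natCast, pow_orderOf_eq_one, one_zpow,
        mul_one, ← hn, ← zpow_mul, mul_comm]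
    have hxA' : (⟨x, hxC⟩ : C) ∈ (A' : Subgroup C) := mem_subgroupOf.2 ⟨hxC, hxP⟩
    rw [hAu] at hxA'
    have hxz : (⟨x, hxC⟩ : C) ∈ zpowers (⟨z, hzC⟩ : C) := (zpowers_le.2 huz) hxA'
    obtain ⟨m, hm⟩ := hxz
    apply hxc
    intro a ha
    have : x = z ^ m := (congrArg Subtype.val hm).symm
    rw [this]
    exact (Commute.zpow_right (hz a ha) m).eq

lemma sylow_isCommSub (hS : SecondAbelian S)
    (hnc : ¬ IsCommSub (⊤ : Subgroup S)) {p : ℕ} [hp : Fact p.Prime] (P : Sylow p S) :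
    IsCommSub (P : Subgroup S) := by
  by_contra hP
  have hPtop : (P : Subgroup S) ≠ ⊤ := sylow_ne_top hnc P.2
  have hPbot : (P : Subgroup S) ≠ ⊥ := by
    intro h
    apply hP
    rw [h]
    intro a ha b hb
    rw [mem_bot.1 ha, mem_bot.1 hb]
  obtain ⟨z, hzP, hz1, hz⟩ : ∃ z ∈ P, z ≠ 1 ∧ ∀ a ∈ P, a * z = z * a := by
    have : Nontrivial (P : Subgroup S) := (nontrivial_iff_ne_bot _).2 hPbot
    have := IsPGroup.center_nontrivial P.2
    obtain ⟨w, hw, hw1⟩ := (nontrivial_iff_exists_ne_one _).1 this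
    refine ⟨w, w.2, fun h => hw1 (Subtype.ext h), fun a ha => ?_⟩
    exact congrArg Subtype.val (mem_center_iff.1 hw ⟨a, ha⟩)
  have key : ∀ x ∈ P, x ≠ 1 → centralizer {x} ≤ (P : Subgroup S) := fun x hx hx1 =>
    centralizer_le_of_nonabelian_sylow hS hnc P hP hzP hz1 hz hx hx1
  have hNP : (P : Subgroup S) = normalizer (P : Set S) :=
    hS.eq_of_le hP (normalizer_ne_top hPbot hPtop) le_normalizer
  have hTI : ∀ x ∈ P, x ≠ 1 → ∀ g, g⁻¹ * x * g ∈ P → g ∈ (P : Subgroup S) := by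
    intro x hx hx1 g hg
    set w := g * z * g⁻¹ with hw
    have hw1 : w ≠ 1 := by simpa [hw] using hz1
    have hwP : w ∈ P := by
      apply key x hx hx1
      rw [mem_centralizer_singleton_iff]
      have := hz _ hg
      rw [hw]
      calc g * z * g⁻¹ * x = g * (z * (g⁻¹ * x * g)) * g⁻¹ := by group
        _ = g * ((g⁻¹ * x * g) * z) * g⁻¹ := by rw [this]
        _ = x * (g * z * g⁻¹) := by group
    have h1 : ∀ b ∈ P, g * b * g⁻¹ ∈ P := by
      intro b hb
      apply key w hwP hw1
      rw [mem_centralizer_singleton_iff, hw]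
      calc g * b * g⁻¹ * (g * z * g⁻¹) = g * (b * z) * g⁻¹ := by group
        _ = g * (z * b) * g⁻¹ := by rw [hz b hb]
        _ = g * z * g⁻¹ * (g * b * g⁻¹) := by group
    rw [hNP]
    exact mem_normalizer_fintype h1
  have hfoc := Subgroup.commutator_inf_eq_focalSubgroup P
  rw [commutator_eq_top_of_simple hnc, top_inf_eq, focalSubgroup_def] at hfoc
  have h2 : (P : Subgroup S) ≤ ⁅(P : Subgroup S), (P : Subgroup S)⁆ := by
    conv_lhs => rw [hfoc]
    rw [closure_le]
    rintro _ ⟨hgP, x, hx, u, rfl⟩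
    by_cases hx1 : x = 1
    · subst hx1
      simp
    · refine commutator_mem_commutator hx ?_
      have h3 : u * x⁻¹ * u⁻¹ ∈ P := by
        have := mul_mem (inv_mem hx) hgP
        rw [commutatorElement_def] at this
        change _ ∈ (P : Subgroup S) at this
        change _ ∈ (P : Subgroup S)
        simpa only [mul_assoc, inv_mul_cancel_left] using this
      rw [← inv_mem_iff]
      refine hTI x⁻¹ (inv_mem hx) (by simpa using hx1) u⁻¹ (by simpa using h3)
  have h1 : Group.IsNilpotent (P : Subgroup S) := P.2.isNilpotent
  have h3 : Nontrivial (P : Subgroup S) := (nontrivial_iff_ne_bot _).2 hPbot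
  have h4 := Group.IsSolvable.commutator_lt_top_of_nontrivial (P : Subgroup S)
  apply h4.ne
  rw [← map_subtype_inj, map_subtype_commutator, ← MonoidHom.range_eq_map, range_subtype]
  exact le_antisymm (commutator_le.2 fun a ha b hb => mul_mem (mul_mem (mul_mem ha hb) (inv_mem ha)) (inv_mem hb)) h2

end

section

variable {S : Type*} [Group S] [Finite S] [IsSimpleGroup S]

/-- An element of the normalizer of `P` of prime power order not centralizing `P`, all of whose
proper powers centralize `P`. -/
structure ActsOn {p : ℕ} (P : Sylow p S) (r : ℕ) (y : S) : Prop where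
  prime : r.Prime
  mem : ∀ x ∈ P, y * x * y⁻¹ ∈ P
  order : ∃ k, orderOf y = r ^ k
  pow_comm : ∀ x ∈ P, x * y ^ r = y ^ r * x
  not_comm : ¬ ∀ x ∈ P, x * y = y * x
  ne : r ≠ p

lemma eq_one_of_pow_eq_one {p r k : ℕ} {Q : Subgroup S} (hp : p.Prime) (hQ : IsPGroup p Q)
    (hr : r.Prime) (hrp : r ≠ p) {x : S} (hx : x ∈ Q) (hxr : x ^ r ^ k = 1) : x = 1 := by
  have : Fact p.Prime := ⟨hp⟩
  obtain ⟨m, hm⟩ := (IsPGroup.iff_orderOf.1 hQ) ⟨x, hx⟩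
  rw [Subgroup.orderOf_mk] at hm
  have h1 := orderOf_dvd_of_pow_eq_one hxr
  have hc : Nat.Coprime (p ^ m) (r ^ k) :=
    Nat.Coprime.pow _ _ ((Nat.coprime_primes hp hr).2 hrp.symm)
  rw [hm] at h1
  rw [← orderOf_eq_one_iff, hm]
  exact Nat.Coprime.eq_one_of_dvd hc h1

lemma exists_actsOn (hS : SecondAbelian S)
    (hnc : ¬ IsCommSub (⊤ : Subgroup S)) {p : ℕ} [hp : Fact p.Prime] (P : Sylow p S)
    (hP : (P : Subgroup S) ≠ ⊥) : ∃ r y, ActsOn P r y := by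
  have hPc := sylow_isCommSub hS hnc P
  have hB := sylow_not_normalizer_le_centralizer (commutator_eq_top_of_simple hnc) P hP
  have hex : ∃ n, ∃ y, (∀ x ∈ P, y * x * y⁻¹ ∈ P) ∧ (¬ ∀ x ∈ P, x * y = y * x) ∧
      orderOf y = n := by
    obtain ⟨y, hy, hyc⟩ := Set.not_subset.1 hB
    refine ⟨_, y, ?_, ?_, rfl⟩
    · intro x hx
      exact (mem_normalizer_iff.1 hy x).1 hx
    · intro h
      exact hyc (mem_centralizer_iff.2 h)
  classical
  obtain ⟨y, hyN, hyc, hyn⟩ := Nat.find_spec hex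
  have hmin := fun m hm => Nat.find_min hex (m := m) hm
  have hnorm : ∀ y : S, (∀ x ∈ P, y * x * y⁻¹ ∈ P) → y ∈ normalizer ((P : Subgroup S) : Set S) :=
    fun y h => mem_normalizer_fintype h
  have hpow : ∀ d, d.Prime → d ∣ orderOf y → ∀ x ∈ P, x * y ^ d = y ^ d * x := by
    intro d hd hdo
    by_contra hcon
    have hlt : orderOf (y ^ d) < Nat.find hex := by
      rw [← hyn, orderOf_pow_of_dvd hd.ne_zero hdo]
      exact Nat.div_lt_self (orderOf_pos y) hd.one_lt
    refine hmin _ hlt ⟨y ^ d, ?_, hcon, rfl⟩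
    have := pow_mem (hnorm y hyN) d
    exact fun x hx => (mem_normalizer_iff.1 this x).1 hx
  have hy1 : orderOf y ≠ 1 := by
    intro h
    rw [orderOf_eq_one_iff] at h
    apply hyc
    simp [h]
  obtain ⟨r, hr, hrd⟩ := Nat.exists_prime_and_dvd hy1
  have huniq : ∀ {d}, d.Prime → d ∣ orderOf y → d = r := by
    intro d hd hdo
    by_contra hne
    apply hyc
    intro x hx
    have hcop : IsCoprime (d : ℤ) r := (Nat.isCoprime_iff_coprime.2 ((Nat.coprime_primes hd hr).2 hne))
    obtain ⟨a, b, hab⟩ := hcop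
    have h1 : Commute x (y ^ (d : ℤ)) := by rw [zpow_natCast]; exact hpow d hd hdo x hx
    have h2 : Commute x (y ^ (r : ℤ)) := by rw [zpow_natCast]; exact hpow r hr hrd x hx
    have h3 := (h1.zpow_right a).mul_right (h2.zpow_right b)
    rw [← zpow_mul, ← zpow_mul, ← zpow_add, mul_comm _ a, mul_comm _ b, hab, zpow_one] at h3
    exact h3.eq
  have hord := Nat.eq_prime_pow_of_unique_prime_dvd (orderOf_pos y).ne' huniq
  refine ⟨r, y, hr, hyN, ⟨_, hord⟩, hpow r hr hrd, hyc, ?_⟩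
  rintro rfl
  have hz : IsPGroup r (zpowers y) := by
    rw [IsPGroup.iff_card, Nat.card_zpowers]
    exact ⟨_, hord⟩
  have h1 : IsPGroup r (zpowers y ⊔ P : Subgroup S) := by
    apply hz.to_sup_of_normal_right' P.2
    rw [zpowers_le]
    exact hnorm y hyN
  have h2 := P.is_maximal' h1 le_sup_right
  have h3 : y ∈ (P : Subgroup S) := by
    rw [← h2]
    exact mem_sup_left (mem_zpowers y)
  exact hyc fun x hx => hPc x hx y h3

variable {p : ℕ} [hp : Fact p.Prime] {P : Sylow p S} {r : ℕ} {y : S}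

lemma ActsOn.mem_normalizer (h : ActsOn P r y) : y ∈ normalizer ((P : Subgroup S) : Set S) :=
  mem_normalizer_fintype h.mem

lemma ActsOn.ne_bot (h : ActsOn P r y) : (P : Subgroup S) ≠ ⊥ := by
  intro hb
  apply h.not_comm
  intro x hx
  have : x ∈ (P : Subgroup S) := hx
  rw [hb, mem_bot] at this
  simp [this]

lemma ActsOn.normalizer_ne_top (h : ActsOn P r y) (hnc : ¬ IsCommSub (⊤ : Subgroup S)) :
    normalizer ((P : Subgroup S) : Set S) ≠ ⊤ :=
  _root_.normalizer_ne_top h.ne_bot (sylow_ne_top hnc P.2)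

lemma ActsOn.normalizer_eq (h : ActsOn P r y) (hS : SecondAbelian S)
    (hnc : ¬ IsCommSub (⊤ : Subgroup S)) :
    normalizer ((P : Subgroup S) : Set S) = (P : Subgroup S) ⊔ zpowers y := by
  symm
  apply hS.eq_of_le _ (h.normalizer_ne_top hnc)
  · rw [sup_le_iff, zpowers_le]
    exact ⟨le_normalizer, h.mem_normalizer⟩
  · intro hc
    exact h.not_comm fun x hx => hc x (mem_sup_left hx) y (mem_sup_right (mem_zpowers y))

lemma ActsOn.zpow_mem (h : ActsOn P r y) {i : ℤ} (hi : y ^ i ∈ P) : y ^ i = 1 := by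
  obtain ⟨k, hk⟩ := h.order
  refine eq_one_of_pow_eq_one (k := k) hp.out P.2 h.prime h.ne hi ?_
  rw [← hk, ← zpow_natCast, ← zpow_mul, mul_comm, zpow_mul, zpow_natCast, pow_orderOf_eq_one,
    one_zpow]

omit [Finite S] [IsSimpleGroup S] in
lemma exists_mul_zpow_of_mem_sup {K : Subgroup S} {y : S} (hy : y ∈ normalizer (K : Set S))
    {w : S} (hw : w ∈ K ⊔ zpowers y) : ∃ k ∈ K, ∃ i : ℤ, w = k * y ^ i := by
  have h2 : zpowers y ≤ normalizer (K : Set S) := by rwa [zpowers_le]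
  have h3 : w ∈ ((K ⊔ zpowers y : Subgroup S) : Set S) := hw
  rw [coe_mul_of_right_le_normalizer_left _ _ h2, Set.mem_mul] at h3
  obtain ⟨k, hk, _, ⟨i, rfl⟩, rfl⟩ := h3
  exact ⟨k, hk, i, rfl⟩

lemma ActsOn.comm_of_invariant (h : ActsOn P r y) (hS : SecondAbelian S)
    (hnc : ¬ IsCommSub (⊤ : Subgroup S)) {K : Subgroup S} (hK : K ≤ P) (hKP : K ≠ P)
    (hy : ∀ x ∈ K, y * x * y⁻¹ ∈ K) : ∀ x ∈ K, x * y = y * x := by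
  have hyK : y ∈ normalizer (K : Set S) := mem_normalizer_fintype hy
  by_cases hc : IsCommSub (K ⊔ zpowers y)
  · exact fun x hx => hc x (mem_sup_left hx) y (mem_sup_right (mem_zpowers y))
  exfalso
  have hle : K ⊔ zpowers y ≤ normalizer ((P : Subgroup S) : Set S) := by
    rw [sup_le_iff, zpowers_le]
    exact ⟨hK.trans le_normalizer, h.mem_normalizer⟩
  have heq := hS.eq_of_le hc (h.normalizer_ne_top hnc) hle
  apply hKP
  refine le_antisymm hK fun w hw => ?_
  have h1 : w ∈ K ⊔ zpowers y := heq ▸ le_normalizer hw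
  obtain ⟨k, hk, i, rfl⟩ := exists_mul_zpow_of_mem_sup hyK h1
  have h2 : y ^ i ∈ P := by
    have := mul_mem (inv_mem (hK hk)) hw
    rw [inv_mul_cancel_left] at this
    exact this
  rw [h.zpow_mem h2, mul_one]
  exact hk

lemma ActsOn.eq_one_of_comm (h : ActsOn P r y) (hS : SecondAbelian S)
    (hnc : ¬ IsCommSub (⊤ : Subgroup S)) {f : S} (hf : f ∈ P) (hfy : f * y = y * f) : f = 1 := by
  have hPc := sylow_isCommSub hS hnc P
  by_contra hf1
  let κ : (P : Subgroup S) →* S :=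
    { toFun := fun w => (w : S)⁻¹ * (y * w * y⁻¹)
      map_one' := by simp
      map_mul' := by
        intro a b
        have h1 := hPc _ (inv_mem b.2) _ (mul_mem (inv_mem a.2) (h.mem a a.2))
        simp only [coe_mul, mul_inv_rev]
        calc (b : S)⁻¹ * (a : S)⁻¹ * (y * (a * b) * y⁻¹)
            = ((b : S)⁻¹ * ((a : S)⁻¹ * (y * a * y⁻¹))) * (y * b * y⁻¹) := by group
          _ = _ := by rw [h1]; group }
  have hκ : ∀ w : (P : Subgroup S), κ w = (w : S)⁻¹ * (y * w * y⁻¹) := fun w => rfl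
  have hle : κ.range ≤ P := by
    rintro _ ⟨w, rfl⟩
    exact mul_mem (inv_mem w.2) (h.mem w w.2)
  have hne : κ.range ≠ P := by
    intro heq
    have hsurj : Function.Surjective (fun w : (P : Subgroup S) =>
        (⟨κ w, hle ⟨w, rfl⟩⟩ : (P : Subgroup S))) := by
      rintro ⟨v, hv⟩
      obtain ⟨w, hw⟩ : v ∈ κ.range := by rw [heq]; exact hv
      exact ⟨w, Subtype.ext hw⟩
    have hinj := Finite.injective_iff_surjective.2 hsurj
    have : (⟨f, hf⟩ : (P : Subgroup S)) = 1 := by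
      apply hinj
      apply Subtype.ext
      simp only [hκ, ← hfy, OneMemClass.coe_one]
      group
    exact hf1 (congrArg Subtype.val this)
  have hcomm := h.comm_of_invariant hS hnc hle hne (by
    rintro _ ⟨w, rfl⟩
    refine ⟨⟨y * w * y⁻¹, h.mem w w.2⟩, ?_⟩
    rw [hκ, hκ]
    group)
  apply h.not_comm
  intro w hw
  set c := κ ⟨w, hw⟩ with hc
  have hcy : c * y = y * c := hcomm c ⟨_, rfl⟩
  have hcP : c ∈ P := hle ⟨_, rfl⟩
  have h1 : ∀ n : ℕ, y ^ n * w = w * c ^ n * y ^ n := by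
    intro n
    induction n with
    | zero => simp
    | succ n ih =>
      have e1 : y * w = w * c * y := by rw [hc, hκ]; simp [mul_assoc]
      have e2 : y * c ^ n = c ^ n * y := ((show Commute c y from hcy).pow_left n).symm.eq
      calc y ^ (n + 1) * w = y * (y ^ n * w) := by rw [pow_succ']; group
        _ = y * w * c ^ n * y ^ n := by rw [ih]; group
        _ = w * c * (y * c ^ n) * y ^ n := by rw [e1]; group
        _ = w * c ^ (n + 1) * y ^ (n + 1) := by rw [e2]; group
  have h2 : c ^ r = 1 := by
    have := h1 r
    rw [← h.pow_comm w hw] at this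
    simpa [mul_assoc] using this
  have hc1 : c = 1 := eq_one_of_pow_eq_one (k := 1) hp.out P.2 h.prime h.ne hcP (by simpa using h2)
  have := h1 1
  rw [hc1] at this
  simpa using this.symm

lemma ActsOn.pow_eq_one (h : ActsOn P r y) (hS : SecondAbelian S)
    (hnc : ¬ IsCommSub (⊤ : Subgroup S)) {x : S} (hx : x ∈ P) : x ^ p = 1 := by
  have hPc := sylow_isCommSub hS hnc P
  let κ : (P : Subgroup S) →* S :=
    { toFun := fun w => (w : S) ^ p
      map_one' := by simp
      map_mul' := by
        intro a b
        exact (show Commute (a : S) b from hPc _ a.2 _ b.2).mul_pow p }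
  have hκ : ∀ w : (P : Subgroup S), κ w = (w : S) ^ p := fun w => rfl
  have hle : κ.range ≤ P := by
    rintro _ ⟨w, rfl⟩
    exact pow_mem w.2 p
  have hne : κ.range ≠ P := by
    intro heq
    have hsurj : Function.Surjective (fun w : (P : Subgroup S) =>
        (⟨κ w, hle ⟨w, rfl⟩⟩ : (P : Subgroup S))) := by
      rintro ⟨v, hv⟩
      obtain ⟨w, hw⟩ : v ∈ κ.range := by rw [heq]; exact hv
      exact ⟨w, Subtype.ext hw⟩
    have hinj := Finite.injective_iff_surjective.2 hsurj
    have hnt : Nontrivial (P : Subgroup S) := (nontrivial_iff_ne_bot _).2 h.ne_bot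
    obtain ⟨n, hn, hcard⟩ := (IsPGroup.nontrivial_iff_card P.2).1 hnt
    obtain ⟨g, hg⟩ := exists_prime_orderOf_dvd_card' (G := (P : Subgroup S)) p
      (by rw [hcard]; exact dvd_pow_self p hn.ne')
    have : g = 1 := by
      apply hinj
      apply Subtype.ext
      have := pow_orderOf_eq_one g
      rw [hg] at this
      simp only [hκ, OneMemClass.coe_one, one_pow]
      exact congrArg Subtype.val this
    rw [this, orderOf_one] at hg
    exact hp.out.one_lt.ne hg
  have hcomm := h.comm_of_invariant hS hnc hle hne (by
    rintro _ ⟨w, rfl⟩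
    refine ⟨⟨y * w * y⁻¹, h.mem w w.2⟩, ?_⟩
    rw [hκ, hκ, conj_pow])
  exact h.eq_one_of_comm hS hnc (pow_mem hx p) (hcomm _ ⟨⟨x, hx⟩, rfl⟩)

lemma ActsOn.pow_prime (h : ActsOn P r y) (hS : SecondAbelian S)
    (hnc : ¬ IsCommSub (⊤ : Subgroup S)) : y ^ r = 1 := by
  have : Fact r.Prime := ⟨h.prime⟩
  obtain ⟨k, hk⟩ := h.order
  have hz : IsPGroup r (zpowers y) := by
    rw [IsPGroup.iff_card, Nat.card_zpowers]
    exact ⟨_, hk⟩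
  obtain ⟨R, hR⟩ := hz.exists_le_sylow
  have hyR : y ∈ (R : Subgroup S) := hR (mem_zpowers y)
  have hRb : (R : Subgroup S) ≠ ⊥ := by
    intro hb
    rw [hb, mem_bot] at hyR
    apply h.not_comm
    simp [hyR]
  obtain ⟨r', y', h'⟩ := exists_actsOn hS hnc R hRb
  exact h'.pow_eq_one hS hnc hyR

lemma ActsOn.centralizer_eq (h : ActsOn P r y) (hS : SecondAbelian S)
    (hnc : ¬ IsCommSub (⊤ : Subgroup S)) {x : S} (hx : x ∈ P) (hx1 : x ≠ 1) :
    centralizer {x} = (P : Subgroup S) := by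
  have hPc := sylow_isCommSub hS hnc P
  set C := centralizer {x} with hC
  have hPC : (P : Subgroup S) ≤ C := fun a ha =>
    mem_centralizer_singleton_iff.2 (hPc a ha x hx)
  have hxC : x ∈ C := hPC hx
  have hCtop : C ≠ ⊤ := centralizer_singleton_ne_top hnc hx1
  by_cases hCc : IsCommSub C
  · refine le_antisymm (fun c hc => ?_) hPC
    have hcN : c ∈ normalizer ((P : Subgroup S) : Set S) := by
      apply mem_normalizer_fintype
      intro a ha
      rw [hCc c hc a (hPC ha), mul_inv_cancel_right]
      exact ha
    rw [h.normalizer_eq hS hnc] at hcN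
    obtain ⟨k, hk, i, rfl⟩ := exists_mul_zpow_of_mem_sup h.mem_normalizer hcN
    have hyi : y ^ i ∈ C := by
      have := mul_mem (inv_mem (hPC hk)) hc
      rwa [inv_mul_cancel_left] at this
    by_cases hri : (r : ℤ) ∣ i
    · obtain ⟨j, rfl⟩ := hri
      rw [zpow_mul, zpow_natCast, h.pow_prime hS hnc, one_zpow, mul_one]
      exact hk
    · exfalso
      have hcop : IsCoprime (r : ℤ) i :=
        (Nat.prime_iff_prime_int.1 h.prime).coprime_iff_not_dvd.2 hri
      obtain ⟨a, b, hab⟩ := hcop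
      have hyC : y ∈ C := by
        have h1 : y ^ (a * r + b * i) ∈ C := by
          rw [zpow_add, mul_comm a, zpow_mul, zpow_natCast, h.pow_prime hS hnc, one_zpow, one_mul,
            mul_comm b, zpow_mul]
          exact Subgroup.zpow_mem _ hyi b
        rwa [hab, zpow_one] at h1
      exact h.not_comm fun w hw => hCc w (hPC hw) y hyC
  exfalso
  have hmem : ∀ {c : S} (hc : c ∈ C), c ∈ P ↔ (⟨c, hc⟩ : C) ∈ P.subtype hPC := fun hc => Iff.rfl
  have hNne : normalizer ((P.subtype hPC : Subgroup C) : Set C) ≠ ⊤ := by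
    intro htop
    have hle : C ≤ normalizer ((P : Subgroup S) : Set S) := by
      intro c hc
      apply mem_normalizer_fintype
      intro a ha
      have h1 : (⟨c, hc⟩ : C) ∈ normalizer ((P.subtype hPC : Subgroup C) : Set C) :=
        htop ▸ mem_top _
      exact ((mem_normalizer_iff.1 h1) ⟨a, hPC ha⟩).1 ha
    have heq := hS.eq_of_le hCc (h.normalizer_ne_top hnc) hle
    have hyC : y ∈ C := heq ▸ h.mem_normalizer
    exact hx1 (h.eq_one_of_comm hS hnc hx (mem_centralizer_singleton_iff.1 hyC).symm)
  obtain ⟨u, huP, hPu, -⟩ := sylow_of_minimal_nonabelian (C := C)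
    (by
      intro h
      apply hCc
      intro a ha b hb
      exact congrArg Subtype.val (h ⟨a, ha⟩ (mem_top _) ⟨b, hb⟩ (mem_top _)))
    (by
      intro H hH a ha b hb
      have : H.map C.subtype < C := by
        refine lt_of_le_of_ne (map_subtype_le H) fun h => hH ?_
        rw [eq_top_iff]
        intro c _
        obtain ⟨d, hd, hdc⟩ : (c : S) ∈ H.map C.subtype := by rw [h]; exact c.2
        exact (Subtype.ext hdc : d = c) ▸ hd
      exact Subtype.ext (hS _ _ this hCtop a (mem_map_of_mem _ ha) b (mem_map_of_mem _ hb)))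
    (P.subtype hPC)
    (by
      intro hb
      have : (⟨x, hxC⟩ : C) ∈ (P.subtype hPC : Subgroup C) := hx
      rw [hb, mem_bot] at this
      exact hx1 (congrArg Subtype.val this))
    hNne
  have huC : ∀ c : C, c * u = u * c := by
    have hxu : (⟨x, hxC⟩ : C) ∈ (P.subtype hPC : Subgroup C) := hx
    rw [hPu] at hxu
    obtain ⟨n, hn⟩ := hxu
    have hup : u ^ p = 1 := Subtype.ext (h.pow_eq_one hS hnc huP)
    have hpn : ¬ (p : ℤ) ∣ n := by
      rintro ⟨m, rfl⟩
      apply hx1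
      have : u ^ ((p : ℤ) * m) = ⟨x, hxC⟩ := hn
      rw [zpow_mul, zpow_natCast, hup, one_zpow] at this
      exact (congrArg Subtype.val this).symm
    obtain ⟨a, b, hab⟩ := (Nat.prime_iff_prime_int.1 hp.out).coprime_iff_not_dvd.2 hpn
    have hux : u = (⟨x, hxC⟩ : C) ^ b := by
      have hn' : u ^ n = ⟨x, hxC⟩ := hn
      rw [← hn', ← zpow_mul]
      conv_lhs => rw [← zpow_one u, ← hab, zpow_add, mul_comm a, zpow_mul, zpow_natCast, hup,
        one_zpow, one_mul, mul_comm b]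
    intro c
    rw [hux]
    have : Commute c (⟨x, hxC⟩ : C) := Subtype.ext (mem_centralizer_singleton_iff.1 c.2)
    exact (this.zpow_right b).eq
  apply hNne
  rw [eq_top_iff]
  intro c _
  apply mem_normalizer_fintype
  intro a ha
  have ha' : a ∈ (P.subtype hPC : Subgroup C) := ha
  rw [hPu] at ha'
  obtain ⟨n, rfl⟩ := ha'
  have : Commute c u := huC c
  simp only at ha ⊢
  rw [(this.zpow_right n).eq, mul_inv_cancel_right]
  exact ha

lemma ActsOn.card_normalizer (h : ActsOn P r y) (hS : SecondAbelian S)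
    (hnc : ¬ IsCommSub (⊤ : Subgroup S)) :
    Nat.card (normalizer ((P : Subgroup S) : Set S)) = Nat.card P * r := by
  have : Fact r.Prime := ⟨h.prime⟩
  have hr : Nat.card (zpowers y) = r := by
    rw [Nat.card_zpowers]
    refine orderOf_eq_prime (h.pow_prime hS hnc) ?_
    rintro rfl
    exact h.not_comm (by simp)
  rw [h.normalizer_eq hS hnc, ← hr, ← Nat.card_prod]
  symm
  refine Nat.card_congr (Equiv.ofBijective (fun z : ↥(P : Subgroup S) × ↥(zpowers y) =>
    (⟨z.1 * z.2, mul_mem (mem_sup_left z.1.2) (mem_sup_right z.2.2)⟩ :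
      ((P : Subgroup S) ⊔ zpowers y : Subgroup S))) ⟨?_, ?_⟩)
  · rintro ⟨⟨a, ha⟩, ⟨_, ⟨i, rfl⟩⟩⟩ ⟨⟨b, hb⟩, ⟨_, ⟨j, rfl⟩⟩⟩ heq
    have h1 : a * y ^ i = b * y ^ j := congrArg Subtype.val heq
    have h2 : y ^ (i - j) = a⁻¹ * b := by
      rw [zpow_sub, eq_inv_mul_iff_mul_eq, ← mul_assoc, h1, mul_inv_cancel_right]
    have h3 := h.zpow_mem (i := i - j) (by rw [h2]; exact mul_mem (inv_mem ha) hb)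
    have h4 : y ^ i = y ^ j := by rwa [zpow_sub, mul_inv_eq_one] at h3
    rw [h4, mul_left_inj] at h1
    simp [h1, h4]
  · rintro ⟨w, hw⟩
    obtain ⟨k, hk, i, rfl⟩ := exists_mul_zpow_of_mem_sup h.mem_normalizer hw
    exact ⟨⟨⟨k, hk⟩, ⟨y ^ i, ⟨i, rfl⟩⟩⟩, rfl⟩

lemma ActsOn.dvd_card_sub_one (h : ActsOn P r y) (hS : SecondAbelian S)
    (hnc : ¬ IsCommSub (⊤ : Subgroup S)) : r ∣ Nat.card P - 1 := by
  classical
  have : Fact r.Prime := ⟨h.prime⟩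
  have : Fintype P := Fintype.ofFinite _
  let f : Function.End P := fun x => ⟨y * x * y⁻¹, h.mem x x.2⟩
  have hf : ∀ n : ℕ, ∀ x, ((f ^ n) x : S) = y ^ n * x * (y ^ n)⁻¹ := by
    intro n
    induction n with
    | zero => intro x; simp [Function.End.one_def]
    | succ n ih =>
      intro x
      rw [pow_succ']
      change y * ((f ^ n) x : S) * y⁻¹ = _
      rw [ih, pow_succ' y n]
      group
  have hfr : f ^ r ^ 1 = 1 := by
    funext x
    apply Subtype.ext
    rw [hf, pow_one, h.pow_prime hS hnc]
    simp [Function.End.one_def]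
  have h1 := Equiv.Perm.card_fixedPoints_modEq hfr
  have h2 : Fintype.card f.fixedPoints = 1 := by
    rw [Fintype.card_eq_one_iff]
    refine ⟨⟨⟨1, one_mem _⟩, Subtype.ext (by simp [f])⟩, ?_⟩
    rintro ⟨⟨x, hx⟩, hfx⟩
    have h3 : y * x * y⁻¹ = x := congrArg Subtype.val hfx
    have : x = 1 := h.eq_one_of_comm hS hnc hx (mul_inv_eq_iff_eq_mul.1 h3).symm
    apply Subtype.ext
    exact Subtype.ext this
  rw [h2] at h1
  rw [Nat.card_eq_fintype_card]
  exact (Nat.modEq_iff_dvd' (Fintype.card_pos)).1 h1.symm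

end

/-- A system of representatives of the conjugacy classes of Sylow subgroups of a finite group in
which the centralizer of every nontrivial element is an elementary abelian Sylow subgroup whose
normalizer is an extension by a group of prime order. -/
structure SylowSystem {G : Type*} [Group G] {ι : Type*} (A : ι → Subgroup G) (p r : ι → ℕ) :
    Prop where
  second : SecondAbelian G
  perfect : _root_.commutator G = ⊤
  p_prime : ∀ i, (p i).Prime
  p_inj : Function.Injective p
  p_surj : ∀ n : ℕ, n.Prime → n ∣ Nat.card G → ∃ i, p i = n
  card_eq : ∀ i, ∃ a, 0 < a ∧ Nat.card (A i) = p i ^ a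
  index : ∀ i, ¬ p i ∣ (A i).index
  pow_eq_one : ∀ i, ∀ x ∈ A i, x ^ p i = 1
  comm : ∀ i, IsCommSub (A i)
  cent : ∀ i, ∀ x ∈ A i, x ≠ 1 → centralizer {x} = A i
  norm_ne_top : ∀ i, normalizer (A i : Set G) ≠ ⊤
  card_norm : ∀ i, Nat.card (normalizer (A i : Set G)) = Nat.card (A i) * r i
  r_prime : ∀ i, (r i).Prime
  r_dvd : ∀ i, r i ∣ Nat.card (A i) - 1
  cover : ∀ x : G, x ≠ 1 → ∃ i g, g * x * g⁻¹ ∈ A i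

lemma exists_sylowSystem {S : Type*} [Group S] [Finite S] [IsSimpleGroup S]
    (hS : SecondAbelian S) (hnc : ¬ IsCommSub (⊤ : Subgroup S)) :
    ∃ (A : ↥(Nat.card S).primeFactors → Subgroup S) (r : ↥(Nat.card S).primeFactors → ℕ),
      SylowSystem A (fun i => (i : ℕ)) r := by
  have hpr : ∀ i : ↥(Nat.card S).primeFactors, Fact (i : ℕ).Prime :=
    fun i => ⟨Nat.prime_of_mem_primeFactors i.2⟩
  have hSyl : ∀ i : ↥(Nat.card S).primeFactors, Nonempty (Sylow (i : ℕ) S) := fun i => inferInstance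
  let P : ∀ i : ↥(Nat.card S).primeFactors, Sylow (i : ℕ) S := fun i => (hSyl i).some
  have hPb : ∀ i, (P i : Subgroup S) ≠ ⊥ := fun i =>
    (P i).ne_bot_of_dvd_card (Nat.dvd_of_mem_primeFactors i.2)
  have hact : ∀ i, ∃ r y, ActsOn (P i) r y := fun i =>
    exists_actsOn hS hnc (P i) (hPb i)
  choose r y hry using hact
  refine ⟨fun i => P i, r, hS, commutator_eq_top_of_simple hnc, fun i => (hpr i).out,
    Subtype.val_injective, ?_, ?_, fun i => (P i).not_dvd_index, ?_, ?_, ?_, ?_, ?_, ?_, ?_, ?_⟩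
  · intro n hn hd
    exact ⟨⟨n, Nat.mem_primeFactors.2 ⟨hn, hd, Nat.card_pos.ne'⟩⟩, rfl⟩
  · intro i
    have hnt : Nontrivial (P i : Subgroup S) := (nontrivial_iff_ne_bot _).2 (hPb i)
    exact (IsPGroup.nontrivial_iff_card (P i).2).1 hnt
  · exact fun i x hx => (hry i).pow_eq_one hS hnc hx
  · exact fun i => sylow_isCommSub hS hnc (P i)
  · exact fun i x hx hx1 => (hry i).centralizer_eq hS hnc hx hx1
  · exact fun i => (hry i).normalizer_ne_top hnc
  · exact fun i => (hry i).card_normalizer hS hnc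
  · exact fun i => (hry i).prime
  · exact fun i => (hry i).dvd_card_sub_one hS hnc
  · intro x hx1
    have ho : orderOf x ≠ 1 := by rwa [Ne, orderOf_eq_one_iff]
    obtain ⟨n, hn, hd⟩ := Nat.exists_prime_and_dvd ho
    let i : ↥(Nat.card S).primeFactors :=
      ⟨n, Nat.mem_primeFactors.2 ⟨hn, hd.trans (orderOf_dvd_natCard x), Nat.card_pos.ne'⟩⟩
    set z := x ^ (orderOf x / n) with hz
    have hzo : orderOf z = n := orderOf_pow_orderOf_div (orderOf_pos x).ne' hd
    have hzp : IsPGroup (i : ℕ) (zpowers z) := by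
      rw [IsPGroup.iff_card, Nat.card_zpowers, hzo]
      exact ⟨1, (pow_one n).symm⟩
    obtain ⟨Q, hQ⟩ := hzp.exists_le_sylow
    obtain ⟨g, hg⟩ := MulAction.exists_smul_eq S Q (P i)
    refine ⟨i, g, ?_⟩
    have h1 : g * z * g⁻¹ ∈ (P i : Subgroup S) := by
      rw [← hg]
      change g * z * g⁻¹ ∈ MulAut.conj g • (Q : Subgroup S)
      rw [← MulAut.conj_apply, ← MulAut.smul_def]
      exact smul_mem_pointwise_smul _ _ _ (hQ (mem_zpowers z))
    have h2 : g * z * g⁻¹ ≠ 1 := by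
      intro h
      rw [mul_inv_eq_one, mul_eq_left] at h
      rw [h, orderOf_one] at hzo
      exact hn.one_lt.ne hzo
    rw [← (hry i).centralizer_eq hS hnc h1 h2, mem_centralizer_singleton_iff]
    have : Commute x z := Commute.self_pow x _
    calc g * x * g⁻¹ * (g * z * g⁻¹) = g * (x * z) * g⁻¹ := by group
      _ = g * (z * x) * g⁻¹ := by rw [this.eq]
      _ = _ := by group

namespace SylowSystem

variable {G : Type*} [Group G] [Finite G] {ι : Type*} {A : ι → Subgroup G} {p r : ι → ℕ}

lemma card_coprime (h : SylowSystem A p r) {i j : ι} (hij : i ≠ j) :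
    (Nat.card (A i)).Coprime (Nat.card (A j)) := by
  obtain ⟨a, -, ha⟩ := h.card_eq i
  obtain ⟨b, -, hb⟩ := h.card_eq j
  rw [ha, hb]
  exact Nat.Coprime.pow _ _
    ((Nat.coprime_primes (h.p_prime i) (h.p_prime j)).2 fun e => hij (h.p_inj e))

lemma fusion (h : SylowSystem A p r) {i j : ι} {x t : G} (hx : x ∈ A i) (hx1 : x ≠ 1)
    (hj : t * x * t⁻¹ ∈ A j) : j = i ∧ t ∈ normalizer (A i : Set G) := by
  have hx2 : t * x * t⁻¹ ≠ 1 := by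
    intro h
    rw [mul_inv_eq_one, mul_eq_left] at h
    exact hx1 h
  have hij : j = i := by
    by_contra hij
    have h1 := h.pow_eq_one i x hx
    have h2 := h.pow_eq_one j _ hj
    rw [conj_pow, mul_inv_eq_one, mul_eq_left] at h2
    have h3 := Nat.dvd_gcd (orderOf_dvd_of_pow_eq_one h1) (orderOf_dvd_of_pow_eq_one h2)
    rw [Nat.Coprime.gcd_eq_one ((Nat.coprime_primes (h.p_prime i) (h.p_prime j)).2
      fun e => hij (h.p_inj e).symm), Nat.dvd_one, orderOf_eq_one_iff] at h3
    exact hx1 h3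
  subst hij
  refine ⟨rfl, mem_normalizer_fintype fun a ha => ?_⟩
  change t * a * t⁻¹ ∈ A j
  rw [← h.cent j _ hj hx2, mem_centralizer_singleton_iff]
  calc t * a * t⁻¹ * (t * x * t⁻¹) = t * (a * x) * t⁻¹ := by group
    _ = t * (x * a) * t⁻¹ := by rw [h.comm j a ha x hx]
    _ = _ := by group

lemma card_conj (h : SylowSystem A p r) {x : G} (hx : x ≠ 1) :
    ∃ i, Nat.card {t : G // t * x * t⁻¹ ∈ A i} = Nat.card (A i) * r i ∧
      ∀ j, j ≠ i → ∀ t : G, t * x * t⁻¹ ∉ A j := by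
  obtain ⟨i, g, hg⟩ := h.cover x hx
  have hg1 : g * x * g⁻¹ ≠ 1 := by
    intro h
    rw [mul_inv_eq_one, mul_eq_left] at h
    exact hx h
  have hconj : ∀ t : G, t * x * t⁻¹ = (t * g⁻¹) * (g * x * g⁻¹) * (t * g⁻¹)⁻¹ := by
    intro t; group
  refine ⟨i, ?_, fun j hj t ht => hj (h.fusion hg hg1 (hconj t ▸ ht)).1⟩
  rw [← h.card_norm i]
  refine Nat.card_congr ((Equiv.mulRight g⁻¹).subtypeEquiv fun t => ?_)
  rw [hconj, Equiv.coe_mulRight]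
  refine ⟨fun ht => (h.fusion hg hg1 ht).2, fun ht => ?_⟩
  exact (mem_normalizer_iff.1 ht _).1 hg

lemma r_pos (h : SylowSystem A p r) (i : ι) : 0 < r i := (h.r_prime i).pos

/-- Integration of class functions. -/
lemma sum_eq [Fintype G] [Fintype ι] (h : SylowSystem A p r) {K : Type*} [Field K] [CharZero K]
    {f : G → K} (hf : ∀ t x, f (t * x * t⁻¹) = f x) :
    open Classical in
    ∑ x, f x = f 1 + ∑ i, (Nat.card G : K) / (Nat.card (A i) * r i) *
      ∑ x with x ∈ A i ∧ x ≠ 1, f x := by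
  classical
  have hq : ∀ i, (Nat.card (A i) : K) * r i ≠ 0 := fun i =>
    mul_ne_zero (Nat.cast_ne_zero.2 Nat.card_pos.ne') (Nat.cast_ne_zero.2 (h.r_pos i).ne')
  have h1 : ∀ x : G, x ≠ 1 → f x = ∑ i, ((Nat.card (A i) : K) * r i)⁻¹ *
      ∑ t : G, if t * x * t⁻¹ ∈ A i then f x else 0 := by
    intro x hx
    obtain ⟨i, hi, hj⟩ := h.card_conj hx
    rw [Finset.sum_eq_single i]
    · rw [← Finset.sum_filter, Finset.sum_const, ← Fintype.card_subtype, ← Nat.card_eq_fintype_card,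
        hi, nsmul_eq_mul, ← mul_assoc]
      push_cast
      rw [inv_mul_cancel₀ (hq i), one_mul]
    · intro j _ hji
      rw [Finset.sum_eq_zero, mul_zero]
      intro t _
      rw [if_neg (hj j hji t)]
    · simp
  rw [← Finset.add_sum_erase _ _ (Finset.mem_univ (1 : G))]
  congr 1
  rw [Finset.sum_congr rfl fun x hx => h1 x (Finset.ne_of_mem_erase hx), Finset.sum_comm]
  refine Finset.sum_congr rfl fun i _ => ?_
  rw [← Finset.mul_sum, Finset.sum_comm, div_eq_inv_mul, mul_assoc]
  congr 1
  have h2 : ∀ t : G, (∑ x ∈ Finset.univ.erase 1, if t * x * t⁻¹ ∈ A i then f x else 0) =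
      ∑ x with x ∈ A i ∧ x ≠ 1, f x := by
    intro t
    rw [← Finset.sum_filter]
    refine Finset.sum_bij (fun x _ => t * x * t⁻¹) ?_ ?_ ?_ ?_
    · intro x hx
      simp only [Finset.mem_filter, Finset.mem_erase, Finset.mem_univ, and_true, true_and] at hx ⊢
      refine ⟨hx.2, fun h => ?_⟩
      rw [mul_inv_eq_one, mul_eq_left] at h
      exact hx.1 h
    · intro x _ y _ hxy
      simpa using hxy
    · intro y hy
      simp only [Finset.mem_filter, Finset.mem_univ, true_and] at hy
      refine ⟨t⁻¹ * y * t, ?_, by group⟩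
      simp only [Finset.mem_filter, Finset.mem_erase, Finset.mem_univ, and_true]
      refine ⟨fun h => hy.2 ?_, by convert hy.1 using 1; group⟩
      rw [mul_assoc, inv_mul_eq_one] at h
      simpa using h
    · intro x _
      exact (hf t x).symm
  rw [Finset.sum_congr rfl fun t _ => h2 t, Finset.sum_const, Finset.card_univ, nsmul_eq_mul,
    Nat.card_eq_fintype_card]

end SylowSystem

namespace SylowSystem

variable {G : Type*} [Group G] [Finite G] {ι : Type*} {A : ι → Subgroup G} {p r : ι → ℕ}

lemma two_le_card (h : SylowSystem A p r) (i : ι) : 2 ≤ Nat.card (A i) := by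
  obtain ⟨a, ha, hc⟩ := h.card_eq i
  rw [hc]
  exact (h.p_prime i).two_le.trans (Nat.le_self_pow ha.ne' _)

lemma exists_w (h : SylowSystem A p r) (i : ι) :
    ∃ w, 0 < w ∧ Nat.card (A i) = w * r i + 1 := by
  obtain ⟨w, hw⟩ := h.r_dvd i
  have := h.two_le_card i
  refine ⟨w, Nat.pos_of_ne_zero ?_, ?_⟩
  · rintro rfl
    omega
  · rw [mul_comm] at hw
    omega

lemma card_nontrivial [Fintype G] [DecidableEq G] (i : ι) [DecidablePred fun x => x ∈ A i] :
    (Finset.univ.filter fun x => x ∈ A i ∧ x ≠ 1).card = Nat.card (A i) - 1 := by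
  have : (Finset.univ.filter fun x => x ∈ A i ∧ x ≠ 1) =
      (Finset.univ.filter fun x => x ∈ A i).erase 1 := by
    ext x
    simp [and_comm]
  rw [this, Finset.card_erase_of_mem (by simp [one_mem])]
  congr 1
  rw [Nat.card_eq_fintype_card, ← Fintype.card_subtype]

lemma card_dvd (_h : SylowSystem A p r) (i : ι) : Nat.card (A i) ∣ Nat.card G :=
  Subgroup.card_subgroup_dvd_card _

/-- The class equation. -/
lemma class_equation [Fintype ι] (h : SylowSystem A p r) :
    (Nat.card G : ℚ) = 1 + ∑ i, (Nat.card G : ℚ) / (Nat.card (A i) * r i) *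
      (Nat.card (A i) - 1 : ℚ) := by
  classical
  have : Fintype G := Fintype.ofFinite G
  have h1 := h.sum_eq (K := ℚ) (f := fun _ => 1) (fun _ _ => rfl)
  simp only [Finset.sum_const, nsmul_eq_mul, mul_one, Finset.card_univ] at h1
  rw [← Nat.card_eq_fintype_card] at h1
  refine h1.trans ?_
  congr 1
  refine Finset.sum_congr rfl fun i _ => ?_
  rw [card_nontrivial, Nat.cast_sub Nat.card_pos, Nat.cast_one]

/-- The class equation, divided by the order of the group. -/
lemma class_equation_div [Fintype ι] (h : SylowSystem A p r) :
    ∑ i, (Nat.card (A i) - 1 : ℚ) / (Nat.card (A i) * r i) = 1 - 1 / Nat.card G := by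
  have h1 := h.class_equation
  have hg : (Nat.card G : ℚ) ≠ 0 := Nat.cast_ne_zero.2 Nat.card_pos.ne'
  have h2 : ∑ i, (Nat.card G : ℚ) / (Nat.card (A i) * r i) * (Nat.card (A i) - 1 : ℚ) =
      Nat.card G * ∑ i, (Nat.card (A i) - 1 : ℚ) / (Nat.card (A i) * r i) := by
    rw [Finset.mul_sum]
    refine Finset.sum_congr rfl fun i _ => ?_
    ring
  rw [h2] at h1
  field_simp
  linarith

lemma card_modEq [Fintype ι] (h : SylowSystem A p r) (i : ι) {n : ℕ}
    (hn : Nat.card G = Nat.card (A i) * r i * n) : ∃ t, n = 1 + Nat.card (A i) * t := by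
  classical
  choose w hw hcard using h.exists_w
  choose m hm using h.card_dvd
  have hq0 : ∀ j, (Nat.card (A j) : ℚ) ≠ 0 := fun j => Nat.cast_ne_zero.2 Nat.card_pos.ne'
  have hr0 : ∀ j, (r j : ℚ) ≠ 0 := fun j => Nat.cast_ne_zero.2 (h.r_pos j).ne'
  have h1 : Nat.card G = 1 + ∑ j, m j * w j := by
    have h2 := h.class_equation
    have h3 : ∀ j, (Nat.card G : ℚ) / (Nat.card (A j) * r j) * (Nat.card (A j) - 1 : ℚ) =
        ((m j * w j : ℕ) : ℚ) := by
      intro j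
      have e1 : (Nat.card G : ℚ) = Nat.card (A j) * m j := by exact_mod_cast hm j
      have e2 : (Nat.card (A j) : ℚ) - 1 = w j * r j := by
        have : (Nat.card (A j) : ℚ) = w j * r j + 1 := by exact_mod_cast hcard j
        linarith
      rw [e1, e2]
      have := hq0 j
      have := hr0 j
      push_cast
      field_simp
    rw [Finset.sum_congr rfl fun j _ => h3 j] at h2
    exact_mod_cast h2
  have h4 : Nat.card (A i) ∣ ∑ j ∈ Finset.univ.erase i, m j * w j := by
    refine Finset.dvd_sum fun j hj => Dvd.dvd.mul_right ?_ _
    have hc := h.card_coprime (Finset.ne_of_mem_erase hj)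
    refine hc.symm.dvd_of_dvd_mul_left ?_
    rw [← hm j]
    exact h.card_dvd i
  obtain ⟨s, hs⟩ := h4
  rw [← Finset.add_sum_erase _ _ (Finset.mem_univ i), hs] at h1
  have hmi : m i = r i * n := by
    have := hm i
    rw [hn, mul_assoc] at this
    exact (Nat.eq_of_mul_eq_mul_left Nat.card_pos this).symm
  set q := Nat.card (A i) with hq
  have h5 : q * (r i * n) = 1 + (n * (q - 1) + q * s) := by
    rw [mul_assoc] at hn
    rw [← hn, h1, hmi, show q - 1 = w i * r i by have := hcard i; omega]
    ring
  have hn0 : 0 < n := Nat.pos_of_ne_zero (by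
    rintro rfl
    rw [mul_zero] at hn
    exact Nat.card_pos.ne' hn)
  have hq1 : 2 ≤ q := h.two_le_card i
  have h6 : q ∣ n - 1 := by
    zify [hn0]
    refine ⟨(r i * n : ℤ) * (-1) + n + s, ?_⟩
    have : (q : ℤ) * (r i * n) = 1 + (n * (q - 1) + q * s) := by
      zify [show 1 ≤ q by omega] at h5
      exact h5
    linarith
  obtain ⟨t, ht⟩ := h6
  exact ⟨t, by omega⟩

section Even

variable (h : SylowSystem A p r)
include h

lemma eq_one_of_sq {i : ι} (hi : p i ≠ 2) {s : G} (hs : s ∈ A i) (h2 : s * s = 1) : s = 1 := by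
  have h1 := orderOf_dvd_of_pow_eq_one (h.pow_eq_one i s hs)
  have h3 := orderOf_dvd_of_pow_eq_one ((sq s).trans h2)
  have h4 := Nat.dvd_gcd h1 h3
  rw [Nat.Coprime.gcd_eq_one ((Nat.coprime_primes (h.p_prime i) Nat.prime_two).2 hi),
    Nat.dvd_one, orderOf_eq_one_iff] at h4
  exact h4

lemma sq_of_mem_normalizer {i : ι} (hr : r i = 2) {s : G}
    (hs : s ∈ normalizer (A i : Set G)) (hsA : s ∉ A i) : s ≠ 1 ∧ s * s = 1 := by
  refine ⟨fun h1 => hsA (h1 ▸ one_mem _), ?_⟩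
  by_contra h1
  have hidx : ((A i).subgroupOf (normalizer (A i : Set G))).index = 2 := by
    have h2 := Subgroup.card_mul_index ((A i).subgroupOf (normalizer (A i : Set G)))
    rw [h.card_norm, hr, Nat.card_congr (subgroupOfEquivOfLe le_normalizer).toEquiv] at h2
    exact Nat.eq_of_mul_eq_mul_left Nat.card_pos h2
  have h2 : s * s ∈ A i := by
    have := Subgroup.sq_mem_of_index_two hidx ⟨s, hs⟩
    rw [sq] at this
    exact this
  apply hsA
  rw [← h.cent i _ h2 h1, mem_centralizer_singleton_iff, mul_assoc]

omit h in
omit [Finite G] in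
lemma inv_of_mul {s a : G} (hs : s * s = 1) (hu : (s⁻¹ * a) * (s⁻¹ * a) = 1) :
    s * a * s⁻¹ = a⁻¹ := by
  have e : s⁻¹ = s := inv_eq_of_mul_eq_one_left hs
  rw [e] at hu ⊢
  rw [eq_inv_iff_mul_eq_one]
  simpa [mul_assoc] using hu

lemma mem_normalizer_of_inv {i : ι} {s a : G} (ha : a ∈ A i) (ha1 : a ≠ 1)
    (hs : s * a * s⁻¹ = a⁻¹) : s ∈ normalizer (A i : Set G) :=
  (h.fusion ha ha1 (by rw [hs]; exact inv_mem ha)).2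

lemma exists_normalizer_not_mem (i : ι) : ∃ y ∈ normalizer (A i : Set G), y ∉ A i := by
  by_contra! hcon
  have h1 : normalizer (A i : Set G) = A i := le_antisymm hcon le_normalizer
  have h2 := h.card_norm i
  rw [h1] at h2
  have h3 : 0 < Nat.card (A i) := Nat.card_pos
  nlinarith [(h.r_prime i).two_le]

lemma card_eq_prime {i : ι} (hi : p i ≠ 2) (hr : r i = 2) : Nat.card (A i) = p i := by
  obtain ⟨y, hyN, hyA⟩ := h.exists_normalizer_not_mem i
  obtain ⟨hy1, hy2⟩ := h.sq_of_mem_normalizer hr hyN hyA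
  have hnt : Nontrivial (A i) := by
    rw [← Finite.one_lt_card_iff_nontrivial]
    exact h.two_le_card i
  obtain ⟨⟨a, ha⟩, ha1⟩ := exists_ne (1 : A i)
  replace ha1 : a ≠ 1 := fun e => ha1 (Subtype.ext e)
  have hinv : ∀ b ∈ A i, y * b * y⁻¹ = b⁻¹ := by
    intro b hb
    have h1 : y⁻¹ * b ∈ normalizer (A i : Set G) := mul_mem (inv_mem hyN) (le_normalizer hb)
    have h2 : y⁻¹ * b ∉ A i := by
      intro hc
      apply hyA
      have := mul_mem hb (inv_mem hc)
      simpa using this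
    exact inv_of_mul hy2 (h.sq_of_mem_normalizer hr h1 h2).2
  have hyz : y ∈ normalizer (zpowers a : Set G) := by
    apply mem_normalizer_fintype
    rintro _ ⟨j, rfl⟩
    simp only
    rw [hinv _ (zpow_mem ha j)]
    exact inv_mem (zpow_mem_zpowers a j)
  have hH : zpowers a ⊔ zpowers y = normalizer (A i : Set G) := by
    refine h.second.eq_of_le ?_ (h.norm_ne_top i) ?_
    · intro hc
      apply hyA
      rw [← h.cent i a ha ha1, mem_centralizer_singleton_iff]
      exact hc y (mem_sup_right (mem_zpowers y)) a (mem_sup_left (mem_zpowers a))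
    · rw [sup_le_iff, zpowers_le, zpowers_le]
      exact ⟨le_normalizer ha, hyN⟩
  have hAz : A i = zpowers a := by
    refine le_antisymm (fun w hw => ?_) (by rwa [zpowers_le])
    have hw' : w ∈ zpowers a ⊔ zpowers y := hH ▸ le_normalizer hw
    obtain ⟨_, ⟨j, rfl⟩, k, rfl⟩ := exists_mul_zpow_of_mem_sup hyz hw'
    simp only at hw ⊢
    have h1 : y ^ k ∈ A i := by
      have := mul_mem (inv_mem (zpow_mem ha j)) hw
      rwa [inv_mul_cancel_left] at this
    have h2 : y ^ k = 1 := by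
      apply h.eq_one_of_sq hi h1
      rw [← (Commute.refl y).mul_zpow k, hy2, one_zpow]
    rw [h2, mul_one]
    exact zpow_mem_zpowers a j
  rw [hAz, Nat.card_zpowers]
  have := Fact.mk (h.p_prime i)
  exact orderOf_eq_prime (h.pow_eq_one i a ha) ha1

end Even

end SylowSystem

namespace SylowSystem

variable {G : Type*} [Group G] [Finite G] {ι : Type*} {A : ι → Subgroup G} {p r : ι → ℕ}

lemma even_q (h : SylowSystem A p r) {k : ι} (hk : p k = 2) : ∃ a, 0 < a ∧ Nat.card (A k) = 2 ^ a := by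
  obtain ⟨a, ha, hc⟩ := h.card_eq k
  exact ⟨a, ha, hk ▸ hc⟩

lemma r_ne_two (h : SylowSystem A p r) {k : ι} (hk : p k = 2) : r k ≠ 2 := by
  intro hr
  obtain ⟨a, ha, hc⟩ := h.even_q hk
  have h1 := h.r_dvd k
  have h2 : 2 ∣ 2 ^ a := dvd_pow_self 2 ha.ne'
  have h3 := h.two_le_card k
  rw [hr] at h1
  rw [← hc] at h2
  omega

section

variable [Fintype G] [DecidableEq G] [Fintype ι] [DecidableEq ι]
  [∀ i, DecidablePred fun x => x ∈ A i]

lemma count_two (h : SylowSystem A p r) {k : ι} (hk : p k = 2) {a : G} (ha : a ∈ A k)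
    (ha1 : a ≠ 1) :
    (Finset.univ.filter fun s : G => (s ≠ 1 ∧ s * s = 1) ∧
      (s⁻¹ * a ≠ 1 ∧ (s⁻¹ * a) * (s⁻¹ * a) = 1)).card = Nat.card (A k) - 2 := by
  have hsq : ∀ x ∈ A k, x * x = 1 := by
    intro x hx
    have := h.pow_eq_one k x hx
    rwa [hk, sq] at this
  have : (Finset.univ.filter fun s : G => (s ≠ 1 ∧ s * s = 1) ∧
      (s⁻¹ * a ≠ 1 ∧ (s⁻¹ * a) * (s⁻¹ * a) = 1)) =
      (Finset.univ.filter fun x => x ∈ A k ∧ x ≠ 1).erase a := by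
    ext s
    simp only [Finset.mem_filter, Finset.mem_univ, true_and, Finset.mem_erase]
    constructor
    · rintro ⟨⟨hs1, hs2⟩, hu1, hu2⟩
      refine ⟨fun e => hu1 (by rw [e, inv_mul_cancel]), ?_, hs1⟩
      have h1 := inv_of_mul hs2 hu2
      rw [inv_eq_of_mul_eq_one_left (hsq a ha), mul_inv_eq_iff_eq_mul] at h1
      rw [← h.cent k a ha ha1, mem_centralizer_singleton_iff, h1]
    · rintro ⟨hsa, hs, hs1⟩
      refine ⟨⟨hs1, hsq s hs⟩, fun e => hsa ?_, hsq _ (mul_mem (inv_mem hs) ha)⟩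
      rw [inv_mul_eq_one] at e
      exact e
  rw [this, Finset.card_erase_of_mem (by simp [ha, ha1]), card_nontrivial]
  omega

lemma count_inverted (h : SylowSystem A p r) {i : ι} (hi : p i ≠ 2) (hr : r i = 2) {a : G}
    (ha : a ∈ A i) (ha1 : a ≠ 1) :
    (Finset.univ.filter fun s : G => (s ≠ 1 ∧ s * s = 1) ∧
      (s⁻¹ * a ≠ 1 ∧ (s⁻¹ * a) * (s⁻¹ * a) = 1)).card = Nat.card (A i) := by
  classical
  have : (Finset.univ.filter fun s : G => (s ≠ 1 ∧ s * s = 1) ∧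
      (s⁻¹ * a ≠ 1 ∧ (s⁻¹ * a) * (s⁻¹ * a) = 1)) =
      (Finset.univ.filter fun x => x ∈ normalizer (A i : Set G)) \
        (Finset.univ.filter fun x => x ∈ A i) := by
    ext s
    simp only [Finset.mem_filter, Finset.mem_univ, true_and, Finset.mem_sdiff]
    constructor
    · rintro ⟨⟨hs1, hs2⟩, hu1, hu2⟩
      exact ⟨h.mem_normalizer_of_inv ha ha1 (inv_of_mul hs2 hu2),
        fun hs => hs1 (h.eq_one_of_sq hi hs hs2)⟩
    · rintro ⟨hsN, hsA⟩
      refine ⟨h.sq_of_mem_normalizer hr hsN hsA, h.sq_of_mem_normalizer hr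
        (mul_mem (inv_mem hsN) (le_normalizer ha)) fun hc => hsA ?_⟩
      have := mul_mem ha (inv_mem hc)
      simpa using this
  rw [this, Finset.card_sdiff_of_subset, ← Fintype.card_subtype, ← Fintype.card_subtype,
    ← Nat.card_eq_fintype_card, ← Nat.card_eq_fintype_card]
  · have := h.card_norm i
    rw [hr] at this
    omega
  · intro x hx
    simp only [Finset.mem_filter, Finset.mem_univ, true_and] at hx ⊢
    exact le_normalizer hx

lemma count_zero (h : SylowSystem A p r) {i : ι} (hi : p i ≠ 2) (hr : r i ≠ 2) {a : G}
    (ha : a ∈ A i) (ha1 : a ≠ 1) :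
    (Finset.univ.filter fun s : G => (s ≠ 1 ∧ s * s = 1) ∧
      (s⁻¹ * a ≠ 1 ∧ (s⁻¹ * a) * (s⁻¹ * a) = 1)).card = 0 := by
  rw [Finset.card_eq_zero, Finset.filter_eq_empty_iff]
  rintro s - ⟨⟨hs1, hs2⟩, hu1, hu2⟩
  have hsN := h.mem_normalizer_of_inv ha ha1 (inv_of_mul hs2 hu2)
  have h1 : orderOf s = 2 := orderOf_eq_prime ((sq s).trans hs2) hs1
  have h2 : 2 ∣ Nat.card (normalizer (A i : Set G)) := by
    rw [← h1]
    exact Subgroup.orderOf_dvd_natCard _ hsN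
  obtain ⟨a, -, hc⟩ := h.card_eq i
  rw [h.card_norm, hc, Nat.prime_two.dvd_mul] at h2
  rcases h2 with h2 | h2
  · exact hi ((Nat.prime_dvd_prime_iff_eq Nat.prime_two (h.p_prime i)).1
      (Nat.prime_two.dvd_of_dvd_pow h2)).symm
  · exact hr ((Nat.prime_dvd_prime_iff_eq Nat.prime_two (h.r_prime i)).1 h2).symm

lemma involution_count (h : SylowSystem A p r) {k : ι} (hk : p k = 2) :
    ((Finset.univ.filter fun s : G => s ≠ 1 ∧ s * s = 1).card : ℚ) =
      (Nat.card G : ℚ) / (Nat.card (A k) * r k) * (Nat.card (A k) - 1) := by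
  have hcl : ∀ t x : G, (if (t * x * t⁻¹ ≠ 1 ∧ t * x * t⁻¹ * (t * x * t⁻¹) = 1) then (1 : ℚ) else 0) =
      if (x ≠ 1 ∧ x * x = 1) then 1 else 0 := by
    intro t x
    have e1 : t * x * t⁻¹ = 1 ↔ x = 1 := by rw [mul_inv_eq_one, mul_eq_left]
    have e2 : t * x * t⁻¹ * (t * x * t⁻¹) = t * (x * x) * t⁻¹ := by group
    have e3 : t * (x * x) * t⁻¹ = 1 ↔ x * x = 1 := by rw [mul_inv_eq_one, mul_eq_left]
    rw [e2]
    simp only [Ne, e1, e3]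
  have h1 := h.sum_eq (f := fun x : G => if (x ≠ 1 ∧ x * x = 1) then (1 : ℚ) else 0) hcl
  rw [Finset.sum_boole] at h1
  rw [h1, if_neg (by simp), zero_add, Finset.sum_eq_single k]
  · congr 1
    rw [Finset.sum_congr rfl fun x hx => if_pos ?_, Finset.sum_const, nsmul_eq_mul, mul_one]
    · have h2 := h.two_le_card k
      have h3 : ((Nat.card (A k) - 1 : ℕ) : ℚ) = (Nat.card (A k) : ℚ) - 1 := by
        rw [Nat.cast_sub (by omega), Nat.cast_one]
      rw [← h3, ← card_nontrivial (A := A) k]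
      congr!
    · simp only [Finset.mem_filter, Finset.mem_univ, true_and] at hx
      refine ⟨hx.2, ?_⟩
      have := h.pow_eq_one k x hx.1
      rwa [hk, sq] at this
  · intro i _ hik
    rw [Finset.sum_eq_zero, mul_zero]
    intro x hx
    simp only [Finset.mem_filter, Finset.mem_univ, true_and] at hx
    rw [if_neg]
    rintro ⟨hx1, hx2⟩
    exact hx1 (h.eq_one_of_sq (fun e => hik (h.p_inj (e.trans hk.symm))) hx.1 hx2)
  · simp

lemma sum_pairs :
    ∑ x : G, ((Finset.univ.filter fun s : G => (s ≠ 1 ∧ s * s = 1) ∧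
      (s⁻¹ * x ≠ 1 ∧ (s⁻¹ * x) * (s⁻¹ * x) = 1)).card : ℚ) =
    ((Finset.univ.filter fun s : G => s ≠ 1 ∧ s * s = 1).card : ℚ) ^ 2 := by
  simp_rw [← Finset.sum_boole]
  rw [Finset.sum_comm, sq, Finset.sum_mul]
  refine Finset.sum_congr rfl fun s _ => ?_
  by_cases hs : s ≠ 1 ∧ s * s = 1
  · simp only [hs, true_and, if_true, one_mul, not_false_eq_true, and_self, Ne]
    exact Equiv.sum_comp (Equiv.mulLeft s⁻¹) fun x => if (¬ x = 1 ∧ x * x = 1) then (1 : ℚ) else 0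
  · simp [hs]

lemma involution_count_sq (h : SylowSystem A p r) {k : ι} (hk : p k = 2) :
    ((Finset.univ.filter fun s : G => s ≠ 1 ∧ s * s = 1).card : ℚ) ^ 2 =
      ((Finset.univ.filter fun s : G => s ≠ 1 ∧ s * s = 1).card : ℚ) +
      (Nat.card G : ℚ) / (Nat.card (A k) * r k) * ((Nat.card (A k) - 1) * (Nat.card (A k) - 2)) +
      (Nat.card G : ℚ) / 2 * ∑ i with r i = 2, ((Nat.card (A i) : ℚ) - 1) := by
  have hcl : ∀ t x : G, ((Finset.univ.filter fun s : G => (s ≠ 1 ∧ s * s = 1) ∧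
      (s⁻¹ * (t * x * t⁻¹) ≠ 1 ∧ (s⁻¹ * (t * x * t⁻¹)) * (s⁻¹ * (t * x * t⁻¹)) = 1)).card : ℚ) =
      ((Finset.univ.filter fun s : G => (s ≠ 1 ∧ s * s = 1) ∧
      (s⁻¹ * x ≠ 1 ∧ (s⁻¹ * x) * (s⁻¹ * x) = 1)).card : ℚ) := by
    intro t x
    congr 1
    symm
    have key : ∀ y : G, (t * y * t⁻¹ ≠ 1 ∧ t * y * t⁻¹ * (t * y * t⁻¹) = 1) ↔
        (y ≠ 1 ∧ y * y = 1) := by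
      intro y
      have e1 : t * y * t⁻¹ = 1 ↔ y = 1 := by rw [mul_inv_eq_one, mul_eq_left]
      have e2 : t * y * t⁻¹ * (t * y * t⁻¹) = t * (y * y) * t⁻¹ := by group
      have e3 : t * (y * y) * t⁻¹ = 1 ↔ y * y = 1 := by rw [mul_inv_eq_one, mul_eq_left]
      rw [e2]
      simp only [Ne, e1, e3]
    refine Finset.card_bij (fun s _ => t * s * t⁻¹) ?_ ?_ ?_
    · intro s hs
      simp only [Finset.mem_filter, Finset.mem_univ, true_and] at hs ⊢
      refine ⟨(key s).2 hs.1, ?_⟩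
      have e : (t * s * t⁻¹)⁻¹ * (t * x * t⁻¹) = t * (s⁻¹ * x) * t⁻¹ := by group
      rw [e]
      exact (key _).2 hs.2
    · intro s _ u _ hsu
      simpa using hsu
    · intro s hs
      simp only [Finset.mem_filter, Finset.mem_univ, true_and] at hs
      refine ⟨t⁻¹ * s * t, ?_, by group⟩
      simp only [Finset.mem_filter, Finset.mem_univ, true_and]
      have e1 : s = t * (t⁻¹ * s * t) * t⁻¹ := by group
      have e : s⁻¹ * (t * x * t⁻¹) = t * ((t⁻¹ * s * t)⁻¹ * x) * t⁻¹ := by group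
      rw [e] at hs
      refine ⟨(key _).1 (e1 ▸ hs.1), (key _).1 hs.2⟩
  rw [← sum_pairs, h.sum_eq hcl]
  have h1 : (Finset.univ.filter fun s : G => (s ≠ 1 ∧ s * s = 1) ∧
      (s⁻¹ * 1 ≠ 1 ∧ (s⁻¹ * 1) * (s⁻¹ * 1) = 1)) =
      (Finset.univ.filter fun s : G => s ≠ 1 ∧ s * s = 1) := by
    ext s
    simp only [Finset.mem_filter, Finset.mem_univ, true_and, mul_one]
    refine ⟨fun hs => hs.1, fun hs => ⟨hs, ?_⟩⟩
    rw [inv_eq_of_mul_eq_one_left hs.2]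
    exact hs
  rw [h1, ← Finset.add_sum_erase _ _ (Finset.mem_univ k), add_assoc]
  have hnt : ∀ (i : ι) (d : DecidablePred fun x => x ∈ A i ∧ x ≠ 1),
      ((Finset.univ.filter fun x => x ∈ A i ∧ x ≠ 1).card : ℚ) = (Nat.card (A i) : ℚ) - 1 := by
    intro i d
    have h2 := h.two_le_card i
    have h3 : ((Nat.card (A i) - 1 : ℕ) : ℚ) = (Nat.card (A i) : ℚ) - 1 := by
      rw [Nat.cast_sub (by omega), Nat.cast_one]
    rw [← h3, ← card_nontrivial (A := A) i]
    congr!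
  congr 2
  · congr 1
    rw [Finset.sum_congr rfl fun a ha => by
      simp only [Finset.mem_filter, Finset.mem_univ, true_and] at ha
      rw [h.count_two hk ha.1 ha.2], Finset.sum_const, nsmul_eq_mul, hnt,
      Nat.cast_sub (h.two_le_card k), Nat.cast_ofNat]
  · have hsub : (Finset.univ.filter fun i => r i = 2) ⊆ Finset.univ.erase k := by
      intro i hi
      simp only [Finset.mem_filter, Finset.mem_univ, true_and] at hi
      rw [Finset.mem_erase]
      refine ⟨?_, Finset.mem_univ i⟩
      rintro rfl
      exact h.r_ne_two hk hi
    rw [← Finset.sum_subset hsub, Finset.mul_sum]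
    · refine Finset.sum_congr rfl fun i hi => ?_
      have hik := Finset.ne_of_mem_erase (hsub hi)
      simp only [Finset.mem_filter, Finset.mem_univ, true_and] at hi
      rw [Finset.sum_congr rfl fun a ha => by
        simp only [Finset.mem_filter, Finset.mem_univ, true_and] at ha
        rw [h.count_inverted (fun e => hik (h.p_inj (e.trans hk.symm))) hi ha.1 ha.2],
        Finset.sum_const, nsmul_eq_mul, hnt, hi]
      have : (Nat.card (A i) : ℚ) ≠ 0 := Nat.cast_ne_zero.2 Nat.card_pos.ne'
      push_cast
      field_simp
    · intro i hik hi
      replace hik := Finset.ne_of_mem_erase hik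
      simp only [Finset.mem_filter, Finset.mem_univ, true_and] at hi
      rw [Finset.sum_eq_zero, mul_zero]
      intro a ha
      simp only [Finset.mem_filter, Finset.mem_univ, true_and] at ha
      rw [h.count_zero (fun e => hik (h.p_inj (e.trans hk.symm))) hi ha.1 ha.2, Nat.cast_zero]

end

end SylowSystem

lemma even_arith_single {a q r w n t x g : ℕ} (hq : q = 2 ^ a) (hwr : q = w * r + 1) (hw : 0 < w)
    (hr : 3 ≤ r) (hn : n = 1 + q * t) (ht : 0 < t) (hg : g = q * r * n) (hx : x.Prime)
    (hx2 : x ≠ 2) (hd : x ∣ g) (hT : x - 1 = 2 * w * (q - 1) * t) : False := by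
  have hx1 := hx.two_le
  obtain ⟨v, rfl⟩ : ∃ v, q = v + 1 := ⟨w * r, hwr⟩
  have hv : v = w * r := by omega
  have hrv : r ≤ v := by rw [hv]; exact Nat.le_mul_of_pos_left r hw
  simp only [Nat.add_sub_cancel] at hT
  have h1 : 2 * (v * t) ≤ x - 1 := by
    rw [hT]
    calc 2 * (v * t) = 2 * 1 * v * t := by ring
      _ ≤ 2 * w * v * t := by gcongr; exact hw
  have h2 : v ≤ v * t := Nat.le_mul_of_pos_right v ht
  have hxr : ¬ x ∣ r := fun h => by
    have := Nat.le_of_dvd (by omega) h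
    omega
  have hxq : ¬ x ∣ v + 1 := fun h => by
    rw [hq] at h
    exact hx2 ((Nat.prime_dvd_prime_iff_eq hx Nat.prime_two).1 (hx.dvd_of_dvd_pow h))
  rw [hg, hx.dvd_mul, hx.dvd_mul] at hd
  have h3 : x ∣ n := by tauto
  have h4 := Nat.le_of_dvd (by omega) h3
  have h5 : 3 * t ≤ v * t := Nat.mul_le_mul_right t (hr.trans hrv)
  rw [hn, add_mul] at h4
  omega

lemma even_arith_pair {a q r w n t x y g : ℕ} (hq : q = 2 ^ a) (hwr : q = w * r + 1) (hw : 0 < w)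
    (hr : 3 ≤ r) (hn : n = 1 + q * t) (ht : 0 < t) (hg : g = q * r * n) (hx : x.Prime)
    (hx2 : x ≠ 2) (hd : x ∣ g) (hy : y.Prime) (hy2 : y ≠ 2) (hyd : y ∣ g) (hxy : x < y)
    (hrp : r.Prime) (hT : (x - 1) + (y - 1) = 2 * w * (q - 1) * t) :
    g = 60 ∧ q * r = 12 := by
  have hx1 := hx.two_le
  obtain ⟨v, rfl⟩ : ∃ v, q = v + 1 := ⟨w * r, hwr⟩
  have hv : v = w * r := by omega
  have hrv : r ≤ v := by rw [hv]; exact Nat.le_mul_of_pos_left r hw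
  simp only [Nat.add_sub_cancel] at hT
  have h1 : v * t ≤ w * v * t := by
    calc v * t = 1 * v * t := by ring
      _ ≤ w * v * t := by gcongr; exact hw
  have hT' : 2 * w * v * t = 2 * (w * v * t) := by ring
  rw [hT'] at hT
  have h2 : v ≤ v * t := Nat.le_mul_of_pos_right v ht
  have hnot : ∀ z : ℕ, z.Prime → z ≠ 2 → ¬ z ∣ v + 1 := fun z hz hz2 h => by
    rw [hq] at h
    exact hz2 ((Nat.prime_dvd_prime_iff_eq hz Nat.prime_two).1 (hz.dvd_of_dvd_pow h))
  have hyr : ¬ y ∣ r := fun h => by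
    have := Nat.le_of_dvd (by omega) h
    omega
  have hyq := hnot y hy hy2
  rw [hg, hy.dvd_mul, hy.dvd_mul] at hyd
  have h3 : y ∣ n := by tauto
  have h5 : 3 * t ≤ v * t := Nat.mul_le_mul_right t (hr.trans hrv)
  have hn' : n = 1 + v * t + t := by rw [hn]; ring
  obtain ⟨c, hc⟩ := h3
  have hc1 : c = 1 := by
    rcases c with _ | _ | c
    · omega
    · rfl
    · exfalso
      have : y * (c + 1 + 1) = y * c + 2 * y := by ring
      have := Nat.zero_le (y * c)
      omega
  subst hc1
  rw [mul_one] at hc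
  have hw1 : w = 1 := by
    by_contra hne
    have h6 : 2 ≤ w := by omega
    have : 2 * (v * t) ≤ w * v * t := by
      calc 2 * (v * t) = 2 * v * t := by ring
        _ ≤ w * v * t := by gcongr
    omega
  subst hw1
  rw [one_mul] at hv
  subst hv
  rw [one_mul] at hT
  have hxn : ¬ x ∣ n := fun h => by
    rw [hc] at h
    have := (Nat.prime_dvd_prime_iff_eq hx hy).1 h
    omega
  have hxq := hnot x hx hx2
  rw [hg, hx.dvd_mul, hx.dvd_mul] at hd
  have hxr : x ∣ v := by tauto
  have hxe := (Nat.prime_dvd_prime_iff_eq hx hrp).1 hxr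
  have ht1 : t = 1 := by
    by_contra hne
    have h6 : 2 ≤ t := by omega
    have h7 : 2 * (v - 1) ≤ t * (v - 1) := Nat.mul_le_mul_right _ h6
    have h8 : t * (v - 1) = v * t - t := by rw [Nat.mul_sub, mul_one, mul_comm]
    omega
  subst ht1
  rw [mul_one] at hn'
  have hy3 : y = v + 2 := by omega
  have hnot3 : ¬ 3 ∣ v + 1 := hnot 3 Nat.prime_three (by norm_num)
  have hv3 : v = 3 := by
    have : 3 ∣ v ∨ 3 ∣ v + 2 := by omega
    rcases this with h | h
    · exact ((Nat.prime_dvd_prime_iff_eq Nat.prime_three hrp).1 h).symm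
    · rw [hy3] at hy
      have := (Nat.prime_dvd_prime_iff_eq Nat.prime_three hy).1 h
      omega
  subst hv3
  rw [hg, hn']
  norm_num

namespace SylowSystem

variable {G : Type*} [Group G] [Finite G] {ι : Type*} {A : ι → Subgroup G} {p r : ι → ℕ}

lemma even_case [Fintype ι] (h : SylowSystem A p r) {k : ι} (hk : p k = 2) :
    Nat.card G = 60 ∧ Nat.card (normalizer (A k : Set G)) = 12 := by
  classical
  have : Fintype G := Fintype.ofFinite G
  obtain ⟨a, -, hq⟩ := h.even_q hk
  obtain ⟨w, hw, hwr⟩ := h.exists_w k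
  have hr : 3 ≤ r k := by
    have h1 := (h.r_prime k).two_le
    have h2 := h.r_ne_two hk
    omega
  obtain ⟨n, hg⟩ : ∃ n, Nat.card G = Nat.card (A k) * r k * n := by
    rw [← h.card_norm]
    exact Subgroup.card_subgroup_dvd_card _
  obtain ⟨t, hn⟩ := h.card_modEq k hg
  have ht : 0 < t := by
    refine Nat.pos_of_ne_zero ?_
    rintro rfl
    apply h.norm_ne_top k
    rw [← Subgroup.card_eq_iff_eq_top, h.card_norm, hg, hn]
    ring
  have hne : ∀ i, r i = 2 → p i ≠ 2 := fun i hi hp => h.r_ne_two hp hi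
  have hpd : ∀ i, r i = 2 → p i ∣ Nat.card G := fun i hi => by
    rw [← h.card_eq_prime (hne i hi) hi]
    exact h.card_dvd i
  have hT : ∑ i with r i = 2, (p i - 1) = 2 * w * (Nat.card (A k) - 1) * t := by
    have h1 := h.involution_count_sq hk
    rw [h.involution_count hk] at h1
    have hq1 := h.two_le_card k
    have h2 : ∑ i with r i = 2, ((Nat.card (A i) : ℚ) - 1) =
        ((∑ i with r i = 2, (p i - 1) : ℕ) : ℚ) := by
      rw [Nat.cast_sum]
      refine Finset.sum_congr rfl fun i hi => ?_
      simp only [Finset.mem_filter, Finset.mem_univ, true_and] at hi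
      rw [h.card_eq_prime (hne i hi) hi, Nat.cast_sub (h.p_prime i).one_le, Nat.cast_one]
    rw [h2] at h1
    have hq0 : (Nat.card (A k) : ℚ) ≠ 0 := Nat.cast_ne_zero.2 (by omega)
    have hr0 : (r k : ℚ) ≠ 0 := Nat.cast_ne_zero.2 (by omega)
    have hn0 : (n : ℚ) ≠ 0 := Nat.cast_ne_zero.2 (by omega)
    have hgn : (Nat.card G : ℚ) / (Nat.card (A k) * r k) = n := by
      rw [hg]
      push_cast
      field_simp
    have hqw : (Nat.card (A k) : ℚ) = w * r k + 1 := by rw [hwr]; push_cast; ring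
    have hnt : (n : ℚ) = 1 + Nat.card (A k) * t := by rw [hn]; push_cast; ring
    rw [hgn] at h1
    have hg' : (Nat.card G : ℚ) = Nat.card (A k) * r k * n := by rw [hg]; push_cast; ring
    rw [hg'] at h1
    have h3 : ((∑ i with r i = 2, (p i - 1) : ℕ) : ℚ) =
        ((2 * w * (Nat.card (A k) - 1) * t : ℕ) : ℚ) := by
      push_cast [Nat.cast_sub (show 1 ≤ Nat.card (A k) by omega)]
      push_cast at h1
      set T := ∑ i with r i = 2, ((p i - 1 : ℕ) : ℚ)
      set q := (Nat.card (A k) : ℚ)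
      have h4 : (q * r k * n) * T = (q * r k * n) * (2 * w * (q - 1) * t) := by
        have h5 : (q * r k * n) * T = 2 * (n * (n - 1) * (q - 1) ^ 2) := by linear_combination 2 * -h1
        rw [h5]
        have h6 : (n : ℚ) - 1 = q * t := by rw [hnt]; ring
        have h7 : q - 1 = w * r k := by rw [hqw]; ring
        rw [h6, sq, h7]
        ring
      exact mul_left_cancel₀ (mul_ne_zero (mul_ne_zero hq0 hr0) hn0) h4
    exact_mod_cast h3
  have hcard : (Finset.univ.filter fun i => r i = 2).card ≤ 2 := by
    by_contra! hcon
    have h1 := h.class_equation_div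
    have hg0 : (0 : ℚ) < 1 / Nat.card G := by
      have : (0 : ℚ) < Nat.card G := Nat.cast_pos.2 Nat.card_pos
      positivity
    have h2 : ∑ i with r i = 2, (1 / 3 : ℚ) ≤
        ∑ i, (Nat.card (A i) - 1 : ℚ) / (Nat.card (A i) * r i) := by
      refine (Finset.sum_le_sum fun i hi => ?_).trans
        (Finset.sum_le_sum_of_subset_of_nonneg (Finset.subset_univ _) fun i _ _ => ?_)
      · simp only [Finset.mem_filter, Finset.mem_univ, true_and] at hi
        have h3 : 3 ≤ Nat.card (A i) := by
          rw [h.card_eq_prime (hne i hi) hi]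
          have := (h.p_prime i).two_le
          have := hne i hi
          omega
        have h4 : (3 : ℚ) ≤ Nat.card (A i) := by exact_mod_cast h3
        rw [hi, div_le_div_iff₀ (by norm_num) (by push_cast; linarith)]
        push_cast
        linarith
      · have h3 := h.two_le_card i
        have h4 : (2 : ℚ) ≤ Nat.card (A i) := by exact_mod_cast h3
        exact div_nonneg (by linarith) (by positivity)
    rw [Finset.sum_const, nsmul_eq_mul, h1] at h2
    have h3 : (3 : ℚ) ≤ (Finset.univ.filter fun i => r i = 2).card := by exact_mod_cast hcon
    linarith
  rw [h.card_norm]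
  rcases Nat.lt_or_ge (Finset.univ.filter fun i => r i = 2).card 2 with hlt | hge
  · exfalso
    rcases Nat.lt_or_ge (Finset.univ.filter fun i => r i = 2).card 1 with hlt1 | hge1
    · rw [Finset.card_eq_zero.1 (by omega : (Finset.univ.filter fun i => r i = 2).card = 0),
        Finset.sum_empty] at hT
      have := h.two_le_card k
      have h0 : 0 < 2 * w * (Nat.card (A k) - 1) * t := by
        have : 0 < Nat.card (A k) - 1 := by omega
        positivity
      omega
    · obtain ⟨i, hi⟩ := Finset.card_eq_one.1 (by omega : (Finset.univ.filter fun i => r i = 2).card = 1)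
      have him : i ∈ (Finset.univ.filter fun i => r i = 2) := hi ▸ Finset.mem_singleton_self i
      simp only [Finset.mem_filter, Finset.mem_univ, true_and] at him
      rw [hi, Finset.sum_singleton] at hT
      exact even_arith_single hq hwr hw hr hn ht hg (h.p_prime i) (hne i him) (hpd i him) hT
  · obtain ⟨i, j, hij, hs⟩ := Finset.card_eq_two.1 (le_antisymm hcard hge)
    have him : i ∈ (Finset.univ.filter fun i => r i = 2) := by rw [hs]; simp
    have hjm : j ∈ (Finset.univ.filter fun i => r i = 2) := by rw [hs]; simp
    simp only [Finset.mem_filter, Finset.mem_univ, true_and] at him hjm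
    rw [hs, Finset.sum_pair hij] at hT
    rcases lt_or_gt_of_ne (fun e => hij (h.p_inj e)) with hlt | hlt
    · exact even_arith_pair hq hwr hw hr hn ht hg (h.p_prime i) (hne i him) (hpd i him)
        (h.p_prime j) (hne j hjm) (hpd j hjm) hlt (h.r_prime k) hT
    · rw [add_comm] at hT
      exact even_arith_pair hq hwr hw hr hn ht hg (h.p_prime j) (hne j hjm) (hpd j hjm)
        (h.p_prime i) (hne i him) (hpd i him) hlt (h.r_prime k) hT

end SylowSystem

/-- A simple group of order 60 with a subgroup of order 12 is the alternating group. -/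
lemma nonempty_mulEquiv_alternatingGroup {G : Type*} [Group G] [Finite G] [IsSimpleGroup G]
    (hperf : _root_.commutator G = ⊤) (hG : Nat.card G = 60) (N : Subgroup G)
    (hN : Nat.card N = 12) : Nonempty (G ≃* ↥(alternatingGroup (Fin 5))) := by
  have hidx : Nat.card (G ⧸ N) = 5 := by
    have := N.card_mul_index
    rw [hN, hG, Subgroup.index] at this
    omega
  have : Fintype (G ⧸ N) := Fintype.ofFinite _
  let e : G ⧸ N ≃ Fin 5 := Finite.equivFinOfCardEq hidx
  let f : G →* Equiv.Perm (Fin 5) :=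
    (e.permCongrHom : Equiv.Perm (G ⧸ N) →* Equiv.Perm (Fin 5)).comp (MulAction.toPermHom G (G ⧸ N))
  have hker : f.ker = ⊥ := by
    have hn : f.ker.Normal := inferInstance
    rcases hn.eq_bot_or_eq_top with h | h
    · exact h
    · exfalso
      have h1 : N = ⊤ := by
        rw [eq_top_iff]
        intro x _
        have hx : x ∈ f.ker := h ▸ mem_top x
        have h2 : e.permCongrHom (MulAction.toPermHom G (G ⧸ N) x) = 1 := hx
        rw [EmbeddingLike.map_eq_one_iff] at h2
        have h3 : x • ((1 : G) : G ⧸ N) = ((1 : G) : G ⧸ N) := by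
          have := congrArg (fun s : Equiv.Perm (G ⧸ N) => s ((1 : G) : G ⧸ N)) h2
          simpa using this
        rw [MulAction.Quotient.smul_mk, smul_eq_mul, mul_one, QuotientGroup.eq] at h3
        simpa using h3
      rw [h1, Subgroup.card_top] at hN
      omega
  have hinj : Function.Injective f := (MonoidHom.ker_eq_bot_iff f).1 hker
  have hmem : ∀ x, f x ∈ alternatingGroup (Fin 5) := by
    intro x
    have h1 : (Equiv.Perm.sign.comp f).ker = ⊤ := by
      rw [eq_top_iff, ← hperf]
      exact Abelianization.commutator_subset_ker _
    have hx : x ∈ (Equiv.Perm.sign.comp f).ker := h1 ▸ mem_top x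
    exact hx
  let F : G →* alternatingGroup (Fin 5) := f.codRestrict _ hmem
  have hF : Function.Injective F := fun x y hxy => hinj (congrArg Subtype.val hxy)
  have hc : Nat.card (alternatingGroup (Fin 5)) = 60 := by
    rw [nat_card_alternatingGroup]
    simp [Nat.factorial]
  exact ⟨MulEquiv.ofBijective F ((Nat.bijective_iff_injective_and_card F).2 ⟨hF, hG.trans hc.symm⟩)⟩

lemma odd_arith {ι : Type*} [Fintype ι] [Nonempty ι] [DecidableEq ι] {w q r : ι → ℕ} {c : ι → ι → ℤ}
    {g : ℚ} (hq : ∀ i, q i = w i * r i + 1) (hw : ∀ i, 2 ≤ w i) (hr : ∀ i, 2 ≤ r i)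
    (hinj : Function.Injective q)
    (hcls : ∑ i, (w i : ℚ) / q i = 1 - 1 / g)
    (hpar : ∀ i j, i ≠ j → Odd (c i j + c j i))
    (hrow : ∀ i, ∑ j ∈ Finset.univ.erase i, (c i j : ℚ) ^ 2 * (w j / q j) + 1 / g ≤ r i / q i)
    (hcol : ∀ i, ∑ k ∈ Finset.univ.erase i, (w k : ℤ) * c k i ^ 2 ≤ r i - 1) : False := by
  obtain ⟨i, hi⟩ := Finite.exists_min r
  have hqpos : ∀ j, (0 : ℚ) < q j := fun j => by
    rw [hq]
    positivity
  have hwpos : ∀ j, (2 : ℚ) ≤ w j := fun j => by exact_mod_cast hw j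
  have hr2 : (2 : ℚ) ≤ r i := by exact_mod_cast hr i
  set K := (Finset.univ.erase i).filter fun j => c j i ≠ 0 with hK
  set L := (Finset.univ.erase i).filter fun j => ¬ c j i ≠ 0 with hL
  have hsplit : ∑ j, (w j : ℚ) / q j = w i / q i + (∑ j ∈ K, (w j : ℚ) / q j + ∑ j ∈ L, (w j : ℚ) / q j) := by
    rw [hK, hL, Finset.sum_filter_add_sum_filter_not,
      Finset.add_sum_erase _ (fun j => (w j : ℚ) / q j) (Finset.mem_univ i)]
  have hLle : ∑ j ∈ L, (w j : ℚ) / q j + 1 / g ≤ r i / q i := by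
    refine le_trans ?_ (hrow i)
    gcongr
    refine (Finset.sum_le_sum fun j hj => ?_).trans
      (Finset.sum_le_sum_of_subset_of_nonneg (Finset.filter_subset _ _) fun j _ _ => ?_)
    · simp only [hL, Finset.mem_filter, Finset.mem_erase, Finset.mem_univ, not_not] at hj
      have h1 := hpar i j (Ne.symm hj.1.1)
      rw [hj.2, add_zero] at h1
      have h2 : c i j ≠ 0 := by
        intro h0
        rw [h0] at h1
        exact (by decide : ¬ Odd (0 : ℤ)) h1
      have h3 : (1 : ℤ) ≤ c i j ^ 2 := by
        have := sq_pos_of_ne_zero h2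
        omega
      have h4 : (1 : ℚ) ≤ (c i j : ℚ) ^ 2 := by exact_mod_cast h3
      exact le_mul_of_one_le_left (by have := hqpos j; positivity) h4
    · have := hqpos j
      positivity
  have hKw : ∑ j ∈ K, (w j : ℚ) ≤ r i - 1 := by
    have h1 : ∑ j ∈ K, (w j : ℤ) ≤ r i - 1 := by
      refine le_trans ?_ (hcol i)
      refine (Finset.sum_le_sum fun j hj => ?_).trans
        (Finset.sum_le_sum_of_subset_of_nonneg (Finset.filter_subset _ _) fun j _ _ => by positivity)
      simp only [hK, Finset.mem_filter] at hj
      have h3 : (1 : ℤ) ≤ c j i ^ 2 := by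
        have := sq_pos_of_ne_zero hj.2
        omega
      exact le_mul_of_one_le_right (by positivity) h3
    exact_mod_cast h1
  have hmul : ∀ j, 2 * (r i : ℚ) ≤ w j * r j := fun j => by
    have : 2 * r i ≤ w j * r j := Nat.mul_le_mul (hw j) (hi j)
    exact_mod_cast this
  have hqc : ∀ j, (q j : ℚ) = w j * r j + 1 := fun j => by rw [hq]; push_cast; ring
  have hpos : (0 : ℚ) < 2 * r i + 1 := by linarith
  have hterm : ∀ j ∈ K, (w j : ℚ) / q j ≤ w j / (2 * r i + 1) := fun j _ => by
    have h1 := hmul j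
    have h2 := hqc j
    gcongr
    linarith
  have hKle : ∑ j ∈ K, (w j : ℚ) / q j ≤ (r i - 1) / (2 * r i + 1) := by
    refine (Finset.sum_le_sum hterm).trans ?_
    rw [← Finset.sum_div]
    gcongr
  have hone : (1 : ℚ) ≤ (w i + r i) / q i + ∑ j ∈ K, (w j : ℚ) / q j := by
    rw [add_div]
    linarith
  have hsum : ((r i : ℚ) + 2) / (2 * r i + 1) + (r i - 1) / (2 * r i + 1) = 1 := by
    field_simp
    ring
  have hw2 : w i = 2 := by
    by_contra hne
    have h3 : 3 ≤ w i := by have := hw i; omega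
    have h3' : (3 : ℚ) ≤ w i := by exact_mod_cast h3
    have : ((w i : ℚ) + r i) / q i < (r i + 2) / (2 * r i + 1) := by
      rw [div_lt_div_iff₀ (hqpos i) hpos, hqc]
      nlinarith [mul_pos (show (0 : ℚ) < w i - 2 by linarith) (show (0 : ℚ) < r i ^ 2 - 1 by nlinarith)]
    linarith
  have hqi : (q i : ℚ) = 2 * r i + 1 := by rw [hqc, hw2]; push_cast; ring
  rcases K.eq_empty_or_nonempty with hKe | hKn
  · rw [hKe, Finset.sum_empty, hqi, hw2, add_zero, le_div_iff₀ hpos] at hone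
    push_cast at hone
    linarith
  · have hlt : ∑ j ∈ K, (w j : ℚ) / q j < ∑ j ∈ K, (w j : ℚ) / (2 * r i + 1) := by
      refine Finset.sum_lt_sum_of_nonempty hKn fun j hj => ?_
      have hji : j ≠ i := by
        simp only [hK, Finset.mem_filter, Finset.mem_erase] at hj
        exact hj.1.1
      have h1 : 2 * (r i : ℚ) + 1 ≤ q j := by rw [hqc]; linarith [hmul j]
      have h2 : (q j : ℚ) ≠ 2 * r i + 1 := by
        rw [← hqi]
        exact fun e => hji (hinj (by exact_mod_cast e))
      have h3 : 2 * (r i : ℚ) + 1 < q j := lt_of_le_of_ne h1 (Ne.symm h2)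
      have h4 := hwpos j
      exact div_lt_div_of_pos_left (by linarith) hpos h3
    rw [← Finset.sum_div] at hlt
    have h5 : (∑ j ∈ K, (w j : ℚ)) / (2 * r i + 1) ≤ (r i - 1) / (2 * r i + 1) := by gcongr
    rw [hw2, hqi] at hone
    push_cast at hone
    rw [add_comm (2 : ℚ)] at hone
    linarith

lemma exists_eq_single_sub_single {X : Type*} [Fintype X] [DecidableEq X] {f d : X → ℤ}
    (hd : ∀ x, 0 < d x) (h0 : ∑ x, d x * f x = 0) (h2 : ∑ x, f x * f x = 2) :
    ∃ x y, x ≠ y ∧ f = Pi.single x 1 - Pi.single y 1 := by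
  have hne : ∃ z, f z ≠ 0 := by
    by_contra! hcon
    simp [hcon] at h2
  have hpos : ∃ x, 0 < f x := by
    by_contra! hcon
    obtain ⟨z, hz⟩ := hne
    have h1 : d z * f z < 0 := mul_neg_of_pos_of_neg (hd z) (lt_of_le_of_ne (hcon z) hz)
    have h3 : ∑ x, d x * f x < ∑ x : X, (0 : ℤ) := Finset.sum_lt_sum
      (fun x _ => mul_nonpos_of_nonneg_of_nonpos (hd x).le (hcon x)) ⟨z, Finset.mem_univ z, h1⟩
    simp only [Finset.sum_const_zero] at h3
    omega
  have hneg : ∃ x, f x < 0 := by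
    by_contra! hcon
    obtain ⟨z, hz⟩ := hne
    have h1 : 0 < d z * f z := mul_pos (hd z) (lt_of_le_of_ne (hcon z) (Ne.symm hz))
    have h3 : ∑ x : X, (0 : ℤ) < ∑ x, d x * f x := Finset.sum_lt_sum
      (fun x _ => mul_nonneg (hd x).le (hcon x)) ⟨z, Finset.mem_univ z, h1⟩
    simp only [Finset.sum_const_zero] at h3
    omega
  obtain ⟨x, hx⟩ := hpos
  obtain ⟨y, hy⟩ := hneg
  have hxy : x ≠ y := by rintro rfl; omega
  refine ⟨x, y, hxy, ?_⟩
  have hyx : y ∈ Finset.univ.erase x := by simp [hxy.symm]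
  rw [← Finset.add_sum_erase _ (fun x => f x * f x) (Finset.mem_univ x),
    ← Finset.add_sum_erase _ (fun x => f x * f x) hyx] at h2
  have hrest : 0 ≤ ∑ z ∈ (Finset.univ.erase x).erase y, f z * f z :=
    Finset.sum_nonneg fun z _ => mul_self_nonneg _
  have hfx : f x = 1 := by nlinarith
  have hfy : f y = -1 := by nlinarith
  have hr0 : ∑ z ∈ (Finset.univ.erase x).erase y, f z * f z = 0 := by
    simp only [hfx, hfy] at h2
    omega
  rw [Finset.sum_eq_zero_iff_of_nonneg fun z _ => mul_self_nonneg _] at hr0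
  ext z
  by_cases hzx : z = x
  · subst hzx
    simp [hfx, hxy]
  by_cases hzy : z = y
  · subst hzy
    simp [hfy, hxy.symm]
  · have := hr0 z (by simp [hzx, hzy])
    simp [hzx, hzy, mul_self_eq_zero.1 this]

lemma coherence {Λ X : Type*} [Fintype X] [DecidableEq X] {v : Λ → X → ℤ} {d : X → ℤ}
    (hd : ∀ x, 0 < d x) (hdeg : ∀ a b, ∑ x, d x * (v a x - v b x) = 0)
    (h2 : ∀ a b, v a ≠ v b → ∑ x, (v a x - v b x) * (v a x - v b x) = 2)
    (h1 : ∀ a b c, v a ≠ v b → v a ≠ v c → v b ≠ v c →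
      ∑ x, (v a x - v b x) * (v a x - v c x) = 1) (hne : ∃ a b, v a ≠ v b) :
    ∃ (b : X → ℤ) (ε : ℤ) (e : Λ → X), ε * ε = 1 ∧ ∀ a, v a = b + Pi.single (e a) ε := by
  obtain ⟨a₀, a₁, h01⟩ := hne
  have key : ∀ a, v a₀ ≠ v a → ∃ x y, x ≠ y ∧ ∀ z, v a₀ z - v a z = (Pi.single x 1 : X → ℤ) z - (Pi.single y 1 : X → ℤ) z := by
    intro a ha
    obtain ⟨x, y, hxy, h⟩ := exists_eq_single_sub_single hd (hdeg a₀ a) (h2 _ _ ha)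
    exact ⟨x, y, hxy, fun z => congrFun h z⟩
  obtain ⟨x, y, hxy, hv⟩ := key a₁ h01
  have inner : ∀ x y s t : X, ∑ z, ((Pi.single x 1 : X → ℤ) z - (Pi.single y 1 : X → ℤ) z) *
      ((Pi.single s 1 : X → ℤ) z - (Pi.single t 1 : X → ℤ) z) =
      (if x = s then 1 else 0) - (if x = t then 1 else 0) - (if y = s then 1 else 0) +
      (if y = t then 1 else 0) := by
    intro x y s t
    simp only [Pi.single_apply, sub_mul, mul_sub, ite_mul, one_mul, zero_mul, Finset.sum_sub_distrib,
      Finset.sum_ite_eq', Finset.mem_univ, if_true]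
    ring
  have step : ∀ a b, v a₀ ≠ v a → v a₀ ≠ v b → v a ≠ v b → ∀ x y s t : X, x ≠ y → s ≠ t →
      (∀ z, v a₀ z - v a z = (Pi.single x 1 : X → ℤ) z - (Pi.single y 1 : X → ℤ) z) →
      (∀ z, v a₀ z - v b z = (Pi.single s 1 : X → ℤ) z - (Pi.single t 1 : X → ℤ) z) →
      (x = s ∧ y ≠ t) ∨ (x ≠ s ∧ y = t) := by
    intro a b ha hb hab x y s t hxy hst hx hs
    have h3 := h1 a₀ a b ha hb hab
    simp_rw [hx, hs] at h3
    rw [inner] at h3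
    by_cases hxs : x = s <;> by_cases hyt : y = t
    · exfalso
      apply hab
      ext z
      have e1 := hx z
      have e2 := hs z
      rw [hxs, hyt] at e1
      omega
    · exact Or.inl ⟨hxs, hyt⟩
    · exact Or.inr ⟨hxs, hyt⟩
    · rw [if_neg hxs, if_neg hyt] at h3
      split_ifs at h3 <;> omega
  by_cases hcase : ∀ a, v a₀ ≠ v a → ∃ y', x ≠ y' ∧ ∀ z,
      v a₀ z - v a z = (Pi.single x 1 : X → ℤ) z - (Pi.single y' 1 : X → ℤ) z
  · have h4 : ∀ a, ∃ u, ∀ z, v a z = v a₀ z - (Pi.single x 1 : X → ℤ) z + (Pi.single u 1 : X → ℤ) z := by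
      intro a
      by_cases ha : v a₀ = v a
      · exact ⟨x, fun z => by rw [ha]; ring⟩
      · obtain ⟨y', -, h⟩ := hcase a ha
        exact ⟨y', fun z => by linarith [h z]⟩
    choose e he using h4
    exact ⟨v a₀ - Pi.single x 1, 1, e, by norm_num, fun a => funext fun z => by simp [he a z]⟩
  · push Not at hcase
    obtain ⟨a₂, h02, hno⟩ := hcase
    obtain ⟨s, t, hst, hv2⟩ := key a₂ h02
    have hsx : s ≠ x := by
      rintro rfl
      obtain ⟨z, hz⟩ := hno t hst
      exact hz (hv2 z)
    have h12 : v a₁ ≠ v a₂ := by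
      intro h
      obtain ⟨z, hz⟩ := hno y hxy
      rw [← h] at hz
      exact hz (hv z)
    have hty : y = t := by
      rcases step a₁ a₂ h01 h02 h12 x y s t hxy hst hv hv2 with h | h
      · exact absurd h.1.symm hsx
      · exact h.2
    subst hty
    have h4 : ∀ a, ∃ u, ∀ z, v a z = v a₀ z + (Pi.single y 1 : X → ℤ) z - (Pi.single u 1 : X → ℤ) z := by
      intro a
      by_cases ha : v a₀ = v a
      · exact ⟨y, fun z => by rw [ha]; ring⟩
      · obtain ⟨x', y', hxy', h⟩ := key a ha
        have hy' : y = y' := by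
          by_cases ha1 : v a₁ = v a
          · have e1 := hv y
            have e2 := h y
            rw [ha1, e2] at e1
            by_contra hne
            simp [Pi.single_apply, hxy.symm, hne] at e1
            split_ifs at e1
          · by_cases ha2 : v a₂ = v a
            · have e1 := hv2 y
              have e2 := h y
              rw [ha2] at e1
              rw [e2] at e1
              by_contra hne
              simp [Pi.single_apply, hst.symm, hne] at e1
              split_ifs at e1
            · rcases step a₁ a h01 ha ha1 x y x' y' hxy hxy' hv h with h5 | h5
              · rcases step a₂ a h02 ha ha2 s y x' y' hst hxy' hv2 h with h6 | h6
                · exact absurd (h6.1.trans h5.1.symm) hsx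
                · exact h6.2
              · exact h5.2
        subst hy'
        exact ⟨x', fun z => by linarith [h z]⟩
    choose e he using h4
    refine ⟨v a₀ + Pi.single y 1, -1, e, by norm_num, fun a => funext fun z => ?_⟩
    rw [he a z]
    simp [Pi.single_apply]
    split_ifs <;> ring

/-- The multiplicities of the linear characters of the subgroups of a `SylowSystem` in the
irreducible characters of a group of odd order, together with the relations between them: `m i`
is the multiplicity of the trivial character, `v i a` that of the nontrivial character `a`, and
`d` is the degree. -/
structure CharacterData {ι X : Type*} [Fintype ι] [Fintype X] {Λ : ι → Type*} [∀ i, Fintype (Λ i)]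
    (m : ι → X → ℤ) (v : ∀ i, Λ i → X → ℤ) (d : X → ℤ) (x₀ : X) (q r w n : ι → ℕ) (g : ℕ) :
    Prop where
  q_eq : ∀ i, q i = w i * r i + 1
  w_even : ∀ i, Even (w i)
  w_pos : ∀ i, 0 < w i
  r_two : ∀ i, 2 ≤ r i
  g_odd : Odd g
  g_eq : ∀ i, g = q i * r i * n i
  q_inj : Function.Injective q
  class_eq : ∑ i, (w i : ℚ) / q i = 1 - 1 / g
  card_eq : ∀ i, Fintype.card (Λ i) = w i * r i
  fiber : ∀ i a, Nat.card {b // v i b = v i a} = r i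
  d_pos : ∀ x, 0 < d x
  degree : ∀ i a b, ∑ x, d x * (v i a x - v i b x) = 0
  two : ∀ i a b, v i a ≠ v i b → ∑ x, (v i a x - v i b x) * (v i a x - v i b x) = 2
  one : ∀ i a b c, v i a ≠ v i b → v i a ≠ v i c → v i b ≠ v i c →
    ∑ x, (v i a x - v i b x) * (v i a x - v i c x) = 1
  trivial_self : ∀ i a, ∑ x, (m i x - v i a x) * (m i x - v i a x) = r i + 1
  diff_diff : ∀ i j, i ≠ j → ∀ a b a' b', ∑ x, (v i a x - v i b x) * (v j a' x - v j b' x) = 0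
  trivial_diff : ∀ i j, i ≠ j → ∀ a a' b', ∑ x, (m i x - v i a x) * (v j a' x - v j b' x) = 0
  trivial_trivial : ∀ i j, i ≠ j → ∀ a a', ∑ x, (m i x - v i a x) * (m j x - v j a' x) = 0
  d_eq : ∀ i x, d x = m i x + ∑ a, v i a x
  m_base : ∀ i, m i x₀ = 1
  v_base : ∀ i a, v i a x₀ = 0
  sum_eq : ∀ x, x ≠ x₀ → d x + ∑ i, n i * (q i * m i x - d x) = 0
  norm_eq : ∀ x, d x ^ 2 + ∑ i, n i * (q i * (m i x ^ 2 + ∑ a, v i a x ^ 2) - d x ^ 2) = g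

namespace CharacterData

variable {ι X : Type*} [Fintype ι] [Fintype X] {Λ : ι → Type*} [∀ i, Fintype (Λ i)]
  {m : ι → X → ℤ} {v : ∀ i, Λ i → X → ℤ} {d : X → ℤ} {x₀ : X} {q r w n : ι → ℕ} {g : ℕ}

lemma two_le_w (h : CharacterData m v d x₀ q r w n g) (i : ι) : 2 ≤ w i := by
  have h1 := h.w_pos i
  obtain ⟨k, hk⟩ := h.w_even i
  omega

lemma nonempty (h : CharacterData m v d x₀ q r w n g) (i : ι) : Nonempty (Λ i) := by
  rw [← Fintype.card_pos_iff, h.card_eq]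
  exact Nat.mul_pos (h.w_pos i) (by have := h.r_two i; omega)

lemma exists_ne (h : CharacterData m v d x₀ q r w n g) (i : ι) (a : Λ i) :
    ∃ b, v i b ≠ v i a := by
  by_contra! hcon
  have h1 := h.fiber i a
  rw [Nat.card_congr (Equiv.subtypeUnivEquiv hcon), Nat.card_eq_fintype_card, h.card_eq] at h1
  have h2 := h.two_le_w i
  have h3 := h.r_two i
  nlinarith

lemma exists_coherent [DecidableEq X] (h : CharacterData m v d x₀ q r w n g) (i : ι) :
    ∃ (b : X → ℤ) (ε : ℤ) (e : Λ i → X), ε * ε = 1 ∧ ∀ a, v i a = b + Pi.single (e a) ε := by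
  obtain ⟨a⟩ := h.nonempty i
  obtain ⟨b, hb⟩ := h.exists_ne i a
  exact coherence h.d_pos (h.degree i) (h.two i) (h.one i) ⟨b, a, hb⟩

theorem false [Nonempty ι] (h : CharacterData m v d x₀ q r w n g) : False := by
  classical
  choose b ε e hε hv using h.exists_coherent
  have hε0 : ∀ i, ε i ≠ 0 := fun i h0 => by simpa [h0] using hε i
  have hvx : ∀ i a x, v i a x = b i x + if e i a = x then ε i else 0 := fun i a x => by
    rw [hv, Pi.add_apply, Pi.single_apply]
    simp only [eq_comm]
  have hve : ∀ i a a', v i a = v i a' ↔ e i a = e i a' := by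
    intro i a a'
    refine ⟨fun hh => ?_, fun hh => by rw [hv, hv, hh]⟩
    by_contra hne
    have h1 := congrFun hh (e i a)
    rw [hvx, hvx, if_pos rfl, if_neg (Ne.symm hne)] at h1
    exact hε0 i (by omega)
  have hex : ∀ i a, ∃ a', e i a' ≠ e i a := fun i a => by
    obtain ⟨a', ha'⟩ := h.exists_ne i a
    exact ⟨a', fun hh => ha' ((hve i a' a).2 hh)⟩
  have hfib : ∀ i a, (Finset.univ.filter fun a' => e i a' = e i a).card = r i := by
    intro i a
    rw [← h.fiber i a, Nat.card_eq_fintype_card, Fintype.card_subtype]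
    simp only [hve]
  set E : ι → Finset X := fun i => Finset.univ.image (e i) with hE
  have hEcard : ∀ i, (E i).card = w i := by
    intro i
    have h1 := Finset.card_eq_sum_card_image (e i) Finset.univ
    rw [Finset.sum_congr rfl (g := fun _ => r i), Finset.sum_const, Finset.card_univ, h.card_eq,
      smul_eq_mul] at h1
    · exact (Nat.eq_of_mul_eq_mul_right (by have := h.r_two i; omega) h1).symm
    · intro x hx
      obtain ⟨a, -, rfl⟩ := Finset.mem_image.1 hx
      exact hfib i a
  -- inner products with a difference
  have hinner : ∀ (f : X → ℤ) i a a', ∑ x, f x * (v i a x - v i a' x) =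
      ε i * (f (e i a) - f (e i a')) := by
    intro f i a a'
    simp only [hvx, add_sub_add_left_eq_sub, mul_sub, mul_ite, mul_zero, Finset.sum_sub_distrib,
      Finset.sum_ite_eq, Finset.mem_univ, if_true]
    ring
  have hdisj : ∀ i j, i ≠ j → ∀ a a', e i a ≠ e j a' := by
    intro i j hij a a' hh
    obtain ⟨b1, hb1⟩ := hex i a
    obtain ⟨b2, hb2⟩ := hex j a'
    have h1 := h.diff_diff i j hij a b1 a' b2
    rw [hinner, mul_eq_zero, or_iff_right (hε0 j)] at h1
    simp only [hvx, add_sub_add_left_eq_sub, ← hh] at h1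
    rw [← hh] at hb2
    simp only [if_true, if_neg hb1, if_neg (Ne.symm hb2), zero_sub, sub_zero] at h1
    have := hε0 i
    have := hε i
    split_ifs at h1 <;> omega
  have hbase : ∀ i a, e i a ≠ x₀ := by
    intro i a hh
    obtain ⟨a', ha'⟩ := hex i a
    have h1 := h.v_base i a
    have h2 := h.v_base i a'
    rw [hvx, if_pos hh] at h1
    rw [hvx, if_neg (hh ▸ ha')] at h2
    exact hε0 i (by omega)
  set c : ι → X → ℤ := fun i x => m i x - b i x with hc
  have hc0 : ∀ i, c i x₀ = 1 := by
    intro i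
    obtain ⟨a⟩ := h.nonempty i
    have h1 := h.v_base i a
    rw [hvx, if_neg (hbase i a)] at h1
    simp only [hc, h.m_base]
    omega
  have hu : ∀ i a x, m i x - v i a x = c i x - if e i a = x then ε i else 0 := by
    intro i a x
    rw [hvx, hc]
    ring
  have hsq : ∀ i a, ∑ x, c i x ^ 2 = r i + 2 * ε i * c i (e i a) := by
    intro i a
    have h1 := h.trivial_self i a
    have h2 : ∀ x, (m i x - v i a x) * (m i x - v i a x) =
        c i x ^ 2 + if e i a = x then (1 - 2 * ε i * c i x) else 0 := by
      intro x
      rw [hu]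
      split_ifs with hx
      · linear_combination hε i
      · ring
    simp only [h2, Finset.sum_add_distrib, Finset.sum_ite_eq, Finset.mem_univ, if_true] at h1
    linarith
  have hconst : ∀ i j a a', c i (e j a) = c i (e j a') := by
    intro i j a a'
    by_cases hij : i = j
    · subst hij
      have h1 := hsq i a
      rw [hsq i a'] at h1
      have h2 : ε i * (c i (e i a) - c i (e i a')) = 0 := by linarith
      rcases mul_eq_zero.1 h2 with h3 | h3
      · exact absurd h3 (hε0 i)
      · linarith
    · obtain ⟨a0⟩ := h.nonempty i
      have h1 := h.trivial_diff i j hij a0 a a'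
      rw [hinner, mul_eq_zero, or_iff_right (hε0 j)] at h1
      rw [hu, hu, if_neg (hdisj i j hij _ _), if_neg (hdisj i j hij _ _)] at h1
      linarith
  have hdout : ∀ i x, (∀ a, e i a ≠ x) → d x = q i * b i x + c i x ∧
      (q i : ℤ) * (m i x ^ 2 + ∑ a, v i a x ^ 2) - d x ^ 2 = (w i * r i) * c i x ^ 2 := by
    intro i x hx
    have h1 : ∀ a, v i a x = b i x := fun a => by rw [hvx, if_neg (hx a), add_zero]
    have h2 : m i x = b i x + c i x := by rw [hc]; ring
    have h3 := h.d_eq i x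
    simp only [h1, Finset.sum_const, Finset.card_univ, h.card_eq, nsmul_eq_mul] at h3 ⊢
    have hqz : (q i : ℤ) = w i * r i + 1 := by rw [h.q_eq]; push_cast; ring
    push_cast at h3 ⊢
    rw [h2] at h3 ⊢
    rw [h3, hqz]
    constructor <;> ring
  have hdin : ∀ i a, d (e i a) = q i * b i (e i a) + c i (e i a) + r i * ε i ∧
      (q i : ℤ) * (m i (e i a) ^ 2 + ∑ a', v i a' (e i a) ^ 2) - d (e i a) ^ 2 =
        (w i * r i) * c i (e i a) ^ 2 - 2 * c i (e i a) * r i * ε i + r i * (q i - r i) := by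
    intro i a
    set x := e i a with hx
    have h2 : m i x = b i x + c i x := by rw [hc]; ring
    have h3 := h.d_eq i x
    have hqz : (q i : ℤ) = w i * r i + 1 := by rw [h.q_eq]; push_cast; ring
    have s1 : ∑ a', v i a' x = w i * r i * b i x + r i * ε i := by
      simp only [hvx, Finset.sum_add_distrib, Finset.sum_const, Finset.card_univ, h.card_eq,
        nsmul_eq_mul, ← Finset.sum_filter, hx, hfib]
      push_cast
      ring
    have s2 : ∑ a', v i a' x ^ 2 = w i * r i * b i x ^ 2 + r i * (2 * b i x * ε i + 1) := by
      have : ∀ a', v i a' x ^ 2 = b i x ^ 2 + if e i a' = x then (2 * b i x * ε i + 1) else 0 := by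
        intro a'
        rw [hvx]
        split_ifs
        · linear_combination hε i
        · ring
      rw [Finset.sum_congr rfl fun a' _ => this a']
      simp only [Finset.sum_add_distrib, Finset.sum_const, Finset.card_univ, h.card_eq,
        nsmul_eq_mul, ← Finset.sum_filter, hx, hfib]
      push_cast
      ring
    have h4 : d x = q i * b i x + c i x + r i * ε i := by rw [h3, s1, h2, hqz]; ring
    refine ⟨h4, ?_⟩
    rw [s2, h4, h2, hqz]
    linear_combination (-(r i : ℤ) ^ 2) * hε i
  have heven : ∀ i, ∃ k : ℤ, (w i : ℤ) = 2 * k := fun i => by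
    obtain ⟨k, hk⟩ := h.w_even i
    exact ⟨k, by rw [hk]; push_cast; ring⟩
  have hcov : ∀ x, x = x₀ ∨ ∃ i a, e i a = x := by
    intro x
    by_contra! hcon
    obtain ⟨hx0, hx⟩ := hcon
    have h1 := h.sum_eq x hx0
    have h2 := h.norm_eq x
    have e1 : Even (d x) := by
      have : Even (∑ i, (n i : ℤ) * (q i * m i x - d x)) := by
        refine Finset.even_sum _ fun i _ => ?_
        obtain ⟨k, hk⟩ := heven i
        have hqz : (q i : ℤ) = w i * r i + 1 := by rw [h.q_eq]; push_cast; ring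
        have h2 : m i x = b i x + c i x := by rw [hc]; ring
        rw [(hdout i x (hx i)).1, h2, hqz, hk]
        exact ⟨n i * (k * r i * c i x), by ring⟩
      have h3 : d x = - ∑ i, (n i : ℤ) * (q i * m i x - d x) := by linarith
      rw [h3]
      exact this.neg
    have e2 : Even (∑ i, (n i : ℤ) * (q i * (m i x ^ 2 + ∑ a, v i a x ^ 2) - d x ^ 2)) := by
      refine Finset.even_sum _ fun i _ => ?_
      obtain ⟨k, hk⟩ := heven i
      rw [(hdout i x (hx i)).2, hk]
      exact ⟨n i * (k * r i * c i x ^ 2), by ring⟩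
    have e3 : Even (g : ℤ) := by
      rw [← h2]
      exact (e1.pow_of_ne_zero (by norm_num)).add e2
    have e4 : Odd (g : ℤ) := by exact_mod_cast h.g_odd
    exact (Int.not_even_iff_odd.2 e4) e3
  have hsum : ∀ F : X → ℤ, ∑ x, F x = F x₀ + ∑ i, ∑ x ∈ E i, F x := by
    intro F
    rw [← Finset.sum_biUnion, ← Finset.sum_insert]
    · refine Finset.sum_congr ?_ fun _ _ => rfl
      ext x
      simp only [Finset.mem_univ, Finset.mem_insert, Finset.mem_biUnion, hE, Finset.mem_image,
        true_and, true_iff]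
      exact hcov x
    · simp only [Finset.mem_biUnion, hE, Finset.mem_image, Finset.mem_univ, true_and, not_exists]
      exact hbase
    · intro i _ j _ hij
      rw [Function.onFun, Finset.disjoint_left]
      simp only [hE, Finset.mem_image, Finset.mem_univ, true_and]
      rintro _ ⟨a, rfl⟩ ⟨a', ha'⟩
      exact hdisj i j hij a a' ha'.symm
  have ha0 : ∀ i, ∃ _ : Λ i, True := fun i => (h.nonempty i).elim fun a => ⟨a, trivial⟩
  choose a0 _ using ha0
  have hEsum : ∀ i (F : X → ℤ) (k : ℤ), (∀ a, F (e i a) = k) → ∑ x ∈ E i, F x = w i * k := by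
    intro i F k hF
    rw [Finset.sum_congr rfl (g := fun _ => k), Finset.sum_const, hEcard, nsmul_eq_mul]
    intro x hx
    obtain ⟨a, -, rfl⟩ := Finset.mem_image.1 hx
    exact hF a
  set C : ι → ι → ℤ := fun i j => c j (e i (a0 i)) with hC
  have hself : ∀ i, 2 * ε i * C i i - w i * C i i ^ 2 ≤ 0 := by
    intro i
    have h1 := h.two_le_w i
    have h2 : (2 : ℤ) ≤ w i := by exact_mod_cast h1
    rcases eq_or_ne (C i i) 0 with h0 | h0
    · simp [h0]
    · have h3 := sq_pos_of_ne_zero h0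
      have h4 : ε i * C i i ≤ C i i ^ 2 := by
        rcases Int.isUnit_iff.1 (IsUnit.of_mul_eq_one _ (hε i)) with h5 | h5 <;> rw [h5] <;>
          rcases lt_or_gt_of_ne h0 with h6 | h6 <;> nlinarith
      nlinarith [mul_nonneg (sub_nonneg.2 h2) h3.le]
  have hgpos : (0 : ℚ) < g := by
    have := h.g_odd.pos
    exact_mod_cast this
  refine odd_arith (w := w) (q := q) (r := r) (c := C) (g := g) h.q_eq h.two_le_w h.r_two h.q_inj
    h.class_eq ?_ ?_ ?_
  · intro i j hij
    have h1 := h.trivial_trivial i j hij (a0 i) (a0 j)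
    have h2 : ∀ x, (m i x - v i (a0 i) x) * (m j x - v j (a0 j) x) =
        c i x * c j x - (if e i (a0 i) = x then ε i * c j x else 0) -
          (if e j (a0 j) = x then ε j * c i x else 0) := by
      intro x
      rw [hu, hu]
      split_ifs with h3 h4
      · exact absurd (h3.trans h4.symm) (hdisj i j hij _ _)
      all_goals ring
    simp only [h2, Finset.sum_sub_distrib, Finset.sum_ite_eq, Finset.mem_univ, if_true] at h1
    rw [hsum, hc0, hc0] at h1
    have h3 : Even (∑ l, ∑ x ∈ E l, c i x * c j x) := by
      refine Finset.even_sum _ fun l _ => ?_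
      rw [hEsum l _ (c i (e l (a0 l)) * c j (e l (a0 l))) fun a => by
        rw [hconst i l a (a0 l), hconst j l a (a0 l)]]
      obtain ⟨k, hk⟩ := heven l
      rw [hk]
      exact ⟨k * (c i (e l (a0 l)) * c j (e l (a0 l))), by ring⟩
    obtain ⟨k, hk⟩ := h3
    rw [hk] at h1
    simp only [hC]
    rcases Int.isUnit_iff.1 (IsUnit.of_mul_eq_one _ (hε i)) with h5 | h5 <;>
      rcases Int.isUnit_iff.1 (IsUnit.of_mul_eq_one _ (hε j)) with h6 | h6 <;>
      rw [h5, h6] at h1 <;> rw [Int.odd_iff] <;> omega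
  · intro i
    have h1 := h.norm_eq (e i (a0 i))
    rw [← Finset.add_sum_erase _ _ (Finset.mem_univ i), (hdin i (a0 i)).2,
      Finset.sum_congr rfl fun j hj => by
        rw [(hdout j (e i (a0 i)) fun a => hdisj j i (Finset.ne_of_mem_erase hj) _ _).2]] at h1
    have hn : ∀ j, ((n j : ℚ) * (w j * r j)) = g * (w j / q j) := by
      intro j
      have h2 : (g : ℚ) = q j * r j * n j := by rw [h.g_eq j]; push_cast; ring
      have h3 : (q j : ℚ) ≠ 0 := by rw [h.q_eq]; positivity
      rw [h2]
      field_simp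
    have h2 : (d (e i (a0 i)) : ℚ) ^ 2 + ((n i : ℚ) * (w i * r i * (C i i : ℚ) ^ 2 -
        2 * C i i * r i * ε i + r i * (q i - r i)) +
        ∑ j ∈ Finset.univ.erase i, (n j : ℚ) * (w j * r j * (C i j : ℚ) ^ 2)) = g := by
      exact_mod_cast h1
    have h3 : ∑ j ∈ Finset.univ.erase i, (n j : ℚ) * (w j * r j * (C i j : ℚ) ^ 2) =
        g * ∑ j ∈ Finset.univ.erase i, (C i j : ℚ) ^ 2 * (w j / q j) := by
      rw [Finset.mul_sum]
      refine Finset.sum_congr rfl fun j _ => ?_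
      linear_combination (C i j : ℚ) ^ 2 * hn j
    rw [h3] at h2
    have h4 : (1 : ℚ) ≤ (d (e i (a0 i)) : ℚ) ^ 2 := by
      have h5 := h.d_pos (e i (a0 i))
      have h6 : (1 : ℤ) ≤ d (e i (a0 i)) ^ 2 := by nlinarith
      exact_mod_cast h6
    have hqp : (0 : ℚ) < q i := by rw [h.q_eq]; positivity
    have hgi : (n i : ℚ) * r i = g / q i := by
      have h2 : (g : ℚ) = q i * r i * n i := by rw [h.g_eq i]; push_cast; ring
      rw [h2]
      field_simp
    have h7 : (2 * ε i * C i i - w i * C i i ^ 2 : ℚ) ≤ 0 := by exact_mod_cast hself i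
    have h8 : (n i : ℚ) * (w i * r i * (C i i : ℚ) ^ 2 - 2 * C i i * r i * ε i + r i * (q i - r i)) =
        g / q i * (-(2 * ε i * C i i - w i * C i i ^ 2) + q i - r i) := by
      rw [← hgi]
      ring
    rw [h8] at h2
    set S' := ∑ j ∈ Finset.univ.erase i, (C i j : ℚ) ^ 2 * (w j / q j)
    have h9 : (g : ℚ) / q i * (q i - r i) ≤
        g / q i * (-(2 * ε i * C i i - w i * C i i ^ 2) + q i - r i) := by
      gcongr
      linarith
    have h10 : (g : ℚ) / q i * (q i - r i) = g - g * (r i / q i) := by field_simp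
    have h11 : (g : ℚ) * (S' + 1 / g) ≤ g * (r i / q i) := by
      rw [mul_add, mul_one_div_cancel hgpos.ne']
      linarith
    exact le_of_mul_le_mul_left h11 hgpos
  · intro i
    have h1 := hsq i (a0 i)
    rw [hsum, hc0, ← Finset.add_sum_erase _ _ (Finset.mem_univ i),
      hEsum i _ (C i i ^ 2) fun a => by rw [hconst i i a (a0 i)],
      Finset.sum_congr rfl fun k _ => hEsum k _ (C k i ^ 2) fun a => by rw [hconst i k a (a0 k)]]
      at h1
    have h2 := hself i
    simp only [hC] at h1 h2 ⊢
    linarith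

end CharacterData

section characters

variable {G : Type u} [Group G]

/-- A function on `G` is an irreducible character if it is the character of an irreducible complex
representation of `G`. -/
def IsIrrChar (χ : G → ℂ) : Prop :=
  ∃ (V : Type u) (_ : AddCommGroup V) (_ : Module ℂ V) (_ : FiniteDimensional ℂ V)
    (ρ : Representation ℂ G V), ρ.IsIrreducible ∧ ρ.character = χ

lemma IsIrrChar.conj {χ : G → ℂ} (h : IsIrrChar χ) (t x : G) : χ (t * x * t⁻¹) = χ x := by
  obtain ⟨V, _, _, _, ρ, -, rfl⟩ := h
  exact ρ.char_conj x t

lemma IsIrrChar.exists_degree {χ : G → ℂ} (h : IsIrrChar χ) : ∃ d : ℕ, 0 < d ∧ χ 1 = d := by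
  obtain ⟨V, _, _, _, ρ, hρ, rfl⟩ := h
  refine ⟨Module.finrank ℂ V, ?_, ρ.char_one⟩
  have h1 : IsSimpleModule ℂ[G] ρ.asModule := inferInstance
  have : Nontrivial V := IsSimpleModule.nontrivial ℂ[G] ρ.asModule
  exact Module.finrank_pos

lemma isIrrChar_one : IsIrrChar (fun _ : G => (1 : ℂ)) := by
  refine ⟨PUnit.{u+1} → ℂ, inferInstance, inferInstance, inferInstance,
    Representation.trivial ℂ G _, ?_, ?_⟩
  · rw [Representation.irreducible_iff_isSimpleModule_asModule,
      isSimpleModule_iff_toSpanSingleton_surjective]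
    refine ⟨inferInstanceAs (Nontrivial (PUnit.{u+1} → ℂ)), fun m hm x => ?_⟩
    have hm0 : (show PUnit.{u+1} → ℂ from m) PUnit.unit ≠ 0 := fun h => hm (funext fun _ => h)
    refine ⟨MonoidAlgebra.single 1 ((show PUnit.{u+1} → ℂ from x) PUnit.unit /
      (show PUnit.{u+1} → ℂ from m) PUnit.unit), ?_⟩
    rw [LinearMap.toSpanSingleton_apply, Representation.single_smul]
    refine funext fun _ => ?_
    exact div_mul_cancel₀ _ hm0
  · ext g
    simp [Representation.character, Representation.trivial]

variable [Fintype G]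

/-- The bilinear form on functions on `G` for which irreducible characters are orthonormal. -/
noncomputable def charForm (f f' : G → ℂ) : ℂ := (Nat.card G : ℂ)⁻¹ * ∑ x, f x * f' x⁻¹

lemma charForm_comm (f f' : G → ℂ) : charForm f f' = charForm f' f := by
  rw [charForm, charForm, ← Equiv.sum_comp (Equiv.inv G)]
  simp [mul_comm]

open Classical in
lemma charForm_irr {χ χ' : G → ℂ} (h : IsIrrChar χ) (h' : IsIrrChar χ') :
    charForm χ χ' = if χ = χ' then 1 else 0 := by
  have : Invertible (Nat.card G : ℂ) := invertibleOfNonzero (by simp)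
  obtain ⟨V, _, _, _, ρ, hρ, rfl⟩ := h
  obtain ⟨W, _, _, _, σ, hσ, rfl⟩ := h'
  have h1 := Representation.char_orthonormal ρ σ
  rw [charForm, h1]
  by_cases h2 : Nonempty (Representation.Equiv σ ρ)
  · rw [if_pos h2, if_pos]
    obtain ⟨φ⟩ := h2
    exact (Representation.char_iso φ).symm
  · rw [if_neg h2, if_neg]
    intro h3
    have h4 := Representation.char_orthonormal σ σ
    rw [if_pos ⟨Representation.Equiv.refl σ⟩] at h4
    rw [if_neg h2, h3, h4] at h1
    exact one_ne_zero h1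

lemma charForm_sum_left {X : Type*} (s : Finset X) (c : X → ℂ) (f : X → G → ℂ) (f' : G → ℂ) :
    charForm (fun x => ∑ i ∈ s, c i * f i x) f' = ∑ i ∈ s, c i * charForm (f i) f' := by
  simp only [charForm, Finset.sum_mul, Finset.mul_sum]
  rw [Finset.sum_comm]
  refine Finset.sum_congr rfl fun i _ => Finset.sum_congr rfl fun x _ => ?_
  ring

lemma finite_irrChar : Finite {χ : G → ℂ // IsIrrChar χ} := by
  classical
  have h : LinearIndependent ℂ (fun χ : {χ : G → ℂ // IsIrrChar χ} => χ.1) := by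
    rw [linearIndependent_iff']
    intro s c hc i hi
    have h1 := charForm_sum_left s c (fun χ => χ.1) i.1
    have h2 : (fun x => ∑ i ∈ s, c i * i.1 x) = 0 := by
      rw [← hc]
      ext x
      simp
    rw [h2] at h1
    simp only [charForm_irr (Subtype.prop _) (Subtype.prop _)] at h1
    simpa [charForm, hi, Subtype.val_inj] using h1.symm
  exact h.finite

lemma sum_single_smul_eq_zero {f : G → ℂ} (hf : ∀ t x, f (t * x * t⁻¹) = f x)
    (h : ∀ χ, IsIrrChar χ → charForm f χ = 0) (S : Type u) [AddCommGroup S] [Module ℂ[G] S]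
    [Module ℂ S] [IsScalarTower ℂ ℂ[G] S]
    [hS : IsSimpleModule ℂ[G] S] (s : S) :
    (∑ x, MonoidAlgebra.single x⁻¹ (f x) : ℂ[G]) • s = 0 := by
  set z : ℂ[G] := ∑ x, MonoidAlgebra.single x⁻¹ (f x) with hz
  let ρ : Representation ℂ G S := Representation.ofModule' S
  have hρz : ∀ (y : ℂ[G]) (s : S), ρ.asAlgebraHom y s = y • s := by
    intro y s
    have h1 : ρ.asAlgebraHom = Algebra.lsmul ℂ ℂ S := by
      rw [Representation.asAlgebraHom_def]
      exact (MonoidAlgebra.lift ℂ (Module.End ℂ S) G).apply_symm_apply _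
    rw [h1]
    rfl
  let e : ρ.asModule ≃ₗ[ℂ[G]] S :=
    { ρ.asModuleEquiv.toAddEquiv with
      map_smul' := fun r x => (ρ.asModuleEquiv_map_smul r x).trans (hρz r _) }
  have hρ : ρ.IsIrreducible := by
    rw [Representation.irreducible_iff_isSimpleModule_asModule]
    exact IsSimpleModule.congr e
  have : Module.Finite ℂ[G] S := inferInstance
  have hfd : FiniteDimensional ℂ S := Module.Finite.trans ℂ[G] _
  have h1 := h ρ.character ⟨_, _, _, hfd, ρ, hρ, rfl⟩
  have hT : ρ.asAlgebraHom z = ∑ x, f x • ρ x⁻¹ := by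
    simp [hz, map_sum]
  have h2 : LinearMap.trace ℂ _ (ρ.asAlgebraHom z) = 0 := by
    rw [hT, map_sum]
    rw [charForm, mul_eq_zero, or_iff_right (by simp)] at h1
    simpa [Representation.character] using h1
  have h3 : ∀ g v, ρ.asAlgebraHom z (ρ g v) = ρ g (ρ.asAlgebraHom z v) := by
    intro g v
    rw [hT, LinearMap.sum_apply, LinearMap.sum_apply, map_sum,
      ← Equiv.sum_comp (MulAut.conj g).toEquiv]
    refine Finset.sum_congr rfl fun x _ => ?_
    simp only [MulEquiv.toEquiv_eq_coe, EquivLike.coe_coe, MulAut.conj_apply, hf,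
      LinearMap.smul_apply, map_smul]
    congr 1
    rw [← Module.End.mul_apply, ← Module.End.mul_apply, ← map_mul, ← map_mul]
    congr 2
    group
  obtain ⟨c, hc⟩ := (Representation.IsIrreducible.algebraMap_intertwiningMap_bijective_of_isAlgClosed
    (ρ := ρ)).2
    (LinearMap.intertwiningMap_of_isIntertwiningMap _ _ _ h3)
  have h4 : ρ.asAlgebraHom z = c • (1 : Module.End ℂ S) := by
    ext v
    have := congrArg (fun F => F v) hc
    exact this.symm
  have : Nontrivial S := IsSimpleModule.nontrivial ℂ[G] S
  have h5 : c = 0 := by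
    rw [h4, map_smul, LinearMap.trace_one, smul_eq_mul, mul_eq_zero] at h2
    refine h2.resolve_right ?_
    simp [Module.finrank_pos.ne']
  rw [← hρz, h4, h5, zero_smul, LinearMap.zero_apply]

lemma eq_zero_of_charForm_eq_zero {f : G → ℂ} (hf : ∀ t x, f (t * x * t⁻¹) = f x)
    (h : ∀ χ, IsIrrChar χ → charForm f χ = 0) : f = 0 := by
  have : NeZero (Nat.card G : ℂ) := ⟨by simp⟩
  have hz : ∀ s : ℂ[G], (∑ x, MonoidAlgebra.single x⁻¹ (f x) : ℂ[G]) • s = 0 := by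
    intro s
    have hs : s ∈ ⨆ m : {m : Submodule ℂ[G] ℂ[G] // IsSimpleModule ℂ[G] m}, m.1 := by
      have := IsSemisimpleModule.sSup_simples_eq_top ℂ[G] ℂ[G]
      rw [sSup_eq_iSup'] at this
      erw [this]
      trivial
    refine Submodule.iSup_induction _ (motive := fun s => _ • s = 0) hs (fun m x hx => ?_) (smul_zero _) fun x y hx hy => ?_
    · have := m.2
      have h1 := sum_single_smul_eq_zero hf h m.1 ⟨x, hx⟩
      exact congrArg Subtype.val h1
    · rw [smul_add, hx, hy, add_zero]
  ext x
  have h8 : (∑ x, MonoidAlgebra.single x⁻¹ (f x) : ℂ[G]).coeff x⁻¹ = 0 := by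
    have := hz 1
    rw [smul_eq_mul, mul_one] at this
    rw [this]
    simp
  rw [Pi.zero_apply, ← h8]
  simp only [MonoidAlgebra.coeff_sum, MonoidAlgebra.coeff_single, Finsupp.finsetSum_apply]
  rw [Finset.sum_eq_single x (fun y _ hy => Finsupp.single_eq_of_ne fun h => hy (inv_injective h).symm)
    (by simp), Finsupp.single_eq_same]

end characters

section expansion

variable {G : Type u} [Group G] [Fintype G]

noncomputable instance : Fintype {χ : G → ℂ // IsIrrChar χ} :=
  have := finite_irrChar (G := G)
  Fintype.ofFinite _

lemma eq_sum_charForm {f : G → ℂ} (hf : ∀ t x, f (t * x * t⁻¹) = f x) :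
    f = fun x => ∑ χ : {χ : G → ℂ // IsIrrChar χ}, charForm f χ.1 * χ.1 x := by
  classical
  have h := eq_zero_of_charForm_eq_zero
    (f := fun x => f x - ∑ χ : {χ : G → ℂ // IsIrrChar χ}, charForm f χ.1 * χ.1 x)
    (fun t x => by simp only [hf, (Subtype.prop _ : IsIrrChar _).conj]) ?_
  · ext x
    exact sub_eq_zero.1 (congrFun h x)
  · intro ψ hψ
    have h1 := charForm_sum_left Finset.univ (fun χ : {χ : G → ℂ // IsIrrChar χ} => charForm f χ.1)
      (fun χ => χ.1) ψ
    have h2 : ∀ χ : {χ : G → ℂ // IsIrrChar χ}, charForm χ.1 ψ = if χ = ⟨ψ, hψ⟩ then 1 else 0 := by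
      intro χ
      rw [charForm_irr χ.2 hψ]
      simp only [Subtype.ext_iff]
    simp only [h2, mul_ite, mul_one, mul_zero, Finset.sum_ite_eq', Finset.mem_univ, if_true] at h1
    rw [← sub_eq_zero.2 h1.symm]
    simp only [charForm, sub_mul, Finset.sum_sub_distrib, mul_sub]

lemma charForm_eq_sum {f : G → ℂ} (hf : ∀ t x, f (t * x * t⁻¹) = f x) (f' : G → ℂ) :
    charForm f f' = ∑ χ : {χ : G → ℂ // IsIrrChar χ}, charForm f χ.1 * charForm f' χ.1 := by
  conv_lhs => rw [eq_sum_charForm hf]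
  rw [charForm_sum_left]
  simp only [charForm_comm f']

end expansion

section linear

variable {A : Type*} [Group A] [Fintype A]

lemma sum_mul_inv_linear [DecidableEq (A →* ℂˣ)] (φ ψ : A →* ℂˣ) :
    ∑ a, (φ a : ℂ) * (ψ a⁻¹ : ℂ) = if φ = ψ then (Nat.card A : ℂ) else 0 := by
  classical
  have h := sum_hom_units ((Units.coeHom ℂ).comp (φ * ψ⁻¹))
  have h1 : (Units.coeHom ℂ).comp (φ * ψ⁻¹) = 1 ↔ φ = ψ := by
    rw [← mul_inv_eq_one (a := φ)]
    refine ⟨fun h => ?_, fun h => by rw [h]; rfl⟩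
    ext a
    exact DFunLike.congr_fun h a
  simp only [h1] at h
  rw [Nat.card_eq_fintype_card, ← Nat.cast_zero, ← apply_ite Nat.cast, ← h]
  refine Finset.sum_congr rfl fun a _ => ?_
  simp

noncomputable instance : Fintype (A →* ℂˣ) :=
  Fintype.ofFinite _

lemma sum_linear_apply [DecidableEq A] (hA : ∀ a b : A, a * b = b * a) (a : A) :
    ∑ φ : A →* ℂˣ, (φ a : ℂ) = if a = 1 then (Nat.card A : ℂ) else 0 := by
  classical
  have h0 : ∀ a : A, a ≠ 1 → ∑ φ : A →* ℂˣ, (φ a : ℂ) = 0 := by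
    intro a ha
    let _ : CommGroup A := { (inferInstance : Group A) with mul_comm := hA }
    obtain ⟨ψ, hψ⟩ := CommGroup.exists_apply_ne_one_of_hasEnoughRootsOfUnity A ℂ ha
    have h1 : (ψ a : ℂ) * ∑ φ : A →* ℂˣ, (φ a : ℂ) = ∑ φ : A →* ℂˣ, (φ a : ℂ) := by
      rw [Finset.mul_sum, ← Equiv.sum_comp (Equiv.mulLeft ψ) fun φ => (φ a : ℂ)]
      simp
    have h2 : ((ψ a : ℂ) - 1) * ∑ φ : A →* ℂˣ, (φ a : ℂ) = 0 := by linear_combination h1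
    refine (mul_eq_zero.1 h2).resolve_left fun h => hψ (Units.ext ?_)
    simpa using sub_eq_zero.1 h
  split_ifs with ha
  · subst ha
    have h1 : ∑ a : A, ∑ φ : A →* ℂˣ, (φ a : ℂ) = ∑ φ : A →* ℂˣ, (φ (1 : A) : ℂ) :=
      Finset.sum_eq_single 1 (fun b _ hb => h0 b hb) (by simp)
    rw [← h1, Finset.sum_comm]
    have h2 := fun φ => sum_mul_inv_linear φ (1 : A →* ℂˣ)
    simp only [MonoidHom.one_apply, Units.val_one, mul_one] at h2
    simp [h2]
  · exact h0 a ha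

end linear

section multiplicity

variable {G : Type u} [Group G] (A : Subgroup G) [Fintype A]

/-- The multiplicity of the linear character `φ` of a subgroup in the restriction of the
character `χ`. -/
noncomputable def linMult (φ : A →* ℂˣ) (χ : G → ℂ) : ℂ :=
  (Nat.card A : ℂ)⁻¹ * ∑ a : A, (φ a : ℂ) * χ (a : G)⁻¹

lemma IsIrrChar.exists_linMult {χ : G → ℂ} (h : IsIrrChar χ) (φ : A →* ℂˣ) :
    ∃ k : ℕ, linMult A φ χ = k := by
  classical
  obtain ⟨V, _, _, _, ρ, -, rfl⟩ := h
  let σ : Representation ℂ A V :=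
    { toFun := fun a => ((φ a⁻¹ : ℂˣ) : ℂ) • ρ a
      map_one' := by simp
      map_mul' := fun a b => by
        simp only [mul_inv_rev, map_mul, Units.val_mul, Subgroup.coe_mul, smul_mul_smul_comm]
        rw [mul_comm] }
  have : Invertible (Nat.card A : ℂ) := invertibleOfNonzero (by simp)
  refine ⟨_, Eq.trans ?_ σ.card_inv_mul_sum_char_eq_finrank⟩
  rw [linMult, ← Equiv.sum_comp (Equiv.inv A)]
  congr 1
  refine Finset.sum_congr rfl fun a _ => ?_
  simp [σ, Representation.character]

variable {A} (hA : IsCommSub A)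
include hA

lemma sum_linMult_mul (χ : G → ℂ) (a : A) :
    ∑ φ : A →* ℂˣ, linMult A φ χ * (φ a : ℂ) = χ a := by
  classical
  have h := fun b => sum_linear_apply (A := A) (fun a b => Subtype.ext (hA a a.2 b b.2)) (b * a)
  simp only [linMult, mul_assoc, Finset.sum_mul, ← Finset.mul_sum]
  rw [Finset.sum_comm]
  have h1 : ∀ b : A, ∑ φ : A →* ℂˣ, (φ b : ℂ) * (χ (b : G)⁻¹ * (φ a : ℂ)) =
      χ (b : G)⁻¹ * if b = a⁻¹ then (Nat.card A : ℂ) else 0 := by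
    intro b
    rw [← ite_congr (propext mul_eq_one_iff_eq_inv) (fun _ => rfl) fun _ => rfl, ← h, Finset.mul_sum]
    refine Finset.sum_congr rfl fun φ _ => ?_
    rw [map_mul, Units.val_mul]
    ring
  simp only [h1, mul_ite, mul_zero, Finset.sum_ite_eq', Finset.mem_univ, if_true]
  rw [mul_comm (χ _), inv_mul_cancel_left₀ (by simp)]
  simp

lemma sum_linMult_sq (χ : G → ℂ) :
    (Nat.card A : ℂ) * ∑ φ : A →* ℂˣ, linMult A φ χ ^ 2 = ∑ a : A, χ a * χ (a : G)⁻¹ := by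
  have h : ∀ φ : A →* ℂˣ, (Nat.card A : ℂ) * linMult A φ χ ^ 2 =
      ∑ a : A, linMult A φ χ * (φ a : ℂ) * χ (a : G)⁻¹ := by
    intro φ
    rw [sq, linMult, ← mul_assoc, mul_inv_cancel_left₀ (by simp), mul_comm, ← linMult,
      Finset.mul_sum]
    simp only [mul_assoc]
  rw [Finset.mul_sum, Finset.sum_congr rfl fun φ _ => h φ, Finset.sum_comm]
  simp only [← Finset.sum_mul, sum_linMult_mul hA]

end multiplicity

section induction

variable {G : Type u} [Group G] [Fintype G] (A : Subgroup G) [Fintype A]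

/-- The function induced from a function supported on the subgroup `A`. -/
noncomputable def indFun (φ : G → ℂ) (x : G) : ℂ := (Nat.card A : ℂ)⁻¹ * ∑ t, φ (t * x * t⁻¹)

lemma indFun_conj (φ : G → ℂ) (s x : G) : indFun A φ (s * x * s⁻¹) = indFun A φ x := by
  rw [indFun, indFun, ← Equiv.sum_comp (Equiv.mulRight s) fun t => φ (t * x * t⁻¹)]
  congr 1
  refine Finset.sum_congr rfl fun t _ => ?_
  simp [mul_assoc]

lemma indFun_one {φ : G → ℂ} (h : φ 1 = 0) : indFun A φ 1 = 0 := by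
  simp [indFun, h]

variable {A}

omit [Fintype A] in
lemma sum_subgroup [Fintype A] {φ : G → ℂ} (h : ∀ x, x ∉ A → φ x = 0) : ∑ a : A, φ a = ∑ x, φ x := by
  classical
  rw [← Finset.sum_filter_of_ne (p := (· ∈ A)) fun x _ hx => by_contra fun hA => hx (h x hA)]
  exact (Finset.sum_subtype _ (by simp) _).symm

lemma charForm_indFun {φ : G → ℂ} (h : ∀ x, x ∉ A → φ x = 0) {f : G → ℂ}
    (hf : ∀ t x, f (t * x * t⁻¹) = f x) :
    charForm (indFun A φ) f = (Nat.card A : ℂ)⁻¹ * ∑ a : A, φ a * f (a : G)⁻¹ := by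
  have h1 : ∀ t, ∑ x, φ (t * x * t⁻¹) * f x⁻¹ = ∑ x, φ x * f x⁻¹ := by
    intro t
    rw [← Equiv.sum_comp (MulAut.conj t).toEquiv fun x => φ x * f x⁻¹]
    refine Finset.sum_congr rfl fun x _ => ?_
    simp only [MulEquiv.toEquiv_eq_coe, EquivLike.coe_coe, MulAut.conj_apply]
    rw [conj_inv, hf]
  rw [sum_subgroup (φ := fun x => φ x * f x⁻¹) fun x hx => by rw [h x hx, zero_mul]]
  have h2 : ∀ x, indFun A φ x * f x⁻¹ =
      (Nat.card A : ℂ)⁻¹ * ∑ t, φ (t * x * t⁻¹) * f x⁻¹ := fun x => by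
    rw [indFun, mul_assoc, Finset.sum_mul]
  rw [charForm, Finset.sum_congr rfl fun x _ => h2 x, ← Finset.mul_sum, Finset.sum_comm, Finset.sum_congr rfl fun t _ => h1 t, Finset.sum_const, Finset.card_univ,
    nsmul_eq_mul, ← Nat.card_eq_fintype_card, mul_left_comm, ← mul_assoc (Nat.card G : ℂ)⁻¹,
    inv_mul_cancel₀ (by simp), one_mul]

open Classical in
/-- The extension by zero of a linear character of `A`. -/
noncomputable def extLin (φ : A →* ℂˣ) (x : G) : ℂ := if hx : x ∈ A then (φ ⟨x, hx⟩ : ℂ) else 0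

omit [Fintype G] [Fintype A] in
lemma extLin_coe (φ : A →* ℂˣ) (a : A) : extLin φ (a : G) = φ a := by
  rw [extLin, dif_pos a.2]

omit [Fintype G] [Fintype A] in
lemma extLin_of_notMem (φ : A →* ℂˣ) {x : G} (hx : x ∉ A) : extLin φ x = 0 := dif_neg hx

omit [Fintype G] [Fintype A] in
lemma extLin_one (φ : A →* ℂˣ) : extLin φ (1 : G) = 1 := by
  have := extLin_coe φ (1 : A)
  simpa using this

/-- The function induced by the difference of two linear characters. -/
noncomputable def indDiff (φ φ' : A →* ℂˣ) : G → ℂ := indFun A fun x => extLin φ x - extLin φ' x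

lemma indDiff_conj (φ φ' : A →* ℂˣ) (t x : G) :
    indDiff φ φ' (t * x * t⁻¹) = indDiff φ φ' x := indFun_conj A _ t x

lemma charForm_indDiff (φ φ' : A →* ℂˣ) {f : G → ℂ} (hf : ∀ t x, f (t * x * t⁻¹) = f x) :
    charForm (indDiff φ φ') f = linMult A φ f - linMult A φ' f := by
  rw [indDiff, charForm_indFun (fun x hx => by simp [extLin_of_notMem _ hx]) hf, linMult, linMult,
    ← mul_sub, ← Finset.sum_sub_distrib]
  simp only [extLin_coe, sub_mul]

lemma indDiff_one (φ φ' : A →* ℂˣ) : indDiff φ φ' (1 : G) = 0 :=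
  indFun_one A (by simp [extLin_one])

/-- The conjugate of a linear character by an element of the normalizer. -/
noncomputable def twist (t : normalizer (A : Set G)) (φ : A →* ℂˣ) : A →* ℂˣ :=
  φ.comp (A.normalizerMonoidHom t).toMonoidHom

omit [Fintype G] [Fintype A] in
lemma twist_apply (t : normalizer (A : Set G)) (φ : A →* ℂˣ) (a : A) :
    twist t φ a = φ ⟨(t : G) * a * (t : G)⁻¹, (mem_normalizer_iff.1 t.2 a).1 a.2⟩ := rfl

lemma linMult_twist (t : normalizer (A : Set G)) (φ : A →* ℂˣ) {f : G → ℂ}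
    (hf : ∀ t x, f (t * x * t⁻¹) = f x) : linMult A (twist t φ) f = linMult A φ f := by
  rw [linMult, linMult, ← Equiv.sum_comp (A.normalizerMonoidHom t).toEquiv
    fun a => (φ a : ℂ) * f (a : G)⁻¹]
  congr 1
  refine Finset.sum_congr rfl fun a _ => ?_
  rw [← hf t, ← conj_inv]
  rfl

end induction

namespace SylowSystem

variable {G : Type u} [Group G] [Fintype G] {ι : Type*} {A : ι → Subgroup G} {p r : ι → ℕ}

/-- The number of elements of the normalizer which carry one linear character to another one. -/
noncomputable def twistCount {A : Subgroup G} (μ l : A →* ℂˣ) : ℕ :=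
  Nat.card {t : normalizer (A : Set G) // twist t μ = l}

lemma twistCount_one_one (h : SylowSystem A p r) (i : ι) :
    twistCount (1 : A i →* ℂˣ) 1 = Nat.card (A i) * r i := by
  rw [← h.card_norm i, twistCount]
  exact Nat.card_congr (Equiv.subtypeUnivEquiv fun t => by ext; rfl)

lemma twist_one {A : Subgroup G} (t : normalizer (A : Set G)) : twist t (1 : A →* ℂˣ) = 1 := by
  ext; rfl

lemma twist_mul {A : Subgroup G} (t s : normalizer (A : Set G)) (μ : A →* ℂˣ) :
    twist (t * s) μ = twist s (twist t μ) := by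
  ext a
  simp only [twist_apply, Subgroup.coe_mul, mul_inv_rev, mul_assoc]

lemma one_twist {A : Subgroup G} (μ : A →* ℂˣ) : twist 1 μ = μ := by
  ext a
  simp [twist_apply]

lemma twist_eq_one {A : Subgroup G} {t : normalizer (A : Set G)} {μ : A →* ℂˣ} (h : twist t μ = 1) :
    μ = 1 := by
  have := congrArg (twist t⁻¹) h
  rwa [← twist_mul, twist_one, mul_inv_cancel, one_twist] at this

lemma twistCount_one_left {A : Subgroup G} {l : A →* ℂˣ} (hl : l ≠ 1) : twistCount 1 l = 0 := by
  rw [twistCount, Nat.card_eq_zero]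
  exact Or.inl ⟨fun t => hl (by rw [← t.2, twist_one])⟩

lemma twistCount_one_right {A : Subgroup G} {μ : A →* ℂˣ} (hμ : μ ≠ 1) : twistCount μ 1 = 0 := by
  rw [twistCount, Nat.card_eq_zero]
  exact Or.inl ⟨fun t => hμ (twist_eq_one t.2)⟩

lemma twist_eq_self_iff (h : SylowSystem A p r) {i : ι} {μ : A i →* ℂˣ} (hμ : μ ≠ 1)
    (t : normalizer (A i : Set G)) : twist t μ = μ ↔ (t : G) ∈ A i := by
  constructor
  · intro ht
    by_contra htA
    have hmem : ∀ a : A i, (t : G) * a * (t : G)⁻¹ ∈ A i := fun a => (mem_normalizer_iff.1 t.2 a).1 a.2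
    let ψ : A i → A i := fun a => ⟨t * a * (t : G)⁻¹, hmem a⟩ * a⁻¹
    have hinj : Function.Injective ψ := by
      intro a b hab
      by_contra hne
      have h1 : (t : G) * a * (t : G)⁻¹ * (a : G)⁻¹ = t * b * (t : G)⁻¹ * (b : G)⁻¹ :=
        congrArg Subtype.val hab
      have h2 := h.comm i _ (hmem b) _ (inv_mem a.2)
      have h3 : (b : G)⁻¹ * a ≠ 1 := fun e => hne (Subtype.ext (inv_mul_eq_one.1 e).symm)
      refine htA ((h.cent i _ (mul_mem (inv_mem b.2) a.2) h3).le ?_)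
      rw [mem_centralizer_singleton_iff, ← mul_inv_eq_iff_eq_mul]
      have h4 : (t : G) * a * (t : G)⁻¹ = t * b * (t : G)⁻¹ * (b : G)⁻¹ * a := by
        rw [← h1]; group
      calc (t : G) * ((b : G)⁻¹ * a) * (t : G)⁻¹ =
          ((t : G) * b * (t : G)⁻¹)⁻¹ * ((t : G) * a * (t : G)⁻¹) := by group
        _ = _ := by rw [h4]; group
    have hsurj := Finite.surjective_of_injective hinj
    apply hμ
    ext a
    obtain ⟨b, rfl⟩ := hsurj a
    have := DFunLike.congr_fun ht b
    rw [twist_apply] at this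
    simp [ψ, this]
  · intro ht
    ext a
    rw [twist_apply]
    congr 3
    rw [h.comm i _ ht _ a.2, mul_inv_cancel_right]

lemma twistCount_eq (h : SylowSystem A p r) {i : ι} {μ : A i →* ℂˣ} (hμ : μ ≠ 1)
    (t : normalizer (A i : Set G)) : twistCount μ (twist t μ) = Nat.card (A i) := by
  have key : ∀ s : normalizer (A i : Set G),
      twist s μ = twist t μ ↔ (s : G) * (t : G)⁻¹ ∈ A i := by
    intro s
    rw [← InvMemClass.coe_inv, ← Subgroup.coe_mul, ← h.twist_eq_self_iff hμ, twist_mul]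
    constructor
    · intro e
      rw [e, ← twist_mul, mul_inv_cancel, one_twist]
    · intro e
      rw [← twist_mul] at e
      nth_rw 2 [← e]
      rw [← twist_mul, inv_mul_cancel_right]
  refine Nat.card_congr
    { toFun := fun s => ⟨(s : G) * (t : G)⁻¹, (key s).1 s.2⟩
      invFun := fun a => ⟨⟨a * t, mul_mem (le_normalizer a.2) t.2⟩, (key _).2 (by simp)⟩
      left_inv := fun s => by ext; simp
      right_inv := fun a => by ext; simp }

lemma card_conj_linear (h : SylowSystem A p r) {i : ι} {μ : A i →* ℂˣ} (hμ : μ ≠ 1) :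
    Nat.card {l : A i →* ℂˣ // ∃ t, twist t μ = l} = r i := by
  have h1 := h.card_norm i
  let e : normalizer (A i : Set G) ≃
      Σ l : {l : A i →* ℂˣ // ∃ t, twist t μ = l}, {t // twist t μ = l.1} :=
    { toFun := fun t => ⟨⟨twist t μ, t, rfl⟩, t, rfl⟩
      invFun := fun x => x.2.1
      left_inv := fun t => rfl
      right_inv := by
        rintro ⟨⟨_, t, rfl⟩, s, hs⟩
        dsimp only at hs
        simp only [Sigma.mk.injEq, Subtype.mk.injEq]
        refine ⟨hs, ?_⟩
        congr! }
  have : Fintype {l : A i →* ℂˣ // ∃ t, twist t μ = l} := Fintype.ofFinite _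
  rw [Nat.card_congr e, Nat.card_sigma, Finset.sum_congr rfl (g := fun _ => Nat.card (A i))] at h1
  · rw [Finset.sum_const, Finset.card_univ, ← Nat.card_eq_fintype_card, smul_eq_mul, mul_comm] at h1
    exact Nat.eq_of_mul_eq_mul_left Nat.card_pos h1
  · rintro ⟨_, t, rfl⟩ -
    exact h.twistCount_eq hμ t

variable [∀ i, Fintype (A i)]

lemma linMult_indDiff (h : SylowSystem A p r) (i : ι) (l μ μ' : A i →* ℂˣ) :
    linMult (A i) l (indDiff μ μ') =
      (Nat.card (A i) : ℂ)⁻¹ * (twistCount μ l - twistCount μ' l : ℂ) := by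
  classical
  have hind : ∀ a : A i, indDiff μ μ' (a : G)⁻¹ = (Nat.card (A i) : ℂ)⁻¹ *
      ∑ t : normalizer (A i : Set G), ((twist t μ a⁻¹ : ℂ) - twist t μ' a⁻¹) := by
    intro a
    rw [indDiff, indFun]
    congr 1
    rcases eq_or_ne a 1 with rfl | ha
    · simp [extLin_one]
    rw [← sum_subgroup (A := normalizer (A i : Set G))
      (φ := fun t => extLin μ (t * (a : G)⁻¹ * t⁻¹) - extLin μ' (t * (a : G)⁻¹ * t⁻¹))]
    · refine Finset.sum_congr rfl fun t _ => ?_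
      rw [twist_apply, twist_apply, ← extLin_coe, ← extLin_coe]
      rfl
    · intro t ht
      have : t * (a : G)⁻¹ * t⁻¹ ∉ A i := fun hm =>
        ht (h.fusion (inv_mem a.2) (by simpa using ha) hm).2
      rw [extLin_of_notMem _ this, extLin_of_notMem _ this, sub_zero]
  have hcount : ∀ μ : A i →* ℂˣ, ∑ t : normalizer (A i : Set G), ∑ a : A i,
      (l a : ℂ) * (twist t μ a⁻¹ : ℂ) = Nat.card (A i) * (twistCount μ l : ℂ) := by
    intro μ
    simp only [sum_mul_inv_linear]
    rw [← Finset.sum_filter, Finset.sum_const, twistCount, nsmul_eq_mul, mul_comm,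
      Nat.card_eq_fintype_card (α := {t // twist t μ = l}), Fintype.card_subtype]
    simp only [eq_comm]
  have hne : (Nat.card (A i) : ℂ) ≠ 0 := by simp
  rw [linMult]
  congr 1
  rw [← mul_right_inj' hne, mul_sub, ← hcount, ← hcount, ← Finset.sum_sub_distrib, Finset.mul_sum]
  simp only [← Finset.sum_sub_distrib]
  rw [Finset.sum_comm]
  refine Finset.sum_congr rfl fun a _ => ?_
  rw [hind, mul_left_comm, mul_inv_cancel_left₀ hne, Finset.mul_sum]
  simp only [mul_sub]

lemma linMult_indDiff_of_ne (h : SylowSystem A p r) {i j : ι} (hij : i ≠ j) (l : A i →* ℂˣ)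
    (μ μ' : A j →* ℂˣ) : linMult (A i) l (indDiff μ μ') = 0 := by
  rw [linMult, Finset.sum_eq_zero, mul_zero]
  intro a _
  rw [indDiff, indFun]
  rcases eq_or_ne a 1 with rfl | ha
  · simp [extLin_one]
  rw [Finset.sum_eq_zero, mul_zero, mul_zero]
  intro t _
  have : t * (a : G)⁻¹ * t⁻¹ ∉ A j := fun hm =>
    hij.symm (h.fusion (inv_mem a.2) (by simpa using ha) hm).1
  rw [extLin_of_notMem _ this, extLin_of_notMem _ this, sub_zero]

end SylowSystem

section multiplicities

variable {G : Type u} [Group G] (A : Subgroup G) [Fintype A]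

/-- The multiplicity of a linear character of a subgroup as a natural number. -/
noncomputable def natMult (φ : A →* ℂˣ) (χ : {χ : G → ℂ // IsIrrChar χ}) : ℕ :=
  (χ.2.exists_linMult A φ).choose

lemma linMult_eq_natMult (φ : A →* ℂˣ) (χ : {χ : G → ℂ // IsIrrChar χ}) :
    linMult A φ χ.1 = natMult A φ χ :=
  (χ.2.exists_linMult A φ).choose_spec

/-- The degree of an irreducible character. -/
noncomputable def degree (χ : {χ : G → ℂ // IsIrrChar χ}) : ℕ := χ.2.exists_degree.choose

lemma degree_pos (χ : {χ : G → ℂ // IsIrrChar χ}) : 0 < degree χ :=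
  χ.2.exists_degree.choose_spec.1

lemma apply_one_eq_degree (χ : {χ : G → ℂ // IsIrrChar χ}) : χ.1 1 = degree χ :=
  χ.2.exists_degree.choose_spec.2

variable {A}

lemma degree_eq_sum (hA : IsCommSub A) (χ : {χ : G → ℂ // IsIrrChar χ}) :
    degree χ = ∑ φ : A →* ℂˣ, natMult A φ χ := by
  have := sum_linMult_mul hA χ.1 1
  simp only [map_one, Units.val_one, mul_one, linMult_eq_natMult, OneMemClass.coe_one,
    apply_one_eq_degree] at this
  exact_mod_cast this.symm

lemma card_linear (hA : IsCommSub A) : Fintype.card (A →* ℂˣ) = Nat.card A := by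
  classical
  have := sum_linear_apply (A := A) (fun a b => Subtype.ext (hA a a.2 b b.2)) 1
  simp only [map_one, Units.val_one, Finset.sum_const, if_true, Finset.card_univ, nsmul_eq_mul,
    mul_one] at this
  exact_mod_cast this

lemma sum_linear_ne_one [DecidablePred fun φ : A →* ℂˣ => φ ≠ 1] {M : Type*} [AddCommMonoid M] (f : (A →* ℂˣ) → M) :
    ∑ φ, f φ = f 1 + ∑ φ : {φ : A →* ℂˣ // φ ≠ 1}, f φ.1 := by
  classical
  rw [← Finset.add_sum_erase _ f (Finset.mem_univ 1)]
  congr 1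
  exact Finset.sum_subtype _ (by simp) _

end multiplicities

namespace SylowSystem

variable {G : Type u} [Group G] [Fintype G] {ι : Type*} {A : ι → Subgroup G} {p r : ι → ℕ}
  [∀ i, Fintype (A i)]

lemma natMult_gram {i j : ι} (l l' : A i →* ℂˣ) (μ μ' : A j →* ℂˣ) :
    ((∑ χ, ((natMult (A i) l χ : ℤ) - natMult (A i) l' χ) *
      ((natMult (A j) μ χ : ℤ) - natMult (A j) μ' χ) : ℤ) : ℂ) =
      linMult (A i) l (indDiff μ μ') - linMult (A i) l' (indDiff μ μ') := by
  rw [← charForm_indDiff _ _ (indDiff_conj μ μ'), charForm_eq_sum (indDiff_conj l l')]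
  push_cast
  refine Finset.sum_congr rfl fun χ _ => ?_
  rw [charForm_indDiff _ _ χ.2.conj, charForm_indDiff _ _ χ.2.conj]
  simp only [linMult_eq_natMult]

variable (h : SylowSystem A p r)
include h

lemma natMult_gram_of_ne {i j : ι} (hij : i ≠ j) (l l' : A i →* ℂˣ) (μ μ' : A j →* ℂˣ) :
    ∑ χ, ((natMult (A i) l χ : ℤ) - natMult (A i) l' χ) *
      ((natMult (A j) μ χ : ℤ) - natMult (A j) μ' χ) = 0 := by
  have := natMult_gram l l' μ μ'
  rw [h.linMult_indDiff_of_ne hij, h.linMult_indDiff_of_ne hij, sub_zero] at this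
  exact_mod_cast this

lemma card_mul_natMult_gram {i : ι} (l l' μ μ' : A i →* ℂˣ) :
    (Nat.card (A i) : ℤ) * ∑ χ, ((natMult (A i) l χ : ℤ) - natMult (A i) l' χ) *
      ((natMult (A i) μ χ : ℤ) - natMult (A i) μ' χ) =
      twistCount μ l - twistCount μ' l - (twistCount μ l' - twistCount μ' l') := by
  have := natMult_gram l l' μ μ'
  rw [h.linMult_indDiff, h.linMult_indDiff, ← mul_sub, eq_inv_mul_iff_mul_eq₀ (by simp)] at this
  exact_mod_cast this

lemma twistCount_self {i : ι} {μ : A i →* ℂˣ} (hμ : μ ≠ 1) : twistCount μ μ = Nat.card (A i) := by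
  have := h.twistCount_eq hμ 1
  rwa [one_twist] at this

omit h in
lemma twistCount_eq_zero {A : Subgroup G} {μ l : A →* ℂˣ} (hμ : ¬ ∃ t, twist t μ = l) :
    twistCount μ l = 0 := by
  rw [twistCount, Nat.card_eq_zero]
  exact Or.inl ⟨fun t => hμ ⟨t, t.2⟩⟩

lemma natMult_eq_iff {i : ι} {μ l : A i →* ℂˣ} (hμ : μ ≠ 1) (hl : l ≠ 1) :
    natMult (A i) l = natMult (A i) μ ↔ ∃ t, twist t μ = l := by
  constructor
  · intro e
    by_contra hcon
    have h1 := h.card_mul_natMult_gram μ l μ l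
    have h2 : ¬ ∃ t, twist t l = μ := by
      rintro ⟨t, rfl⟩
      exact hcon ⟨t⁻¹, by rw [← twist_mul, mul_inv_cancel, one_twist]⟩
    rw [e, h.twistCount_self hμ, h.twistCount_self hl, twistCount_eq_zero hcon,
      twistCount_eq_zero h2] at h1
    have h3 : (0 : ℤ) < Nat.card (A i) := by exact_mod_cast Nat.card_pos
    simp only [sub_self, mul_zero, Finset.sum_const_zero] at h1
    push_cast at h1
    linarith
  · rintro ⟨t, rfl⟩
    funext χ
    have := linMult_twist t μ χ.2.conj
    rw [linMult_eq_natMult, linMult_eq_natMult] at this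
    exact_mod_cast this

lemma twistCount_eq_zero_of_natMult {i : ι} {μ l : A i →* ℂˣ} (hμ : μ ≠ 1) (hl : l ≠ 1)
    (hne : natMult (A i) l ≠ natMult (A i) μ) : twistCount μ l = 0 :=
  twistCount_eq_zero fun ht => hne ((h.natMult_eq_iff hμ hl).2 ht)

end SylowSystem

namespace SylowSystem

variable {G : Type u} [Group G] [Fintype G] {ι : Type*} {A : ι → Subgroup G} {p r : ι → ℕ}

open Classical in
lemma sum_nontrivial (A : Subgroup G) [Fintype A] (f : G → ℂ) :
    ∑ x with x ∈ A ∧ x ≠ 1, f x = ∑ a : A, f a - f 1 := by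
  have h1 : ∑ a : A, f a = ∑ x with x ∈ A, f x := (Finset.sum_subtype _ (by simp) _).symm
  have h2 : (Finset.univ.filter fun x => x ∈ A ∧ x ≠ 1) =
      (Finset.univ.filter fun x => x ∈ A).erase 1 := by
    ext x
    simp [and_comm]
  rw [h1, h2, ← Finset.add_sum_erase (Finset.univ.filter fun x => x ∈ A) f (a := 1) (by simp [one_mem]),
    add_sub_cancel_left]

lemma sum_eq_sum_subgroup [Fintype ι] [∀ i, Fintype (A i)] (h : SylowSystem A p r) {n : ι → ℕ}
    (hn : ∀ i, Nat.card G = Nat.card (A i) * r i * n i) {f : G → ℂ}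
    (hf : ∀ t x, f (t * x * t⁻¹) = f x) :
    ∑ x, f x = f 1 + ∑ i, (n i : ℂ) * (∑ a : A i, f a - f 1) := by
  classical
  rw [h.sum_eq hf]
  congr 1
  refine Finset.sum_congr rfl fun i _ => ?_
  have hr : (r i : ℂ) ≠ 0 := Nat.cast_ne_zero.2 (h.r_pos i).ne'
  have hq : (Nat.card (A i) : ℂ) ≠ 0 := by simp
  have h1 : (Nat.card G : ℂ) / (Nat.card (A i) * r i) = n i := by
    rw [hn i]
    push_cast
    field_simp
  rw [h1]
  congr 1
  convert sum_nontrivial (A i) f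

variable [∀ i, Fintype (A i)]

lemma characterData [Fintype ι] (h : SylowSystem A p r) (hodd : Odd (Nat.card G)) {w n : ι → ℕ}
    (hw0 : ∀ i, 0 < w i) (hw : ∀ i, Nat.card (A i) = w i * r i + 1)
    (hn : ∀ i, Nat.card G = Nat.card (A i) * r i * n i)
    [∀ i, DecidablePred fun φ : A i →* ℂˣ => φ ≠ 1] :
    CharacterData (Λ := fun i => {φ : A i →* ℂˣ // φ ≠ 1})
      (fun i χ => (natMult (A i) 1 χ : ℤ)) (fun i φ χ => (natMult (A i) φ.1 χ : ℤ))
      (fun χ => (degree χ : ℤ)) (⟨fun _ => 1, isIrrChar_one⟩ : {χ : G → ℂ // IsIrrChar χ})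
      (fun i => Nat.card (A i)) r w n (Nat.card G) := by
  classical
  have hq0 : ∀ i, (Nat.card (A i) : ℤ) ≠ 0 := fun i => by exact_mod_cast Nat.card_pos.ne'
  have hv : ∀ i (a b : {φ : A i →* ℂˣ // φ ≠ 1}),
      ((fun χ => (natMult (A i) a.1 χ : ℤ)) ≠ fun χ => (natMult (A i) b.1 χ : ℤ)) →
      twistCount a.1 b.1 = 0 ∧ twistCount b.1 a.1 = 0 := by
    intro i a b hab
    have hab' : natMult (A i) a.1 ≠ natMult (A i) b.1 := fun e => hab (by rw [e])
    exact ⟨h.twistCount_eq_zero_of_natMult a.2 b.2 hab'.symm,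
      h.twistCount_eq_zero_of_natMult b.2 a.2 hab'⟩
  have hm : ∀ i (φ : A i →* ℂˣ),
      natMult (A i) φ ⟨fun _ => 1, isIrrChar_one⟩ = if φ = 1 then 1 else 0 := by
    intro i φ
    have h1 := linMult_eq_natMult (A i) φ ⟨fun _ => 1, isIrrChar_one⟩
    have h2 := sum_mul_inv_linear φ 1
    simp only [MonoidHom.one_apply, Units.val_one] at h2
    rw [linMult] at h1
    simp only [h2] at h1
    split_ifs at h1 ⊢
    · rw [inv_mul_cancel₀ (by simp)] at h1
      exact_mod_cast h1.symm
    · rw [mul_zero] at h1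
      exact_mod_cast h1.symm
  refine ⟨hw, ?_, hw0, fun i => (h.r_prime i).two_le, hodd, hn, ?_, ?_, ?_, ?_, ?_, ?_, ?_, ?_, ?_,
    ?_, ?_, ?_, ?_, ?_, ?_, ?_, ?_⟩
  · intro i
    have h1 := hodd
    rw [hn i, Nat.odd_mul, Nat.odd_mul, hw i] at h1
    obtain ⟨⟨h2, h3⟩, -⟩ := h1
    by_contra h4
    rw [Nat.not_even_iff_odd] at h4
    exact (Nat.not_odd_iff_even.2 ((h4.mul h3).add_one)) h2
  · intro i j hij
    by_contra hne
    have := h.card_coprime hne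
    simp only at hij
    rw [hij, Nat.coprime_self] at this
    have := h.two_le_card j
    omega
  · rw [← h.class_equation_div]
    refine Finset.sum_congr rfl fun i _ => ?_
    have hr : (r i : ℚ) ≠ 0 := Nat.cast_ne_zero.2 (h.r_pos i).ne'
    have hq : (Nat.card (A i) : ℚ) ≠ 0 := Nat.cast_ne_zero.2 Nat.card_pos.ne'
    rw [div_eq_div_iff hq (mul_ne_zero hq hr), hw i]
    push_cast
    ring
  · intro i
    rw [Fintype.card_subtype_compl, card_linear (h.comm i), hw i]
    simp
  · intro i a
    rw [← h.card_conj_linear a.2]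
    refine Nat.card_congr
      { toFun := fun b => ⟨b.1.1, (h.natMult_eq_iff a.2 b.1.2).1 ?_⟩
        invFun := fun l => ⟨⟨l.1, ?_⟩, ?_⟩
        left_inv := fun b => rfl
        right_inv := fun l => rfl }
    · funext χ
      exact_mod_cast congrFun b.2 χ
    · obtain ⟨l, t, rfl⟩ := l
      exact fun e => a.2 (twist_eq_one e)
    · obtain ⟨l, t, rfl⟩ := l
      dsimp only
      rw [(h.natMult_eq_iff a.2 fun e => a.2 (twist_eq_one e)).2 ⟨t, rfl⟩]
  · exact fun χ => by exact_mod_cast degree_pos χ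
  · intro i a b
    have h1 := congrFun (eq_sum_charForm (indDiff_conj a.1 b.1)) 1
    rw [indDiff_one] at h1
    have h2 : ((∑ χ, (degree χ : ℤ) * ((natMult (A i) a.1 χ : ℤ) - natMult (A i) b.1 χ) : ℤ) : ℂ)
        = 0 := by
      rw [h1]
      push_cast
      refine Finset.sum_congr rfl fun χ _ => ?_
      rw [charForm_indDiff _ _ χ.2.conj, apply_one_eq_degree, linMult_eq_natMult,
        linMult_eq_natMult, mul_comm]
    exact_mod_cast h2
  · intro i a b hab
    rw [← mul_right_inj' (hq0 i), h.card_mul_natMult_gram, h.twistCount_self a.2,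
      h.twistCount_self b.2, (hv i a b hab).1, (hv i a b hab).2]
    push_cast
    ring
  · intro i a b c hab hac hbc
    rw [← mul_right_inj' (hq0 i), h.card_mul_natMult_gram, h.twistCount_self a.2,
      (hv i a b hab).1, (hv i a c hac).2, (hv i b c hbc).2]
    push_cast
    ring
  · intro i a
    rw [← mul_right_inj' (hq0 i), h.card_mul_natMult_gram, h.twistCount_self a.2,
      h.twistCount_one_one, twistCount_one_left a.2, twistCount_one_right a.2]
    push_cast
    ring
  · exact fun i j hij a b a' b' => h.natMult_gram_of_ne hij _ _ _ _
  · exact fun i j hij a a' b' => h.natMult_gram_of_ne hij _ _ _ _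
  · exact fun i j hij a a' => h.natMult_gram_of_ne hij _ _ _ _
  · intro i χ
    rw [degree_eq_sum (h.comm i), sum_linear_ne_one]
    push_cast
    rfl
  · intro i
    simp [hm]
  · intro i a
    simp [hm, a.2]
  · intro χ hχ
    have h1 := h.sum_eq_sum_subgroup hn χ.2.conj
    have h2 := charForm_irr isIrrChar_one χ.2
    rw [if_neg fun e => hχ (Subtype.ext e.symm), charForm, mul_eq_zero] at h2
    have h3 : ∑ x, χ.1 x = 0 := by
      rcases h2 with h2 | h2
      · simp at h2
      · rw [← Equiv.sum_comp (Equiv.inv G)]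
        simpa using h2
    have h4 : ∀ i, ∑ a : A i, χ.1 a = Nat.card (A i) * natMult (A i) 1 χ := by
      intro i
      rw [← linMult_eq_natMult, linMult, mul_inv_cancel_left₀ (by simp),
        ← Equiv.sum_comp (Equiv.inv (A i))]
      simp
    rw [h3, apply_one_eq_degree] at h1
    simp only [h4] at h1
    exact_mod_cast h1.symm
  · intro χ
    have h1 := h.sum_eq_sum_subgroup hn (f := fun x => χ.1 x * χ.1 x⁻¹) fun t x => by
      rw [conj_inv, χ.2.conj, χ.2.conj]
    have h2 := charForm_irr χ.2 χ.2
    rw [if_pos rfl, charForm, inv_mul_eq_one₀ (by simp)] at h2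
    have h4 : ∀ i, ∑ a : A i, χ.1 a * χ.1 (a : G)⁻¹ = Nat.card (A i) *
        ((natMult (A i) 1 χ : ℂ) ^ 2 + ∑ φ : {φ : A i →* ℂˣ // φ ≠ 1}, (natMult (A i) φ.1 χ : ℂ) ^ 2) := by
      intro i
      rw [← sum_linMult_sq (h.comm i), sum_linear_ne_one]
      simp only [linMult_eq_natMult]
    rw [← h2, inv_one, apply_one_eq_degree] at h1
    simp only [h4, ← sq] at h1
    exact_mod_cast h1.symm

theorem even_card [Finite ι] [Nonempty ι] (h : SylowSystem A p r) : Even (Nat.card G) := by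
  classical
  have : Fintype ι := Fintype.ofFinite ι
  rw [← Nat.not_odd_iff_even]
  intro hodd
  choose w hw0 hw using h.exists_w
  have hd : ∀ i, Nat.card (A i) * r i ∣ Nat.card G := fun i => by
    rw [← h.card_norm i]
    exact card_subgroup_dvd_card _
  choose n hn using hd
  exact (h.characterData hodd hw0 hw hn).false

end SylowSystem

/-- A finite simple nonabelian group all of whose second maximal subgroups are abelian is
isomorphic to the alternating group of degree five. -/
theorem SecondAbelian.nonempty_mulEquiv {S : Type u} [Group S] [Finite S] [IsSimpleGroup S]
    (hS : SecondAbelian S) (hnc : ¬ IsCommSub (⊤ : Subgroup S)) :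
    Nonempty (S ≃* alternatingGroup (Fin 5)) := by
  classical
  have : Fintype S := Fintype.ofFinite S
  obtain ⟨A, r, h⟩ := exists_sylowSystem hS hnc
  have hi : Nonempty ↥(Nat.card S).primeFactors := by
    obtain ⟨n, hn, hd⟩ := Nat.exists_prime_and_dvd (Finite.one_lt_card (α := S)).ne'
    exact ⟨⟨n, Nat.mem_primeFactors.2 ⟨hn, hd, Nat.card_pos.ne'⟩⟩⟩
  obtain ⟨k, hk⟩ := h.p_surj 2 Nat.prime_two h.even_card.two_dvd
  obtain ⟨h1, h2⟩ := h.even_case hk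
  exact nonempty_mulEquiv_alternatingGroup h.perfect h1 _ h2

lemma exists_finiteIndex_comap {G H : Type*} [Group G] [Group H] {f : H →* G}
    (hf : Function.Surjective f) (h : ∃ K : Subgroup G, K ≠ ⊤ ∧ K.FiniteIndex) :
    ∃ K : Subgroup H, K ≠ ⊤ ∧ K.FiniteIndex := by
  obtain ⟨L, hL, hfi⟩ := h
  refine ⟨L.comap f, fun h => hL ?_, ⟨by rw [index_comap_of_surjective L hf]; exact hfi.index_ne_zero⟩⟩
  rw [← map_comap_eq_self_of_surjective hf L, h, map_top_of_surjective _ hf]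

lemma LocallyGraded.of_injective {G H : Type*} [Group G] [Group H] (hG : LocallyGraded G)
    {f : H →* G} (hf : Function.Injective f) : LocallyGraded H := by
  intro K hK hfg
  let e := K.equivMapOfInjective f hf
  have : Group.FG (K.map f) := Group.fg_of_surjective (f := e.toMonoidHom) e.surjective
  exact exists_finiteIndex_comap (f := e.toMonoidHom) e.surjective
    (hG (K.map f) (by rwa [Ne, map_eq_bot_iff_of_injective _ hf]) this)

lemma LocallyGraded.exists_finiteIndex {G : Type*} [Group G] [Nontrivial G] (hG : LocallyGraded G)
    (hfg : Group.FG G) : ∃ K : Subgroup G, K ≠ ⊤ ∧ K.FiniteIndex := by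
  let e : G ≃* (⊤ : Subgroup G) := topEquiv.symm
  exact exists_finiteIndex_comap (f := e.toMonoidHom) e.surjective
    (hG ⊤ top_ne_bot (Group.fg_of_surjective (f := e.toMonoidHom) e.surjective))

lemma IsCommSub.commutator_eq_bot {G : Type*} [Group G] {H : Subgroup G} (h : IsCommSub H) :
    ⁅H, H⁆ = ⊥ := by
  rw [eq_bot_iff, commutator_le]
  intro a ha b hb
  rw [mem_bot, commutatorElement_eq_one_iff_mul_comm]
  exact h a ha b hb

lemma IsCommSub.map {G H : Type*} [Group G] [Group H] {K : Subgroup G} (h : IsCommSub K)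
    (f : G →* H) : IsCommSub (K.map f) := by
  rintro _ ⟨a, ha, rfl⟩ _ ⟨b, hb, rfl⟩
  rw [← map_mul, h a ha b hb, map_mul]

lemma IsCommSub.of_map {G H : Type*} [Group G] [Group H] {K : Subgroup G} {f : G →* H}
    (hf : Function.Injective f) (h : IsCommSub (K.map f)) : IsCommSub K := by
  intro a ha b hb
  apply hf
  rw [map_mul, map_mul, h _ (mem_map_of_mem f ha) _ (mem_map_of_mem f hb)]

lemma not_isCommSub_top {G : Type*} [Group G] [Nontrivial G]
    (hperf : _root_.commutator G = ⊤) : ¬ IsCommSub (⊤ : Subgroup G) := fun h =>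
  bot_ne_top (α := Subgroup G) (h.commutator_eq_bot.symm.trans hperf)

lemma commutator_quotient_eq_top {G : Type*} [Group G] (hperf : _root_.commutator G = ⊤)
    (N : Subgroup G) [N.Normal] : _root_.commutator (G ⧸ N) = ⊤ := by
  have h := map_commutator ⊤ ⊤ (QuotientGroup.mk' N)
  rw [map_top_of_surjective _ (QuotientGroup.mk'_surjective N)] at h
  rw [_root_.commutator_def, ← h, ← _root_.commutator_def, hperf,
    map_top_of_surjective _ (QuotientGroup.mk'_surjective N)]

/-- A nontrivial finite group all of whose proper subgroups are abelian is not perfect. -/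
lemma commutator_ne_top_of_finite {Q : Type*} [Group Q] [Finite Q] [Nontrivial Q]
    (h : ∀ H : Subgroup Q, H ≠ ⊤ → IsCommSub H) : _root_.commutator Q ≠ ⊤ := by
  intro hperf
  have hsyl : ∀ (p : ℕ), Fact p.Prime → ∀ P : Sylow p Q, (P : Subgroup Q).Normal := by
    intro p _ P
    rw [← normalizer_eq_top_iff]
    by_contra hP
    have hb : (P : Subgroup Q) ≠ ⊥ := by
      intro hb
      exact hP (normalizer_eq_top_iff.2 (by rw [hb]; infer_instance))
    refine sylow_not_normalizer_le_centralizer hperf P hb fun a ha => ?_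
    rw [mem_centralizer_iff]
    exact fun b hb => h _ hP b (le_normalizer hb) a ha
  have : Group.IsNilpotent Q := (Group.isNilpotent_of_finite_tfae.out 0 3).2 hsyl
  exact (Group.IsSolvable.commutator_lt_top_of_nontrivial Q).ne hperf

lemma exists_normal_finiteIndex {T : Type*} [Group T] {K : Subgroup T} (hK : K ≠ ⊤)
    [K.FiniteIndex] : ∃ N : Subgroup T, N.Normal ∧ N.FiniteIndex ∧ N ≠ ⊤ :=
  ⟨K.normalCore, inferInstance, inferInstance, fun h => hK (top_le_iff.1 (h ▸ K.normalCore_le))⟩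

/-- A locally graded group all of whose proper subgroups are abelian is metabelian. -/
lemma LocallyGraded.isCommSub_commutator {M : Type*} [Group M] (hM : LocallyGraded M)
    (h : ∀ H : Subgroup M, H ≠ ⊤ → IsCommSub H) : IsCommSub (_root_.commutator M) := by
  by_cases hperf : _root_.commutator M = ⊤
  · by_contra hnc
    rw [hperf] at hnc
    obtain ⟨x, y, hxy⟩ : ∃ x y : M, x * y ≠ y * x := by
      by_contra! hcon
      exact hnc fun a _ b _ => hcon a b
    have hcl : closure {x, y} = (⊤ : Subgroup M) := by
      by_contra hne
      exact hxy (h _ hne x (subset_closure (by simp)) y (subset_closure (by simp)))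
    have : Nontrivial M := ⟨x * y, y * x, hxy⟩
    obtain ⟨K, hK, _⟩ := hM.exists_finiteIndex (Group.fg_iff.2 ⟨{x, y}, hcl, Set.toFinite _⟩)
    obtain ⟨N, hN, _, hNt⟩ := exists_normal_finiteIndex hK
    have : Nontrivial (M ⧸ N) := QuotientGroup.nontrivial_iff.2 hNt
    refine commutator_ne_top_of_finite (Q := M ⧸ N) (fun H hH => ?_)
      (commutator_quotient_eq_top hperf N)
    rw [← map_comap_eq_self_of_surjective (QuotientGroup.mk'_surjective N) H]
    refine (h _ fun he => hH ?_).map _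
    rw [← map_comap_eq_self_of_surjective (QuotientGroup.mk'_surjective N) H, he,
      map_top_of_surjective _ (QuotientGroup.mk'_surjective N)]
  · exact h _ hperf

/-- A group with a proper subgroup of finite index has a finite simple quotient. -/
lemma exists_simple_quotient {T : Type*} [Group T] {K : Subgroup T} (hK : K ≠ ⊤)
    [K.FiniteIndex] :
    ∃ (N : Subgroup T) (_ : N.Normal), N.FiniteIndex ∧ IsSimpleGroup (T ⧸ N) := by
  classical
  have hex : ∃ n, ∃ N : Subgroup T, (N.Normal ∧ N.FiniteIndex ∧ N ≠ ⊤) ∧ N.index = n := by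
    obtain ⟨N, hN⟩ := exists_normal_finiteIndex hK
    exact ⟨_, N, hN, rfl⟩
  obtain ⟨N, ⟨hN, hfi, hNt⟩, hind⟩ := Nat.find_spec hex
  have : Nontrivial (T ⧸ N) := QuotientGroup.nontrivial_iff.2 hNt
  refine ⟨N, hN, hfi, ⟨fun H hH => ?_⟩⟩
  by_contra! hcon
  have hle : N ≤ H.comap (QuotientGroup.mk' N) := by
    intro x hx
    rw [mem_comap, QuotientGroup.mk'_apply, (QuotientGroup.eq_one_iff x).2 hx]
    exact one_mem H
  have hmap := map_comap_eq_self_of_surjective (QuotientGroup.mk'_surjective N) H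
  have hlt : N < H.comap (QuotientGroup.mk' N) := by
    refine lt_of_le_of_ne hle fun he => hcon.1 ?_
    rw [← hmap, ← he, QuotientGroup.map_mk'_self]
  have hfi' : (H.comap (QuotientGroup.mk' N)).FiniteIndex := finiteIndex_of_le hle
  have h1 := index_strictAnti hlt
  refine Nat.find_min hex (hind ▸ h1) ⟨_, ⟨inferInstance, hfi', fun he => hcon.2 ?_⟩, rfl⟩
  rw [← hmap, he, map_top_of_surjective _ (QuotientGroup.mk'_surjective N)]

section central

variable {T : Type*} [Group T] {N : Subgroup T} [N.Normal] [IsSimpleGroup (T ⧸ N)]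

lemma secondAbelian_quotient (hT : ∀ U : Subgroup T, ¬ U.Normal → ∀ K < U, IsCommSub K) :
    SecondAbelian (T ⧸ N) := by
  intro K H hKH hH
  have hs := QuotientGroup.mk'_surjective N
  rw [← map_comap_eq_self_of_surjective hs K]
  refine (hT (H.comap (QuotientGroup.mk' N)) (fun hn => ?_) _
    ((comap_lt_comap_of_surjective hs).2 hKH)).map _
  have : H.Normal := map_comap_eq_self_of_surjective hs H ▸ hn.map _ hs
  rcases IsSimpleGroup.eq_bot_or_eq_top_of_normal H this with h | h
  · exact not_lt_bot (h ▸ hKH)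
  · exact hH h

/-- In a perfect group, the kernel of a finite simple quotient is trivial if the preimages of
proper nonmaximal subgroups are abelian. -/
lemma eq_bot_of_perfect [N.FiniteIndex]
    (hT : ∀ U : Subgroup T, ¬ U.Normal → ∀ K < U, IsCommSub K)
    (hperf : _root_.commutator T = ⊤) : N = ⊥ := by
  have hS := secondAbelian_quotient (N := N) hT
  have : Finite (T ⧸ N) := finite_quotient_of_finiteIndex
  have hnt : Nontrivial (T ⧸ N) := IsSimpleGroup.toNontrivial
  have hs := QuotientGroup.mk'_surjective N
  have hnc := not_isCommSub_top (commutator_quotient_eq_top hperf N)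
  obtain ⟨A, r, h⟩ := exists_sylowSystem hS hnc
  have hcomm : ∀ i, IsCommSub ((A i).comap (QuotientGroup.mk' N)) := by
    intro i
    have hne : A i ≠ normalizer (A i : Set (T ⧸ N)) := by
      obtain ⟨y, hy, hyA⟩ := h.exists_normalizer_not_mem i
      intro he
      exact hyA (he ▸ hy)
    have hbot : A i ≠ ⊥ := by
      intro hb
      have := h.two_le_card i
      rw [hb, card_bot] at this
      omega
    have hmap := map_comap_eq_self_of_surjective hs (normalizer (A i : Set (T ⧸ N)))
    refine hT ((normalizer (A i : Set (T ⧸ N))).comap (QuotientGroup.mk' N)) (fun hn => ?_) _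
      ((comap_lt_comap_of_surjective hs).2 (lt_of_le_of_ne le_normalizer hne))
    have : (normalizer (A i : Set (T ⧸ N))).Normal := hmap ▸ hn.map _ hs
    rcases IsSimpleGroup.eq_bot_or_eq_top_of_normal _ this with h' | h'
    · exact hbot (le_bot_iff.1 (h' ▸ le_normalizer))
    · exact h.norm_ne_top i h'
  have hker : ∀ i, N ≤ (A i).comap (QuotientGroup.mk' N) := by
    intro i x hx
    rw [mem_comap, QuotientGroup.mk'_apply, (QuotientGroup.eq_one_iff x).2 hx]
    exact one_mem _
  have hcov : ∀ x : T, ∃ i t, t * x * t⁻¹ ∈ (A i).comap (QuotientGroup.mk' N) := by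
    intro x
    rcases eq_or_ne (QuotientGroup.mk' N x) 1 with hx | hx
    · obtain ⟨s, hs1⟩ := exists_ne (1 : T ⧸ N)
      obtain ⟨i, -⟩ := h.cover s hs1
      exact ⟨i, 1, by simp [hx, one_mem]⟩
    · obtain ⟨i, g, hg⟩ := h.cover _ hx
      obtain ⟨t, rfl⟩ := hs g
      exact ⟨i, t, by simpa using hg⟩
  have hcen : ∀ n ∈ N, ∀ x : T, n * x = x * n := by
    intro n hn x
    obtain ⟨i, t, ht⟩ := hcov x
    have h1 := hcomm i _ ht _ (hker i (Normal.conj_mem inferInstance n hn t))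
    calc n * x = t⁻¹ * ((t * n * t⁻¹) * (t * x * t⁻¹)) * t := by group
      _ = t⁻¹ * ((t * x * t⁻¹) * (t * n * t⁻¹)) * t := by rw [h1]
      _ = _ := by group
  rw [eq_bot_iff]
  intro n hn
  have hpow : ∀ i, n ^ (A i).index = 1 := by
    intro i
    let B := (A i).comap (QuotientGroup.mk' N)
    have hB : B.FiniteIndex := finiteIndex_of_le (hker i)
    let _ : CommGroup B :=
      { (inferInstance : Group B) with
        mul_comm := fun a b => Subtype.ext (hcomm i a a.2 b b.2) }
    have h1 := MonoidHom.transfer_eq_pow (MonoidHom.id B) n fun k g _ => by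
      rw [mul_assoc, hcen _ (pow_mem hn k), inv_mul_cancel_left]
    have h2 : (MonoidHom.transfer (MonoidHom.id B)).ker = ⊤ := by
      rw [eq_top_iff, ← hperf]
      exact Abelianization.commutator_subset_ker _
    have h3 : MonoidHom.transfer (MonoidHom.id B) n = 1 := by
      rw [← MonoidHom.mem_ker, h2]
      trivial
    rw [h1] at h3
    have h4 : n ^ B.index = 1 := congrArg Subtype.val h3
    rwa [index_comap_of_surjective _ hs] at h4
  rw [mem_bot, ← orderOf_eq_one_iff]
  by_contra ho
  obtain ⟨p, hp, hd⟩ := Nat.exists_prime_and_dvd ho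
  obtain ⟨s, hs1⟩ := exists_ne (1 : T ⧸ N)
  obtain ⟨j, -⟩ := h.cover s hs1
  have hdiv : ∀ i, p ∣ (A i).index := fun i => hd.trans (orderOf_dvd_of_pow_eq_one (hpow i))
  obtain ⟨i, hi⟩ := h.p_surj p hp ((hdiv j).trans (index_dvd_card _))
  exact h.index i (by simpa only [hi] using hdiv i)

end central

section reduction

variable {G : Type u} [Group G]

lemma commutator_le_center_of_forall_normal {Q : Type*} [Group Q]
    (h : ∀ K : Subgroup Q, K.Normal) : _root_.commutator Q ≤ center Q := by
  rw [_root_.commutator_def, commutator_le]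
  intro a _ b _
  have key : ∀ x : Q, a * b * x * (a * b)⁻¹ = b * a * x * (b * a)⁻¹ := by
    intro x
    obtain ⟨i, hi⟩ := mem_zpowers_iff.1 ((h (zpowers x)).conj_mem x (mem_zpowers x) a)
    obtain ⟨j, hj⟩ := mem_zpowers_iff.1 ((h (zpowers x)).conj_mem x (mem_zpowers x) b)
    have h1 : a * b * x * (a * b)⁻¹ = a * (b * x * b⁻¹) * a⁻¹ := by group
    have h2 : b * a * x * (b * a)⁻¹ = b * (a * x * a⁻¹) * b⁻¹ := by group
    rw [h1, h2, ← hi, ← hj, ← conj_zpow, ← conj_zpow, ← hi, ← hj, ← zpow_mul, ← zpow_mul, mul_comm]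
  rw [mem_center_iff]
  intro x
  have h1 := key ((b * a)⁻¹ * x * (b * a))
  have h2 : b * a * ((b * a)⁻¹ * x * (b * a)) * (b * a)⁻¹ = x := by group
  rw [h2] at h1
  have h3 : ⁅a, b⁆ * x * ⁅a, b⁆⁻¹ = x := by
    rw [commutatorElement_def]
    refine Eq.trans ?_ h1
    group
  exact (mul_inv_eq_iff_eq_mul.1 h3).symm

lemma normal_of_not_isCommSub (hlg : LocallyGraded G)
    (hp : ∀ U : Subgroup G, ¬ U.Normal → ∀ K < U, IsCommSub K) {H : Subgroup G}
    (hH : ¬ IsCommSub ⁅H, H⁆) : H.Normal := by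
  by_contra hn
  apply hH
  have h1 := (hlg.of_injective H.subtype_injective).isCommSub_commutator fun K hK => by
    refine IsCommSub.of_map H.subtype_injective (hp H hn _ ?_)
    refine lt_of_le_of_ne (map_subtype_le K) fun he => hK ?_
    apply map_injective H.subtype_injective
    rw [he, ← MonoidHom.range_eq_map, range_subtype]
  have h2 := h1.map H.subtype
  rwa [_root_.commutator_def, map_commutator, ← MonoidHom.range_eq_map, range_subtype] at h2

lemma derivedSeries_two_le (hlg : LocallyGraded G)
    (hp : ∀ U : Subgroup G, ¬ U.Normal → ∀ K < U, IsCommSub K) {H : Subgroup G}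
    (hH : ¬ IsCommSub ⁅H, H⁆) : derivedSeries G 2 ≤ H := by
  have hn : ∀ K, H ≤ K → K.Normal := fun K hK =>
    normal_of_not_isCommSub hlg hp fun hc => hH (hc.mono (commutator_mono hK hK))
  have := hn H le_rfl
  have hs := QuotientGroup.mk'_surjective H
  have h1 : _root_.commutator (G ⧸ H) ≤ center (G ⧸ H) := by
    refine commutator_le_center_of_forall_normal fun K => ?_
    rw [← map_comap_eq_self_of_surjective hs K]
    refine (hn _ fun x hx => ?_).map _ hs
    rw [mem_comap, QuotientGroup.mk'_apply, (QuotientGroup.eq_one_iff x).2 hx]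
    exact one_mem _
  have h2 : (derivedSeries G 2).map (QuotientGroup.mk' H) = derivedSeries (G ⧸ H) 2 :=
    map_derivedSeries_eq hs 2
  have h3 : derivedSeries (G ⧸ H) 2 = ⊥ := by
    rw [derivedSeries_succ, derivedSeries_one]
    refine IsCommSub.commutator_eq_bot fun a ha b _ => ?_
    exact (mem_center_iff.1 (h1 ha) b).symm
  rw [h3, Subgroup.map_eq_bot_iff, QuotientGroup.ker_mk'] at h2
  exact h2

lemma not_isCommSub_derivedSeries (hins : ¬ Group.IsSolvable G) (n : ℕ) :
    ¬ IsCommSub (derivedSeries G n) := fun h =>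
  hins ⟨n + 1, by rw [derivedSeries_succ]; exact h.commutator_eq_bot⟩

lemma commutator_derivedSeries_two (hlg : LocallyGraded G) (hins : ¬ Group.IsSolvable G)
    (hp : ∀ U : Subgroup G, ¬ U.Normal → ∀ K < U, IsCommSub K) :
    ⁅derivedSeries G 2, derivedSeries G 2⁆ = derivedSeries G 2 := by
  refine le_antisymm (commutator_le_self _) (derivedSeries_two_le hlg hp ?_)
  rw [← derivedSeries_succ, ← derivedSeries_succ]
  exact not_isCommSub_derivedSeries hins 4

lemma fg_derivedSeries_two (hlg : LocallyGraded G) (hins : ¬ Group.IsSolvable G)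
    (hp : ∀ U : Subgroup G, ¬ U.Normal → ∀ K < U, IsCommSub K) :
    Group.FG (derivedSeries G 2) := by
  have h1 : ∃ a ∈ derivedSeries G 2, ∃ b ∈ derivedSeries G 2, ∃ c ∈ derivedSeries G 2,
      ∃ d ∈ derivedSeries G 2, ⁅a, b⁆ * ⁅c, d⁆ ≠ ⁅c, d⁆ * ⁅a, b⁆ := by
    by_contra! hcon
    apply not_isCommSub_derivedSeries hins 3
    rw [derivedSeries_succ, Subgroup.commutator_def]
    apply isCommSub_closure
    rintro _ ⟨a, ha, b, hb, rfl⟩ _ ⟨c, hc, d, hd, rfl⟩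
    exact hcon a ha b hb c hc d hd
  obtain ⟨a, ha, b, hb, c, hc, d, hd, hne⟩ := h1
  rw [Group.fg_iff_subgroup_fg, fg_iff]
  refine ⟨{a, b, c, d}, le_antisymm ?_ (derivedSeries_two_le hlg hp fun h => hne ?_),
    Set.toFinite _⟩
  · rw [closure_le]
    rintro x (rfl | rfl | rfl | rfl) <;> assumption
  · exact h _ (commutator_mem_commutator (subset_closure (by simp)) (subset_closure (by simp))) _
      (commutator_mem_commutator (subset_closure (by simp)) (subset_closure (by simp)))

/-- Frattini argument: a finite simple normal subgroup is the whole group. -/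
lemma eq_top_of_isSimpleGroup (hp : ∀ U : Subgroup G, ¬ U.Normal → ∀ K < U, IsCommSub K)
    {R : Subgroup G} [R.Normal] [Finite R] [IsSimpleGroup R]
    (hperf : _root_.commutator R = ⊤) : R = ⊤ := by
  by_contra hR
  have hnt : Nontrivial R := IsSimpleGroup.toNontrivial
  have hnc := not_isCommSub_top hperf
  obtain ⟨p, hpr, hd⟩ := Nat.exists_prime_and_dvd (Finite.one_lt_card (α := R)).ne'
  have : Fact p.Prime := ⟨hpr⟩
  obtain ⟨P⟩ : Nonempty (Sylow p R) := inferInstance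
  have hb : (P : Subgroup R) ≠ ⊥ := P.ne_bot_of_dvd_card hd
  have hN := sylow_not_normalizer_le_centralizer hperf P hb
  have hNt : normalizer ((P : Subgroup R) : Set R) ≠ ⊤ := normalizer_ne_top hb (sylow_ne_top hnc P.2)
  have hsup := Sylow.normalizer_sup_eq_top P
  set M := normalizer (((P : Subgroup R).map R.subtype : Subgroup G) : Set G) with hM
  have hmem : ∀ x : R, (x : G) ∈ M ↔ x ∈ normalizer ((P : Subgroup R) : Set R) := by
    intro x
    have hP : ∀ y : R, (y : G) ∈ ((P : Subgroup R).map R.subtype : Subgroup G) ↔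
        y ∈ (P : Subgroup R) := fun y => mem_map_iff_mem R.subtype_injective
    have hRP : ∀ y : G, y ∉ R → y ∉ ((P : Subgroup R).map R.subtype : Subgroup G) :=
      fun y hy h => hy (map_subtype_le _ h)
    rw [hM, mem_normalizer_iff, mem_normalizer_iff]
    constructor
    · intro h y
      have h1 := h y
      rwa [hP, show (x : G) * y * (x : G)⁻¹ = ((x * y * x⁻¹ : R) : G) from rfl, hP] at h1
    · intro h y
      by_cases hy : y ∈ R
      · have h1 := h ⟨y, hy⟩
        rwa [← hP, ← hP] at h1
      · refine iff_of_false (hRP y hy) (hRP _ fun h1 => hy ?_)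
        have h2 := R.mul_mem (R.mul_mem (R.inv_mem x.2) h1) x.2
        rwa [show (x : G)⁻¹ * (x * y * (x : G)⁻¹) * x = y by group] at h2
  have hnot : ¬ IsCommSub (M ⊓ R) := by
    intro hc
    refine hN fun x hx => mem_centralizer_iff.2 fun y hy => Subtype.ext ?_
    exact hc y ⟨(hmem y).2 (le_normalizer hy), y.2⟩ x ⟨(hmem x).2 hx, x.2⟩
  have hMn : M.Normal := by
    by_contra hcon
    refine hnot (hp M hcon _ (lt_of_le_of_ne inf_le_left fun he => hR ?_))
    rwa [sup_eq_right.2 (inf_eq_left.1 he)] at hsup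
  have hn : (normalizer ((P : Subgroup R) : Set R)).Normal := by
    refine ⟨fun x hx g => ?_⟩
    rw [← hmem] at hx ⊢
    exact hMn.conj_mem x hx g
  rcases IsSimpleGroup.eq_bot_or_eq_top_of_normal _ hn with h | h
  · exact hb (le_bot_iff.1 (h ▸ le_normalizer))
  · exact hNt h

end reduction

/-- A locally graded insoluble group in which every subgroup properly containing a nonabelian
subgroup is normal is isomorphic to the alternating group of degree five. -/
theorem LocallyGraded.nonempty_mulEquiv {G : Type u} [Group G] (hlg : LocallyGraded G)
    (hins : ¬ Group.IsSolvable G)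
    (hp : ∀ U : Subgroup G, ¬ U.Normal → ∀ K < U, IsCommSub K) :
    Nonempty (G ≃* alternatingGroup (Fin 5)) := by
  set R := derivedSeries G 2 with hR
  have hinj := R.subtype_injective
  have hRn : R.Normal := derivedSeries_normal G 2
  have hnc : ¬ IsCommSub R := not_isCommSub_derivedSeries hins 2
  have hperf : _root_.commutator R = ⊤ := by
    apply map_injective hinj
    rw [_root_.commutator_def, map_commutator, ← MonoidHom.range_eq_map, range_subtype]
    exact commutator_derivedSeries_two hlg hins hp
  have hnt : Nontrivial R := by
    by_contra h
    rw [not_nontrivial_iff_subsingleton] at h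
    exact hnc fun a ha b hb => congrArg Subtype.val
      (Subsingleton.elim ((⟨a, ha⟩ * ⟨b, hb⟩ : R)) (⟨b, hb⟩ * ⟨a, ha⟩))
  have hT : ∀ U : Subgroup R, ¬ U.Normal → ∀ K < U, IsCommSub K := by
    intro U hU K hK
    refine IsCommSub.of_map hinj (hp (U.map R.subtype) (fun h => hU ?_) _
      ((map_lt_map_iff_of_injective hinj).2 hK))
    rw [← comap_map_eq_self_of_injective hinj U]
    exact h.comap _
  obtain ⟨K, hK, _⟩ := (hlg.of_injective hinj).exists_finiteIndex (fg_derivedSeries_two hlg hins hp)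
  obtain ⟨N, _, _, _⟩ := exists_simple_quotient hK
  have hN := eq_bot_of_perfect (N := N) hT hperf
  subst hN
  let e : R ⧸ (⊥ : Subgroup R) ≃* R := QuotientGroup.quotientBot
  have : Finite (R ⧸ (⊥ : Subgroup R)) := finite_quotient_of_finiteIndex
  have : Finite R := Finite.of_equiv _ e.toEquiv
  obtain ⟨f⟩ := (secondAbelian_quotient (N := (⊥ : Subgroup R)) hT).nonempty_mulEquiv
    (not_isCommSub_top (commutator_quotient_eq_top hperf _))
  have : IsSimpleGroup R := e.symm.isSimpleGroup
  have htop := eq_top_of_isSimpleGroup hp hperf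
  exact ⟨(topEquiv.symm.trans ((MulEquiv.subgroupCongr htop).symm.trans e.symm)).trans f⟩

theorem LocallyGraded.nonempty_mulEquiv_of_parahamiltonian {G : Type u} [Group G]
    (hlg : LocallyGraded G) (hinsol : ¬ Group.IsSolvable G) (hpara : Parahamiltonian G) :
    Nonempty (G ≃* alternatingGroup (Fin 5)) := by
  refine hlg.nonempty_mulEquiv hinsol fun U hU K hK a ha b hb => ?_
  rcases hpara.2 U hU with h | h
  · exact congrArg Subtype.val (h ⟨a, hK.le ha⟩ ⟨b, hK.le hb⟩)
  · have hne : K.subgroupOf U ≠ ⊤ := fun he => hK.not_ge (subgroupOf_eq_top.1 he)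
    exact congrArg (fun x : K.subgroupOf U => ((x : U) : G))
      (h.2 _ hne ⟨⟨a, hK.le ha⟩, ha⟩ ⟨⟨b, hK.le hb⟩, hb⟩)

end

/-- A locally graded insoluble parahamiltonian group is isomorphic to $A_5$. -/
theorem stmt_7 {G : Type*} [Group G]
    (hlg : LocallyGraded G) (hinsol : ¬ IsSolvable G) (hpara : Parahamiltonian G) :
    Nonempty (G ≃* ↥(alternatingGroup (Fin 5))) := by
  exact hlg.nonempty_mulEquiv_of_parahamiltonian hinsol hpara
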